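/- (Hyperbolic secant laws.) Fix k ∈ (0,1) and let c_k = π/(2kK(k)), C_k = π·sinh(2πT_k)/(2K(k)). Then: (a) for every α ∈ (π/2)ℤ, Σ_{j=0}^∞ k^j(1−k)·4^{−(j+1)}·N^□_j(α) = c_k·sech(4T_kα) + ((k−1)/k)·1_{α=0}, where N^□_j(α) is the number of simple rectilinear walks w of length j+1 started at the origin for which the winding angle around (−1/2,−1/2) of the polygonal path w_0,…,w_j,(w_j+w_{j+1})/2 lies in (α−π/2, α+π/2); and (b) for every α ∈ (π/2)ℤ + π/4, Σ_{j=0}^∞ k^j(1−k)·4^{−(j+1)}·N^•_j(α) = C_k·sech(4T_k(α−π/4))·sech(4T_k(α+π/4)), where N^•_j(α) is the number of simple rectilinear walks w of length j+1 started at the origin with w_i ≠ (0,0) for 1 ≤ i ≤ j and for which the winding angle around (0,0) of the polygonal path w_0,…,w_j,(w_j+w_{j+1})/2 (omitting the first increment, which starts at the origin) lies in (α−π/2, α+π/2). -/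

import Mathlib

open Complex Real Set

noncomputable section

/-- A lattice point `(x,y)` viewed as the complex number `x + iy`. -/
def ptC (p : ℤ × ℤ) : ℂ := (p.1 : ℂ) + (p.2 : ℂ) * Complex.I

/-- A diagonal step on `ℤ²`. -/
def IsDiagStep (a b : ℤ × ℤ) : Prop :=
  b - a = (1, 1) ∨ b - a = (1, -1) ∨ b - a = (-1, -1) ∨ b - a = (-1, 1)

/-- A rectilinear step on `ℤ²`. -/
def IsRectStep (a b : ℤ × ℤ) : Prop :=
  b - a = (1, 0) ∨ b - a = (-1, 0) ∨ b - a = (0, 1) ∨ b - a = (0, -1)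

/-- `w` encodes a simple diagonal walk `(w₀, …, w_n)` as a list of length `n+1`. -/
def IsWalkList (w : List (ℤ × ℤ)) : Prop := w ≠ [] ∧ w.Chain' IsDiagStep

/-- Winding angle of the walk `w` around the origin up to time `i`. -/
def windTo (w : List (ℤ × ℤ)) (i : ℕ) : ℝ :=
  ∑ j ∈ Finset.range i, (ptC (w.getD (j + 1) 0) / ptC (w.getD j 0)).arg

/-- The full winding angle of the walk `w` around the origin. -/
def wind (w : List (ℤ × ℤ)) : ℝ := windTo w (w.length - 1)

/-- The condition on walks counted by `W^{(α,I)}_{l,p}`: a simple diagonal walk on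
`ℤ² ∖ {0}` from `(p,0)` to a point on one of the axes at distance `l` from the origin,
with full winding angle `α` and intermediate winding angles in `I`. -/
def WCond (l p : ℕ) (α : ℝ) (I : Set ℝ) (w : List (ℤ × ℤ)) : Prop :=
  IsWalkList w ∧ (∀ x ∈ w, x ≠ (0, 0)) ∧ w.head? = some ((p : ℤ), 0) ∧
    (w.getLast? = some ((l : ℤ), 0) ∨ w.getLast? = some (-(l : ℤ), 0) ∨
      w.getLast? = some (0, (l : ℤ)) ∨ w.getLast? = some (0, -(l : ℤ))) ∧
    wind w = α ∧ (∀ i, 1 ≤ i → i ≤ w.length - 2 → windTo w i ∈ I)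

/-- The generating function `W^{(α,I)}_{l,p}(t)`. -/
def Wgen (t : ℝ) (l p : ℕ) (α : ℝ) (I : Set ℝ) : ℝ :=
  ∑' w : {w : List (ℤ × ℤ) // WCond l p α I w}, t ^ (w.val.length - 1)

/-- The complete elliptic integral of the first kind `K(k)`. -/
def Kell (k : ℝ) : ℝ := ∫ y in (0:ℝ)..1, 1 / Real.sqrt ((1 - y ^ 2) * (1 - k ^ 2 * y ^ 2))

/-- The complete elliptic integral of the second kind `E(k)`. -/
def Eell (k : ℝ) : ℝ := ∫ y in (0:ℝ)..1, Real.sqrt (1 - k ^ 2 * y ^ 2) / Real.sqrt (1 - y ^ 2)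

/-- The complementary modulus `k' = √(1-k²)`. -/
def kComp (k : ℝ) : ℝ := Real.sqrt (1 - k ^ 2)

/-- The elliptic nome `q_k = exp(-π K(k')/K(k))`. -/
def qNome (k : ℝ) : ℝ := Real.exp (-π * Kell (kComp k) / Kell k)

/-- The descending Landen transformation `k₁ = (1-k')/(1+k')`. -/
def kLanden (k : ℝ) : ℝ := (1 - kComp k) / (1 + kComp k)

/-- `T_k = K(k')/(4K(k))`. -/
def Tell (k : ℝ) : ℝ := Kell (kComp k) / (4 * Kell k)

/-- The plane minus the two real slits `{z ∈ ℝ : z² ≥ κ}`. -/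
def slitDom (κ : ℝ) : Set ℂ := {z : ℂ | ¬(z.im = 0 ∧ κ ≤ z.re ^ 2)}

/-- `v` is the analytic function `v_κ` on `ℂ ∖ {z ∈ ℝ : z² ≥ κ}` with `v 0 = 0` and
`v'(z) = 1/(4K(κ)√((κ-z²)(1-κz²)))`, the branch of the square root being positive on
`(-√κ, √κ)` (by analytic continuation this determines `v` uniquely). -/
structure IsVmap (κ : ℝ) (v : ℂ → ℂ) : Prop where
  map_zero : v 0 = 0
  analytic : AnalyticOnNhd ℂ v (slitDom κ)
  deriv_real : ∀ x : ℝ, x ^ 2 < κ →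
    HasDerivAt v ((1 / (4 * Kell κ * Real.sqrt ((κ - x ^ 2) * (1 - κ * x ^ 2))) : ℝ) : ℂ)
      (x : ℂ)

/-- The function `f_m(z) = cos(2πm(v(z) + 1/4)) - cos(πm/2)` built from `v = v_{k₁}`. -/
def fmFun (v : ℂ → ℂ) (m : ℕ) (z : ℂ) : ℂ :=
  Complex.cos (2 * (π : ℂ) * m * (v z + 1 / 4)) - Complex.cos ((π : ℂ) * m / 2)

/-- `a n m` is the (real) Taylor coefficient `[zⁿ] f_m(z)` at `0`. -/
def IsCoeff (κ : ℝ) (v : ℂ → ℂ) (a : ℕ → ℕ → ℝ) : Prop :=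
  ∀ m : ℕ, 1 ≤ m → ∀ z : ℂ, z ∈ slitDom κ → ‖z‖ < 1 →
    HasSum (fun n : ℕ => (a n m : ℂ) * z ^ n) (fmFun v m z)

/-- An excursion: a nonempty simple diagonal walk from the origin to the origin with no
intermediate visits to the origin. -/
def IsExcursion (w : List (ℤ × ℤ)) : Prop :=
  2 ≤ w.length ∧ w.Chain' IsDiagStep ∧ w.head? = some (0, 0) ∧ w.getLast? = some (0, 0) ∧
    ∀ i, 1 ≤ i → i ≤ w.length - 2 → w.getD i 0 ≠ (0, 0)

/-- The winding angle sequence of an excursion: `θ₀ = θ₁ = 0`, increments of the first and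
last step do not contribute, and `θ_n = θ_{n-1}`. -/
def windExcTo (w : List (ℤ × ℤ)) (i : ℕ) : ℝ :=
  ∑ j ∈ Finset.Icc 2 (min i (w.length - 2)), (ptC (w.getD j 0) / ptC (w.getD (j - 1) 0)).arg

/-- The full winding angle of an excursion. -/
def windExc (w : List (ℤ × ℤ)) : ℝ := windExcTo w (w.length - 1)

/-- `F^{(α)}(t)`: generating function of excursions with winding angle `α`. -/
def Fgen (t α : ℝ) : ℝ :=
  ∑' w : {w : List (ℤ × ℤ) // IsExcursion w ∧ windExc w = α}, t ^ (w.val.length - 1)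

/-- `F(t,b) = Σ_w t^{|w|} e^{i b θ^w}`, the characteristic function of excursions. -/
def Fchar (t b : ℝ) : ℂ :=
  ∑' w : {w : List (ℤ × ℤ) // IsExcursion w},
    (t : ℂ) ^ (w.val.length - 1) * Complex.exp (Complex.I * b * windExc w.val)

/-- `ψ_k(z) = (1 - √(1-kz²))/(√k z)` (principal square root), `ψ_k(0) = 0`. -/
def psiK (k : ℝ) (z : ℂ) : ℂ :=
  if z = 0 then 0 else (1 - (1 - (k : ℂ) * z ^ 2) ^ ((1 : ℂ) / 2)) / ((Real.sqrt k : ℂ) * z)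

/-- The `i`-th point of the "half-step" polygonal path `w₀, …, w_j, (w_j + w_{j+1})/2`
associated to a walk `w` encoded as a list of length `j+2`. -/
def halfPt (w : List (ℤ × ℤ)) (i : ℕ) : ℂ :=
  if i + 1 < w.length then ptC (w.getD i 0)
  else (ptC (w.getD (w.length - 2) 0) + ptC (w.getD (w.length - 1) 0)) / 2

/-- Winding angle of the half-step path of `w` around `z`, summing the increments with
index `start ≤ i ≤ (length of the path)`. -/
def windHalf (w : List (ℤ × ℤ)) (z : ℂ) (start : ℕ) : ℝ :=
  ∑ i ∈ Finset.Icc start (w.length - 1), ((halfPt w i - z) / (halfPt w (i - 1) - z)).arg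

/-- `N^□_j(α)`: the number of simple rectilinear walks of length `j+1` started at the
origin whose half-step winding angle around `(-1/2,-1/2)` lies in `(α-π/2, α+π/2)`. -/
def Nsq (j : ℕ) (α : ℝ) : ℕ :=
  Nat.card {w : List (ℤ × ℤ) // w.length = j + 2 ∧ w.head? = some (0, 0) ∧
    w.Chain' IsRectStep ∧
    windHalf w (-(1 / 2) - (1 / 2) * Complex.I) 1 ∈ Set.Ioo (α - π / 2) (α + π / 2)}

/-- `N^•_j(α)`: the number of simple rectilinear walks of length `j+1` started at the
origin, avoiding the origin at times `1,…,j`, whose half-step winding angle around the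
origin (omitting the first increment) lies in `(α-π/2, α+π/2)`. -/
def Nbu (j : ℕ) (α : ℝ) : ℕ :=
  Nat.card {w : List (ℤ × ℤ) // w.length = j + 2 ∧ w.head? = some (0, 0) ∧
    w.Chain' IsRectStep ∧ (∀ i, 1 ≤ i → i ≤ j → w.getD i 0 ≠ (0, 0)) ∧
    windHalf w 0 2 ∈ Set.Ioo (α - π / 2) (α + π / 2)}

namespace HypSec

variable {k : ℝ}

/-- `√(1 - k² cos² φ)`. -/
def dk (k φ : ℝ) : ℝ := Real.sqrt (1 - k ^ 2 * Real.cos φ ^ 2)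

/-- `√(1 - k'² sin² χ)` for the complementary modulus `k'`. -/
def dc (k χ : ℝ) : ℝ := Real.sqrt (Real.cos χ ^ 2 + k ^ 2 * Real.sin χ ^ 2)

def uk (k φ : ℝ) : ℝ := ∫ x in (0:ℝ)..φ, 1 / dk k x

def tk (k χ : ℝ) : ℝ := ∫ x in (0:ℝ)..χ, 1 / dc k x

section
variable {k : ℝ} (hk : k ∈ Ioo (0 : ℝ) 1)

lemma dk_arg_pos (hk : k ∈ Ioo (0 : ℝ) 1) (φ : ℝ) : 0 < 1 - k ^ 2 * Real.cos φ ^ 2 := by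
  nlinarith [Real.cos_sq_le_one φ, hk.1, hk.2, mul_pos hk.1 hk.1]

lemma dk_pos (hk : k ∈ Ioo (0 : ℝ) 1) (φ : ℝ) : 0 < dk k φ := Real.sqrt_pos.2 (dk_arg_pos hk φ)

lemma dk_sq (hk : k ∈ Ioo (0 : ℝ) 1) (φ : ℝ) : dk k φ ^ 2 = 1 - k ^ 2 * Real.cos φ ^ 2 :=
  Real.sq_sqrt (dk_arg_pos hk φ).le

lemma dk_le_one (φ : ℝ) : dk k φ ≤ 1 := by
  refine Real.sqrt_le_one.2 ?_
  nlinarith [sq_nonneg (k * Real.cos φ)]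

lemma dc_arg_pos (hk : k ∈ Ioo (0 : ℝ) 1) (χ : ℝ) :
    0 < Real.cos χ ^ 2 + k ^ 2 * Real.sin χ ^ 2 := by
  have h := Real.sin_sq_add_cos_sq χ
  have h2 : 0 < k ^ 2 := pow_pos hk.1 2
  rcases eq_or_ne (Real.sin χ) 0 with h0 | h0
  · rw [h0] at h ⊢; nlinarith
  · have := mul_pos h2 (pow_pos (abs_pos.2 h0) 2)
    rw [sq_abs] at this
    nlinarith [sq_nonneg (Real.cos χ)]

lemma dc_pos (hk : k ∈ Ioo (0 : ℝ) 1) (χ : ℝ) : 0 < dc k χ := Real.sqrt_pos.2 (dc_arg_pos hk χ)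

lemma dc_sq (hk : k ∈ Ioo (0 : ℝ) 1) (χ : ℝ) :
    dc k χ ^ 2 = Real.cos χ ^ 2 + k ^ 2 * Real.sin χ ^ 2 :=
  Real.sq_sqrt (dc_arg_pos hk χ).le

@[fun_prop] lemma continuous_dk : Continuous (dk k) := by unfold dk; fun_prop
@[fun_prop] lemma continuous_dc : Continuous (dc k) := by unfold dc; fun_prop

lemma continuous_inv_dk (hk : k ∈ Ioo (0 : ℝ) 1) : Continuous fun x => 1 / dk k x :=
  continuous_const.div continuous_dk fun x => (dk_pos hk x).ne'

lemma continuous_inv_dc (hk : k ∈ Ioo (0 : ℝ) 1) : Continuous fun x => 1 / dc k x :=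
  continuous_const.div continuous_dc fun x => (dc_pos hk x).ne'

lemma hasDerivAt_dk (hk : k ∈ Ioo (0 : ℝ) 1) (φ : ℝ) :
    HasDerivAt (dk k) (k ^ 2 * Real.cos φ * Real.sin φ / dk k φ) φ := by
  have h := ((((Real.hasDerivAt_cos φ).fun_pow 2).const_mul (k ^ 2)).const_sub 1).sqrt
    (dk_arg_pos hk φ).ne'
  refine HasDerivAt.congr_deriv h ?_
  have := (dk_pos hk φ).ne'
  rw [show √(1 - k ^ 2 * Real.cos φ ^ 2) = dk k φ from rfl]
  field_simp
  simp
  ring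

lemma hasDerivAt_dc (hk : k ∈ Ioo (0 : ℝ) 1) (χ : ℝ) :
    HasDerivAt (dc k) (-(1 - k ^ 2) * Real.cos χ * Real.sin χ / dc k χ) χ := by
  have h := (((Real.hasDerivAt_cos χ).fun_pow 2).fun_add
    (((Real.hasDerivAt_sin χ).fun_pow 2).const_mul (k ^ 2))).sqrt
    (dc_arg_pos hk χ).ne'
  refine HasDerivAt.congr_deriv h ?_
  have := (dc_pos hk χ).ne'
  rw [show √(Real.cos χ ^ 2 + k ^ 2 * Real.sin χ ^ 2) = dc k χ from rfl]
  field_simp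
  simp
  ring

lemma hasDerivAt_uk (hk : k ∈ Ioo (0 : ℝ) 1) (φ : ℝ) : HasDerivAt (uk k) (1 / dk k φ) φ :=
  intervalIntegral.integral_hasDerivAt_right ((continuous_inv_dk hk).intervalIntegrable _ _)
    ((continuous_inv_dk hk).stronglyMeasurableAtFilter _ _) (continuous_inv_dk hk).continuousAt

lemma hasDerivAt_tk (hk : k ∈ Ioo (0 : ℝ) 1) (χ : ℝ) : HasDerivAt (tk k) (1 / dc k χ) χ :=
  intervalIntegral.integral_hasDerivAt_right ((continuous_inv_dc hk).intervalIntegrable _ _)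
    ((continuous_inv_dc hk).stronglyMeasurableAtFilter _ _) (continuous_inv_dc hk).continuousAt

lemma continuous_uk (hk : k ∈ Ioo (0 : ℝ) 1) : Continuous (uk k) :=
  continuous_iff_continuousAt.2 fun x => (hasDerivAt_uk hk x).continuousAt

lemma continuous_tk (hk : k ∈ Ioo (0 : ℝ) 1) : Continuous (tk k) :=
  continuous_iff_continuousAt.2 fun x => (hasDerivAt_tk hk x).continuousAt

end

/-- The Cauchy–Riemann equations `dc · ∂_χ f = i · dk · ∂_φ f`, with `a = ∂_φ f`. -/
structure CR (k : ℝ) (s : Set ℝ) (f a : ℝ → ℝ → ℂ) : Prop where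
  dphi : ∀ χ ∈ s, ∀ φ, HasDerivAt (fun x => f x χ) (a φ χ) φ
  dchi : ∀ χ ∈ s, ∀ φ, HasDerivAt (fun y => f φ y) (I * dk k φ / dc k χ * a φ χ) χ
  cf : ContinuousOn (Function.uncurry f) (univ ×ˢ s)
  ca : ContinuousOn (Function.uncurry a) (univ ×ˢ s)

namespace CR
variable {k : ℝ} {s : Set ℝ} {f g a b : ℝ → ℝ → ℂ}

lemma mul (hf : CR k s f a) (hg : CR k s g b) :
    CR k s (fun φ χ => f φ χ * g φ χ) (fun φ χ => a φ χ * g φ χ + f φ χ * b φ χ) where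
  dphi χ hχ φ := (hf.dphi χ hχ φ).fun_mul (hg.dphi χ hχ φ)
  dchi χ hχ φ := by
    refine ((hf.dchi χ hχ φ).fun_mul (hg.dchi χ hχ φ)).congr_deriv ?_
    ring
  cf := hf.cf.mul hg.cf
  ca := (hf.ca.mul hg.cf).add (hf.cf.mul hg.ca)

lemma one : CR k s (fun _ _ => 1) (fun _ _ => 0) where
  dphi _ _ φ := hasDerivAt_const φ 1
  dchi χ _ φ := by simpa using hasDerivAt_const χ (1:ℂ)
  cf := continuousOn_const
  ca := continuousOn_const

lemma inv (hf : CR k s f a) (h0 : ∀ φ, ∀ χ ∈ s, f φ χ ≠ 0) :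
    CR k s (fun φ χ => (f φ χ)⁻¹) (fun φ χ => - a φ χ / f φ χ ^ 2) where
  dphi χ hχ φ := (hf.dphi χ hχ φ).fun_inv (h0 φ χ hχ)
  dchi χ hχ φ := by
    refine ((hf.dchi χ hχ φ).fun_inv (h0 φ χ hχ)).congr_deriv ?_
    ring
  cf := hf.cf.inv₀ fun x hx => h0 _ _ hx.2
  ca := hf.ca.neg.div (hf.cf.pow 2) fun x hx => pow_ne_zero 2 (h0 _ _ hx.2)

lemma pow (hf : CR k s f a) (n : ℕ) : ∃ b, CR k s (fun φ χ => f φ χ ^ n) b := by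
  induction n with
  | zero => exact ⟨_, by simpa using one⟩
  | succ n ih =>
    obtain ⟨b, hb⟩ := ih
    exact ⟨_, by simpa only [pow_succ] using hb.mul hf⟩

lemma zpow (hf : CR k s f a) (h0 : ∀ φ, ∀ χ ∈ s, f φ χ ≠ 0) (n : ℤ) :
    ∃ b, CR k s (fun φ χ => f φ χ ^ n) b := by
  cases n with
  | ofNat n => simpa using hf.pow n
  | negSucc n =>
    obtain ⟨b, hb⟩ := hf.pow (n + 1)
    exact ⟨_, by simpa only [zpow_negSucc] using hb.inv fun φ χ h => pow_ne_zero _ (h0 φ χ h)⟩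

lemma mono {t : Set ℝ} (hf : CR k s f a) (h : t ⊆ s) : CR k t f a where
  dphi χ hχ := hf.dphi χ (h hχ)
  dchi χ hχ := hf.dchi χ (h hχ)
  cf := hf.cf.mono (prod_mono_right h)
  ca := hf.ca.mono (prod_mono_right h)

open MeasureTheory in
lemma integral_const (hk : k ∈ Ioo (0 : ℝ) 1) (hf : CR k s f a)
    (hper : ∀ χ ∈ s, f (2 * π) χ = f 0 χ) {x y : ℝ} (hs : uIcc x y ⊆ s) :
    ∫ φ in (0:ℝ)..2 * π, f φ x / dk k φ = ∫ φ in (0:ℝ)..2 * π, f φ y / dk k φ := by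
  have hx : x ∈ s := hs left_mem_uIcc
  have hy : y ∈ s := hs right_mem_uIcc
  have hd : ∀ φ, (dk k φ : ℂ) ≠ 0 := fun φ => by exact_mod_cast (dk_pos hk φ).ne'
  have hd' : ∀ φ, (dc k φ : ℂ) ≠ 0 := fun φ => by exact_mod_cast (dc_pos hk φ).ne'
  have hcf : ∀ z ∈ s, Continuous fun φ => f φ z := fun z hz =>
    continuous_iff_continuousAt.2 fun φ => (hf.dphi z hz φ).continuousAt
  have hsec : ∀ φ, ContinuousOn (fun χ => a φ χ) s := fun φ =>
    hf.ca.comp (f := fun χ => (φ, χ)) (by fun_prop) fun χ hχ => ⟨mem_univ _, hχ⟩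
  have hcdk : Continuous fun φ => (dk k φ : ℂ) := by fun_prop
  have hcdc : Continuous fun φ => (dc k φ : ℂ) := by fun_prop
  rw [eq_comm, ← sub_eq_zero, ← intervalIntegral.integral_sub
    (Continuous.intervalIntegrable (show Continuous fun φ => f φ y / dk k φ from (hcf y hy).div hcdk hd) _ _)
    (Continuous.intervalIntegrable (show Continuous fun φ => f φ x / dk k φ from (hcf x hx).div hcdk hd) _ _)]
  have h1 : ∀ φ, f φ y / dk k φ - f φ x / dk k φ = ∫ χ in x..y, I / dc k χ * a φ χ := by
    intro φ
    have h2 := intervalIntegral.integral_eq_sub_of_hasDerivAt (f := fun χ => f φ χ)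
      (fun χ hχ => hf.dchi χ (hs hχ) φ)
      (by
        apply ContinuousOn.intervalIntegrable
        exact ((continuous_const.div hcdc hd').continuousOn.mul (hsec φ)).mono hs)
    rw [← sub_div, ← h2, div_eq_inv_mul, ← intervalIntegral.integral_const_mul]
    congr 1; ext χ
    have := hd φ
    field_simp
  simp_rw [h1]
  have hint : ContinuousOn (Function.uncurry fun φ χ => I / dc k χ * a φ χ)
      (uIcc 0 (2 * π) ×ˢ uIcc x y) := by
    refine ContinuousOn.mul ?_ (hf.ca.mono (prod_mono (subset_univ _) hs))
    exact ((continuous_const.div hcdc hd').comp continuous_snd).continuousOn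
  rw [MeasureTheory.intervalIntegral_intervalIntegral_swap
    ((hint.integrableOn_compact (isCompact_uIcc.prod isCompact_uIcc)).mono_set
      (prod_mono uIoc_subset_uIcc uIoc_subset_uIcc))]
  refine (intervalIntegral.integral_congr (g := fun _ => (0:ℂ)) ?_).trans (by simp)
  intro χ hχ
  simp only []
  rw [intervalIntegral.integral_const_mul, intervalIntegral.integral_eq_sub_of_hasDerivAt
    (f := fun φ => f φ χ) (fun φ _ => hf.dphi χ (hs hχ) φ), hper χ (hs hχ), sub_self, mul_zero]
  apply Continuous.intervalIntegrable
  exact continuousOn_univ.1 (hf.ca.comp (f := fun φ => (φ, χ)) (by fun_prop)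
    fun φ _ => ⟨mem_univ _, hs hχ⟩)

end CR

lemma Kell_eq_trig (κ : ℝ) :
    Kell κ = ∫ φ in (0:ℝ)..π / 2, 1 / Real.sqrt (1 - κ ^ 2 * Real.cos φ ^ 2) := by
  have hπ := Real.pi_pos
  have him : Real.cos '' Ioo 0 (π / 2) = Ioo 0 1 := by
    ext y
    constructor
    · rintro ⟨x, ⟨h1, h2⟩, rfl⟩
      refine ⟨Real.cos_pos_of_mem_Ioo ⟨by linarith, h2⟩, ?_⟩
      have := Real.cos_lt_cos_of_nonneg_of_le_pi le_rfl (by linarith : x ≤ π) h1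
      simpa using this
    · rintro ⟨h1, h2⟩
      exact ⟨Real.arccos y, ⟨Real.arccos_pos.2 h2, Real.arccos_lt_pi_div_two.2 h1⟩,
        Real.cos_arccos (by linarith) h2.le⟩
  have hinj : InjOn Real.cos (Ioo 0 (π / 2)) :=
    fun x hx y hy h => Real.injOn_cos ⟨hx.1.le, by linarith [hx.2]⟩
      ⟨hy.1.le, by linarith [hy.2]⟩ h
  have h := MeasureTheory.integral_image_eq_integral_abs_deriv_smul (measurableSet_Ioo)
    (fun x _ => (Real.hasDerivAt_cos x).hasDerivWithinAt) hinj
    (fun y => 1 / Real.sqrt ((1 - y ^ 2) * (1 - κ ^ 2 * y ^ 2)))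
  rw [him] at h
  rw [Kell, intervalIntegral.integral_of_le zero_le_one,
    intervalIntegral.integral_of_le (by positivity),
    MeasureTheory.integral_Ioc_eq_integral_Ioo, MeasureTheory.integral_Ioc_eq_integral_Ioo, h]
  refine MeasureTheory.setIntegral_congr_fun measurableSet_Ioo fun x hx => ?_
  have hs : 0 < Real.sin x := Real.sin_pos_of_pos_of_lt_pi hx.1 (by linarith [hx.2])
  simp only [smul_eq_mul]
  rw [← Real.sin_sq, Real.sqrt_mul (sq_nonneg _), Real.sqrt_sq hs.le, abs_neg, abs_of_pos hs]
  rw [one_div, mul_inv, ← mul_assoc, mul_inv_cancel₀ hs.ne', one_mul, one_div]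


lemma uk_pi_div_two : uk k (π / 2) = Kell k := (Kell_eq_trig k).symm

lemma tk_pi_div_two (hk : k ∈ Ioo (0 : ℝ) 1) : tk k (π / 2) = Kell (kComp k) := by
  rw [Kell_eq_trig, tk]
  have h := intervalIntegral.integral_comp_sub_left (a := 0) (b := π / 2)
    (fun x => 1 / Real.sqrt (1 - kComp k ^ 2 * Real.cos x ^ 2)) (π / 2)
  rw [sub_zero, sub_self] at h
  rw [← h]
  congr 1; ext x
  rw [dc, Real.cos_pi_div_two_sub, kComp, Real.sq_sqrt (by nlinarith [hk.1, hk.2])]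
  congr 2
  linear_combination (-1) * Real.sin_sq_add_cos_sq x + 2 * Real.sin_sq_add_cos_sq x

lemma uk_sub (hk : k ∈ Ioo (0 : ℝ) 1) (a b : ℝ) : uk k b - uk k a = ∫ x in a..b, 1 / dk k x := by
  rw [uk, uk, intervalIntegral.integral_interval_sub_left] <;>
  exact (continuous_inv_dk hk).intervalIntegrable _ _

lemma dk_neg (x : ℝ) : dk k (-x) = dk k x := by simp [dk]

lemma dk_add_pi (x : ℝ) : dk k (x + π) = dk k x := by simp [dk, Real.cos_add_pi]

lemma uk_zero : uk k 0 = 0 := by simp [uk]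

lemma tk_zero : tk k 0 = 0 := by simp [tk]

lemma uk_neg (x : ℝ) : uk k (-x) = - uk k x := by
  have h := intervalIntegral.integral_comp_neg (a := 0) (b := -x) (fun x => 1 / dk k x)
  simp only [dk_neg, neg_neg, neg_zero] at h
  rw [uk, h, intervalIntegral.integral_symm, uk]

lemma uk_add_pi (hk : k ∈ Ioo (0 : ℝ) 1) (x : ℝ) : uk k (x + π) = uk k x + 2 * Kell k := by
  have h1 : ∀ x, uk k (x + π) = uk k x + uk k π := by
    intro x
    have h := intervalIntegral.integral_comp_add_right (a := 0) (b := x) (fun x => 1 / dk k x) π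
    simp only [dk_add_pi, zero_add] at h
    rw [← uk_sub hk π, ← uk_sub hk 0, uk_zero] at h
    linarith
  rw [h1]
  have h2 := h1 (-(π / 2))
  rw [uk_neg, uk_pi_div_two, show -(π / 2) + π = π / 2 by ring, uk_pi_div_two] at h2
  linarith

lemma uk_pi (hk : k ∈ Ioo (0 : ℝ) 1) : uk k π = 2 * Kell k := by
  have := uk_add_pi hk 0
  simpa [uk_zero] using this

lemma uk_two_pi (hk : k ∈ Ioo (0 : ℝ) 1) : uk k (2 * π) = 4 * Kell k := by
  rw [show 2 * π = π + π by ring, uk_add_pi hk, uk_pi hk]; ring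

lemma uk_three_pi_div_two (hk : k ∈ Ioo (0 : ℝ) 1) : uk k (3 * π / 2) = 3 * Kell k := by
  rw [show 3 * π / 2 = π / 2 + π by ring, uk_add_pi hk, uk_pi_div_two]; ring

lemma uk_strictMono (hk : k ∈ Ioo (0 : ℝ) 1) : StrictMono (uk k) :=
  strictMono_of_hasDerivAt_pos (hasDerivAt_uk hk) fun x => one_div_pos.2 (dk_pos hk x)

lemma tk_strictMono (hk : k ∈ Ioo (0 : ℝ) 1) : StrictMono (tk k) :=
  strictMono_of_hasDerivAt_pos (hasDerivAt_tk hk) fun x => one_div_pos.2 (dc_pos hk x)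

lemma Kell_pos (hk : k ∈ Ioo (0 : ℝ) 1) : 0 < Kell k := by
  rw [← uk_pi_div_two, ← uk_zero (k := k)]
  exact uk_strictMono hk (by positivity)

lemma Kell_kComp_pos (hk : k ∈ Ioo (0 : ℝ) 1) : 0 < Kell (kComp k) := by
  rw [← tk_pi_div_two hk, ← tk_zero (k := k)]
  exact tk_strictMono hk (by positivity)

/-- The frequency `π / (2K)`. -/
def om (k : ℝ) : ℝ := π / (2 * Kell k)

lemma om_pos (hk : k ∈ Ioo (0 : ℝ) 1) : 0 < om k := div_pos Real.pi_pos (by linarith [Kell_pos hk])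

lemma om_mul_Kell (hk : k ∈ Ioo (0 : ℝ) 1) : om k * Kell k = π / 2 := by
  have := (Kell_pos hk).ne'
  rw [om]; field_simp

/-- The base `exp(-πK'/(2K))`. -/
def qk (k : ℝ) : ℝ := Real.exp (-(om k * Kell (kComp k)))

lemma qk_pos : 0 < qk k := Real.exp_pos _

lemma qk_lt_one (hk : k ∈ Ioo (0 : ℝ) 1) : qk k < 1 :=
  Real.exp_lt_one_iff.2 (neg_neg_of_pos (mul_pos (om_pos hk) (Kell_kComp_pos hk)))

/-- The function `z`. -/
def zf (k φ χ : ℝ) : ℂ :=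
  (Real.cos φ * dc k χ + I * (Real.sin φ * Real.cos χ)) / (1 + dk k φ * Real.sin χ)

/-- The function `λ`. -/
def lf (k φ χ : ℝ) : ℂ :=
  k * (Real.cos φ - I * (Real.sin χ * Real.sin φ)) / (dc k χ + dk k φ * Real.cos χ)

def ef (k : ℝ) (m : ℤ) (φ χ : ℝ) : ℂ :=
  Complex.exp (I * (m * om k) * (uk k φ + I * tk k χ))

def strip : Set ℝ := Ioo (-(π / 2)) π

lemma zden_pos (hk : k ∈ Ioo (0 : ℝ) 1) (φ : ℝ) {χ : ℝ} (hχ : χ ∈ strip) :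
    0 < 1 + dk k φ * Real.sin χ := by
  have h1 : -1 < Real.sin χ := by
    rcases le_or_gt 0 χ with h | h
    · linarith [Real.sin_nonneg_of_nonneg_of_le_pi h hχ.2.le]
    · have := Real.sin_lt_sin_of_lt_of_le_pi_div_two le_rfl (by linarith [Real.pi_pos]) hχ.1
      simpa using this
  nlinarith [dk_le_one (k := k) φ, dk_pos hk φ]

lemma lden_pos (hk : k ∈ Ioo (0 : ℝ) 1) (φ : ℝ) {χ : ℝ} (hχ : χ ∈ strip) :
    0 < dc k χ + dk k φ * Real.cos χ := by
  rcases le_or_gt χ (π / 2) with h | h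
  · have := Real.cos_nonneg_of_mem_Icc ⟨hχ.1.le, h⟩
    have := dk_pos hk φ
    have := dc_pos hk χ
    positivity
  · have hs := Real.sin_pos_of_pos_of_lt_pi (by linarith [Real.pi_pos]) hχ.2
    have : |dk k φ * Real.cos χ| < dc k χ := by
      refine abs_lt_of_sq_lt_sq ?_ (dc_pos hk χ).le
      rw [mul_pow, dk_sq hk, dc_sq hk]
      nlinarith [mul_pos (pow_pos hk.1 2) (pow_pos hs 2), sq_nonneg (k * Real.cos φ * Real.cos χ)]
    linarith [neg_abs_le (dk k φ * Real.cos χ)]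

section

lemma ccos (φ : ℝ) : HasDerivAt (fun x : ℝ => ((Real.cos x : ℝ) : ℂ)) (-(Real.sin φ : ℂ)) φ := by
  simpa using (Real.hasDerivAt_cos φ).ofReal_comp
lemma csin (φ : ℝ) : HasDerivAt (fun x : ℝ => ((Real.sin x : ℝ) : ℂ)) (Real.cos φ : ℂ) φ :=
  (Real.hasDerivAt_sin φ).ofReal_comp

/-- The derivative of `dk`. -/
def dkD (k φ : ℝ) : ℝ := k ^ 2 * Real.cos φ * Real.sin φ / dk k φ

/-- The derivative of `dc`. -/
def dcD (k χ : ℝ) : ℝ := -(1 - k ^ 2) * Real.cos χ * Real.sin χ / dc k χ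

lemma cdk (hk : k ∈ Ioo (0 : ℝ) 1) (φ : ℝ) : HasDerivAt (fun x : ℝ => (dk k x : ℂ))
    (dkD k φ : ℂ) φ :=
  (hasDerivAt_dk hk φ).ofReal_comp
lemma cdc (hk : k ∈ Ioo (0 : ℝ) 1) (φ : ℝ) : HasDerivAt (fun x : ℝ => (dc k x : ℂ))
    (dcD k φ : ℂ) φ :=
  (hasDerivAt_dc hk φ).ofReal_comp

lemma continuous_dkD (hk : k ∈ Ioo (0 : ℝ) 1) : Continuous (dkD k) :=
  Continuous.div (by fun_prop) continuous_dk fun x => (dk_pos hk x).ne'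

lemma cr_relations (hk : k ∈ Ioo (0 : ℝ) 1) (φ χ : ℝ) :
    (dk k φ : ℂ) ^ 2 = 1 - k ^ 2 * Real.cos φ ^ 2 ∧
    (dc k χ : ℂ) ^ 2 = Real.cos χ ^ 2 + k ^ 2 * Real.sin χ ^ 2 ∧
    (Real.sin φ : ℂ) ^ 2 + Real.cos φ ^ 2 = 1 ∧
    (Real.sin χ : ℂ) ^ 2 + Real.cos χ ^ 2 = 1 ∧
    (dkD k φ : ℂ) * dk k φ = k ^ 2 * Real.cos φ * Real.sin φ ∧
    (dcD k χ : ℂ) * dc k χ = -(1 - k ^ 2) * Real.cos χ * Real.sin χ := by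
  refine ⟨mod_cast dk_sq hk φ, mod_cast dc_sq hk χ, mod_cast Real.sin_sq_add_cos_sq φ,
    mod_cast Real.sin_sq_add_cos_sq χ, ?_, ?_⟩
  · have : dkD k φ * dk k φ = k ^ 2 * Real.cos φ * Real.sin φ := by
      rw [dkD, div_mul_cancel₀ _ (dk_pos hk φ).ne']
    exact_mod_cast this
  · have : dcD k χ * dc k χ = -(1 - k ^ 2) * Real.cos χ * Real.sin χ := by
      rw [dcD, div_mul_cancel₀ _ (dc_pos hk χ).ne']
    exact_mod_cast this

lemma cr_zf (hk : k ∈ Ioo (0 : ℝ) 1) : ∃ a, CR k strip (zf k) a := by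
  have hne : ∀ φ : ℝ, ∀ χ ∈ strip, (1 + dk k φ * Real.sin χ : ℂ) ≠ 0 := fun φ χ hχ => by
    exact_mod_cast (zden_pos hk φ hχ).ne'
  have hc := continuous_dkD hk
  have hcd := continuous_dk (k := k)
  have hcc := continuous_dc (k := k)
  refine ⟨fun φ χ => ((-Real.sin φ * dc k χ + I * (Real.cos φ * Real.cos χ))
      * (1 + dk k φ * Real.sin χ) - (Real.cos φ * dc k χ + I * (Real.sin φ * Real.cos χ))
      * (dkD k φ * Real.sin χ))
      / (1 + dk k φ * Real.sin χ) ^ 2, ?_, ?_, ?_, ?_⟩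
  · intro χ hχ φ
    exact (((ccos φ).mul_const _).fun_add (((csin φ).mul_const _).const_mul I)).fun_div
      (((cdk hk φ).mul_const _).const_add 1) (hne φ χ hχ)
  · intro χ hχ φ
    refine HasDerivAt.congr_deriv ((((cdc hk χ).const_mul _).fun_add
      (((ccos χ).const_mul _).const_mul I)).fun_div
      (((csin χ).const_mul _).const_add 1) (hne φ χ hχ)) ?_
    have h2 : (dc k χ : ℂ) ≠ 0 := by exact_mod_cast (dc_pos hk χ).ne'
    obtain ⟨e1, e2, e3, e4, e5, e6⟩ := cr_relations hk φ χ
    generalize (Real.sin φ : ℂ) = S at *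
    generalize (Real.cos φ : ℂ) = C at *
    generalize (Real.sin χ : ℂ) = s at *
    generalize (Real.cos χ : ℂ) = c at *
    rw [← mul_div_assoc]
    congr 1
    rw [div_mul_eq_mul_div, eq_div_iff h2]
    generalize (dk k φ : ℂ) = d at *
    generalize (dc k χ : ℂ) = D at *
    generalize (dcD k χ : ℂ) = D1 at *
    generalize (dkD k φ : ℂ) = d1 at *
    linear_combination (-C*c*d) * e2 + (C * c * s + I * S * D * s) * e1 + C * (1 + d * s) * e6
      + I * s * (C * D + I * S * c) * e5 + (-C*c*d - I*S*d*D) * e4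
      - (k^2 * C*c*s) * e3 + (C * c * s * S ^ 2 * k ^ 2 - c * C * d * (1 + d * s)) * I_sq
  · refine ContinuousOn.div (Continuous.continuousOn ?_) (Continuous.continuousOn ?_)
      fun x hx => hne _ _ hx.2
    all_goals fun_prop
  · refine ContinuousOn.div (Continuous.continuousOn ?_) (Continuous.continuousOn ?_)
      fun x hx => pow_ne_zero 2 (hne _ _ hx.2)
    all_goals fun_prop

lemma cr_lf (hk : k ∈ Ioo (0 : ℝ) 1) : ∃ a, CR k strip (lf k) a := by
  have hne : ∀ φ : ℝ, ∀ χ ∈ strip, (dc k χ + dk k φ * Real.cos χ : ℂ) ≠ 0 := fun φ χ hχ => by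
    exact_mod_cast (lden_pos hk φ hχ).ne'
  have hc := continuous_dkD hk
  have hcd := continuous_dk (k := k)
  have hcc := continuous_dc (k := k)
  refine ⟨fun φ χ => (k * (-Real.sin φ - I * (Real.sin χ * Real.cos φ))
      * (dc k χ + dk k φ * Real.cos χ) - k * (Real.cos φ - I * (Real.sin χ * Real.sin φ))
      * (dkD k φ * Real.cos χ))
      / (dc k χ + dk k φ * Real.cos χ) ^ 2, ?_, ?_, ?_, ?_⟩
  · intro χ hχ φ
    exact (((ccos φ).fun_sub (((csin φ).const_mul _).const_mul I)).const_mul (k:ℂ)).fun_div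
      (((cdk hk φ).mul_const _).const_add (dc k χ : ℂ)) (hne φ χ hχ)
  · intro χ hχ φ
    refine HasDerivAt.congr_deriv ((((((csin χ).mul_const _).const_mul I).const_sub
      (Real.cos φ : ℂ)).const_mul (k:ℂ)).fun_div
      ((cdc hk χ).fun_add ((ccos χ).const_mul (dk k φ : ℂ))) (hne φ χ hχ)) ?_
    have h2 : (dc k χ : ℂ) ≠ 0 := by exact_mod_cast (dc_pos hk χ).ne'
    obtain ⟨e1, e2, e3, e4, e5, e6⟩ := cr_relations hk φ χ
    generalize (Real.sin φ : ℂ) = S at *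
    generalize (Real.cos φ : ℂ) = C at *
    generalize (Real.sin χ : ℂ) = s at *
    generalize (Real.cos χ : ℂ) = c at *
    rw [← mul_div_assoc]
    congr 1
    rw [div_mul_eq_mul_div, eq_div_iff h2]
    generalize (dk k φ : ℂ) = d at *
    generalize (dc k χ : ℂ) = D at *
    generalize (dcD k χ : ℂ) = D1 at *
    generalize (dkD k φ : ℂ) = d1 at *
    linear_combination (-k * (C - I * s * S)) * e6 + I * k * c * (C - I * s * S) * e5
      + k * (-C * c * s + I * c * S) * e1 + k * k ^ 2 * C * c * s * e3 - k * I * c * S * e2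
      + k * (-I * d * S * D - I * c * S) * e4
      + k * (s * C * d * D + s * C * d ^ 2 * c - c * s * S ^ 2 * k ^ 2 * C) * I_sq
  · refine ContinuousOn.div (Continuous.continuousOn ?_) (Continuous.continuousOn ?_)
      fun x hx => hne _ _ hx.2
    all_goals fun_prop
  · refine ContinuousOn.div (Continuous.continuousOn ?_) (Continuous.continuousOn ?_)
      fun x hx => pow_ne_zero 2 (hne _ _ hx.2)
    all_goals fun_prop

lemma cr_ef (hk : k ∈ Ioo (0 : ℝ) 1) (m : ℤ) (s : Set ℝ) : ∃ a, CR k s (ef k m) a := by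
  have hcu : Continuous (uk k) := continuous_uk hk
  have hct : Continuous (tk k) := continuous_tk hk
  have hcd := continuous_dk (k := k)
  have hd : ∀ φ, (dk k φ : ℂ) ≠ 0 := fun φ => by exact_mod_cast (dk_pos hk φ).ne'
  have hd' : ∀ φ, (dc k φ : ℂ) ≠ 0 := fun φ => by exact_mod_cast (dc_pos hk φ).ne'
  have hce : Continuous (Function.uncurry (ef k m)) := by
    unfold ef Function.uncurry; fun_prop
  refine ⟨fun φ χ => ef k m φ χ * (I * (m * om k) * (1 / dk k φ)), ?_, ?_, hce.continuousOn, ?_⟩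
  · intro χ _ φ
    have h := (((hasDerivAt_uk hk φ).ofReal_comp.add_const (I * tk k χ)).const_mul
      (I * (m * om k))).cexp
    simpa [ef] using h
  · intro χ _ φ
    have h := ((((hasDerivAt_tk hk χ).ofReal_comp.const_mul I).const_add (uk k φ : ℂ)).const_mul
      (I * (m * om k))).cexp
    refine HasDerivAt.congr_deriv h ?_
    have := hd φ
    have := hd' χ
    rw [ef]; push_cast; field_simp
  · refine ContinuousOn.mul hce.continuousOn (Continuous.continuousOn ?_)
    refine continuous_const.mul (continuous_const.div (by fun_prop) fun x => hd _)

end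

/-- The boundary value `k cos φ / (1 + √(1 - k² cos² φ))`. -/
def lam (k φ : ℝ) : ℝ := k * Real.cos φ / (1 + dk k φ)

lemma one_add_dk_pos (hk : k ∈ Ioo (0 : ℝ) 1) (φ : ℝ) : 0 < 1 + dk k φ := by
  linarith [dk_pos hk φ]

lemma continuous_lam (hk : k ∈ Ioo (0 : ℝ) 1) : Continuous (lam k) := by
  have hcd := continuous_dk (k := k)
  exact Continuous.div (by fun_prop) (by fun_prop) fun x => (one_add_dk_pos hk x).ne'

lemma lam_rel (hk : k ∈ Ioo (0 : ℝ) 1) (φ : ℝ) :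
    k * Real.cos φ * (lam k φ ^ 2 + 1) = 2 * lam k φ := by
  have h := (one_add_dk_pos hk φ).ne'
  have h2 := dk_sq hk φ
  rw [lam]; field_simp
  linear_combination (k * Real.cos φ) * h2

lemma one_sub_lam (hk : k ∈ Ioo (0 : ℝ) 1) (φ : ℝ) :
    1 - k * lam k φ * Real.cos φ = dk k φ := by
  have h := (one_add_dk_pos hk φ).ne'
  have h2 := dk_sq hk φ
  rw [lam]; field_simp
  linear_combination -h2

/-- `Φ_m(X,Y)`. -/
def Phi (k : ℝ) (m : ℤ) (X : ℕ) (Y : ℤ) : ℝ :=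
  ∫ φ in (0:ℝ)..2 * π, lam k φ ^ X * Real.cos (Y * φ + m * om k * uk k φ) / dk k φ

lemma Phi_neg (m : ℤ) (X : ℕ) (Y : ℤ) : Phi k (-m) X Y = Phi k m X (-Y) := by
  unfold Phi
  congr 1; ext φ
  rw [← Real.cos_neg]
  congr 3; push_cast; ring

lemma continuous_Phi_integrand (hk : k ∈ Ioo (0 : ℝ) 1) (m : ℤ) (X : ℕ) (Y : ℤ) :
    Continuous fun φ => lam k φ ^ X * Real.cos (Y * φ + m * om k * uk k φ) / dk k φ := by
  have h1 := continuous_lam hk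
  have h2 := continuous_uk hk
  exact Continuous.div (by fun_prop) continuous_dk fun x => (dk_pos hk x).ne'

lemma Phi_harmonic (hk : k ∈ Ioo (0 : ℝ) 1) (m : ℤ) (X : ℕ) (Y : ℤ) :
    Phi k m (X + 1) Y = k / 4 * (Phi k m (X + 2) (Y + 1) + Phi k m (X + 2) (Y - 1)
      + Phi k m X (Y + 1) + Phi k m X (Y - 1)) := by
  have hi : ∀ X Y, IntervalIntegrable
      (fun φ => lam k φ ^ X * Real.cos (Y * φ + m * om k * uk k φ) / dk k φ)
      MeasureTheory.volume 0 (2 * π) := fun X Y => by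
    have h1 := continuous_lam hk
    have h2 := continuous_uk hk
    refine Continuous.intervalIntegrable (Continuous.div (by fun_prop) continuous_dk
      fun x => (dk_pos hk x).ne') _ _
  unfold Phi
  rw [← intervalIntegral.integral_add (hi _ _) (hi _ _),
    ← intervalIntegral.integral_add ((hi _ _).add (hi _ _)) (hi _ _),
    ← intervalIntegral.integral_add (((hi _ _).add (hi _ _)).add (hi _ _)) (hi _ _),
    ← intervalIntegral.integral_const_mul]
  congr 1; ext φ
  have e1 : Real.cos (((Y + 1 : ℤ) : ℝ) * φ + m * om k * uk k φ) =
      Real.cos ((Y * φ + m * om k * uk k φ) + φ) := by congr 1; push_cast; ring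
  have e2 : Real.cos (((Y - 1 : ℤ) : ℝ) * φ + m * om k * uk k φ) =
      Real.cos ((Y * φ + m * om k * uk k φ) - φ) := by congr 1; push_cast; ring
  rw [e1, e2]
  generalize (Y * φ + m * om k * uk k φ : ℝ) = θ
  rw [Real.cos_add, Real.cos_sub]
  have hd := (dk_pos hk φ).ne'
  field_simp
  linear_combination (-2 * lam k φ ^ X * Real.cos θ) * lam_rel hk φ

lemma Phi_zero_zero (hk : k ∈ Ioo (0 : ℝ) 1) {m : ℤ} (hm : m ≠ 0) : Phi k m 0 0 = 0 := by
  have hmo : (m : ℝ) * om k ≠ 0 := mul_ne_zero (by exact_mod_cast hm) (om_pos hk).ne'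
  have hd : ∀ φ ∈ uIcc 0 (2 * π), HasDerivAt
      (fun φ => Real.sin (m * om k * uk k φ) / (m * om k))
      (lam k φ ^ 0 * Real.cos (((0:ℤ):ℝ) * φ + m * om k * uk k φ) / dk k φ) φ := fun φ _ => by
    refine (((hasDerivAt_uk hk φ).const_mul (m * om k)).sin.div_const (m * om k)).congr_deriv ?_
    have := (dk_pos hk φ).ne'
    have := (om_pos hk).ne'
    simp; field_simp
  unfold Phi
  rw [intervalIntegral.integral_eq_sub_of_hasDerivAt hd
    ((continuous_Phi_integrand hk m 0 0).intervalIntegrable _ _), uk_two_pi hk, uk_zero]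
  rw [show (m : ℝ) * om k * (4 * Kell k) = ((2 * m : ℤ) : ℝ) * π by
    push_cast; linear_combination 4 * (m:ℝ) * om_mul_Kell hk, Real.sin_int_mul_pi]
  simp

lemma dc_zero : dc k 0 = 1 := by simp [dc]

lemma dc_pi_div_two (hk : k ∈ Ioo (0 : ℝ) 1) : dc k (π / 2) = k := by
  simp [dc, Real.sqrt_sq hk.1.le]

lemma zf_zero (φ : ℝ) : zf k φ 0 = Complex.exp (φ * I) := by
  rw [Complex.exp_mul_I]
  simp [zf, dc_zero, mul_comm]

lemma zf_pi_div_two (hk : k ∈ Ioo (0 : ℝ) 1) (φ : ℝ) : zf k φ (π / 2) = lam k φ := by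
  rw [zf, dc_pi_div_two hk, lam]
  simp [mul_comm]

lemma lf_zero (φ : ℝ) : lf k φ 0 = lam k φ := by
  rw [lf, dc_zero, lam]
  simp

lemma lf_pi_div_two (hk : k ∈ Ioo (0 : ℝ) 1) (φ : ℝ) :
    lf k φ (π / 2) = Complex.exp (-φ * I) := by
  rw [lf, dc_pi_div_two hk, Complex.exp_mul_I]
  have : (k : ℂ) ≠ 0 := by exact_mod_cast hk.1.ne'
  simp
  field_simp
  ring

lemma ef_eq (m : ℤ) (φ χ : ℝ) : ef k m φ χ =
    Complex.exp ((m * om k * uk k φ : ℝ) * I) * (Real.exp (-(m * om k * tk k χ)) : ℝ) := by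
  rw [ef, Complex.ofReal_exp, ← Complex.exp_add]
  congr 1; push_cast
  linear_combination (m * om k * tk k χ) * I_sq

lemma ef_zero (m : ℤ) (φ : ℝ) :
    ef k m φ 0 = Complex.exp ((m * om k * uk k φ : ℝ) * I) := by
  rw [ef_eq, tk_zero]; simp

lemma ef_pi_div_two (hk : k ∈ Ioo (0 : ℝ) 1) (m : ℤ) (φ : ℝ) :
    ef k m φ (π / 2) = Complex.exp ((m * om k * uk k φ : ℝ) * I) * (qk k ^ m : ℝ) := by
  rw [ef_eq, tk_pi_div_two hk, qk, ← Real.rpow_intCast, ← Real.exp_mul]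
  congr 3; ring

lemma ef_two_pi (hk : k ∈ Ioo (0 : ℝ) 1) (m : ℤ) (χ : ℝ) : ef k m (2 * π) χ = ef k m 0 χ := by
  rw [ef_eq, ef_eq, uk_two_pi hk, uk_zero]
  congr 1
  rw [show (m : ℝ) * om k * (4 * Kell k) = m * (2 * π) by
    linear_combination 4 * (m:ℝ) * om_mul_Kell hk]
  rw [Complex.exp_eq_exp_iff_exists_int]
  exact ⟨m, by push_cast; ring⟩

lemma normSq_zf (hk : k ∈ Ioo (0 : ℝ) 1) (φ : ℝ) {χ : ℝ} (hχ : χ ∈ strip) :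
    Complex.normSq (zf k φ χ) = (1 - dk k φ * Real.sin χ) / (1 + dk k φ * Real.sin χ) := by
  have h := (zden_pos hk φ hχ).ne'
  have e : zf k φ χ = (⟨Real.cos φ * dc k χ, Real.sin φ * Real.cos χ⟩ : ℂ) /
      ((1 + dk k φ * Real.sin χ : ℝ) : ℂ) := by
    rw [zf, Complex.mk_eq_add_mul_I]; push_cast; ring
  rw [e, Complex.normSq_div, Complex.normSq_ofReal, Complex.normSq_mk]
  rw [div_eq_div_iff (mul_ne_zero h h) h]
  have e1 := dk_sq hk φ
  have e2 := dc_sq hk χ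
  have e3 := Real.sin_sq_add_cos_sq φ
  have e4 := Real.sin_sq_add_cos_sq χ
  have : Real.cos φ ^ 2 * dc k χ ^ 2 + Real.sin φ ^ 2 * Real.cos χ ^ 2
      = (1 - dk k φ * Real.sin χ) * (1 + dk k φ * Real.sin χ) := by
    linear_combination (Real.cos φ ^ 2) * e2 + Real.sin χ ^ 2 * e1 + Real.cos χ ^ 2 * e3 + e4
  linear_combination (1 + dk k φ * Real.sin χ) * this

lemma abs_dk_mul_sin_lt (hk : k ∈ Ioo (0 : ℝ) 1) (φ : ℝ) {χ : ℝ}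
    (hχ : χ ∈ Ioo (-(π / 2)) (π / 2)) : 0 < 1 - dk k φ * Real.sin χ := by
  have h1 : Real.sin χ < 1 := by
    have := Real.sin_lt_sin_of_lt_of_le_pi_div_two hχ.1.le le_rfl hχ.2
    simpa using this
  nlinarith [dk_le_one (k := k) φ, dk_pos hk φ]

lemma mem_strip {χ : ℝ} (hχ : χ ∈ Ioo (-(π / 2)) (π / 2)) : χ ∈ strip :=
  ⟨hχ.1, by linarith [hχ.2, Real.pi_pos]⟩

lemma zf_ne_zero (hk : k ∈ Ioo (0 : ℝ) 1) (φ : ℝ) {χ : ℝ} (hχ : χ ∈ Ioo (-(π / 2)) (π / 2)) :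
    zf k φ χ ≠ 0 := by
  rw [← Complex.normSq_pos, normSq_zf hk φ (mem_strip hχ)]
  exact div_pos (abs_dk_mul_sin_lt hk φ hχ) (zden_pos hk φ (mem_strip hχ))

lemma norm_lf_le (hk : k ∈ Ioo (0 : ℝ) 1) (φ : ℝ) {χ : ℝ} (hχ : χ ∈ Icc 0 (π / 2)) :
    ‖lf k φ χ‖ ≤ 1 := by
  have hp := lden_pos hk φ (χ := χ) ⟨by linarith [hχ.1, Real.pi_pos], by linarith [hχ.2, Real.pi_pos]⟩
  have e : lf k φ χ = (⟨k * Real.cos φ, -(k * (Real.sin χ * Real.sin φ))⟩ : ℂ) /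
      ((dc k χ + dk k φ * Real.cos χ : ℝ) : ℂ) := by
    rw [lf, Complex.mk_eq_add_mul_I]; push_cast; ring
  rw [e, norm_div, Complex.norm_real, Real.norm_of_nonneg hp.le, div_le_one hp]
  refine abs_le_of_sq_le_sq' ?_ hp.le |>.2
  rw [Complex.sq_norm, Complex.normSq_mk]
  have e1 := dk_sq hk φ
  have e2 := dc_sq hk χ
  have e3 := Real.sin_sq_add_cos_sq φ
  have e4 := Real.sin_sq_add_cos_sq χ
  have hc := Real.cos_nonneg_of_mem_Icc (x := χ) ⟨by linarith [hχ.1, Real.pi_pos], hχ.2⟩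
  have h3 : 0 ≤ dc k χ * (dk k φ * Real.cos χ) := by
    have := dk_pos hk φ
    have := dc_pos hk χ
    positivity
  have h4 : 0 ≤ Real.cos χ ^ 2 * dk k φ ^ 2 := by positivity
  have : (dc k χ + dk k φ * Real.cos χ) ^ 2 - (k * Real.cos φ * (k * Real.cos φ) +
      -(k * (Real.sin χ * Real.sin φ)) * -(k * (Real.sin χ * Real.sin φ)))
      = 2 * (dc k χ * (dk k φ * Real.cos χ)) + 2 * (Real.cos χ ^ 2 * dk k φ ^ 2) := by
    linear_combination e2 - Real.cos χ ^ 2 * e1 + k ^ 2 * Real.cos φ ^ 2 * e4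
      - k ^ 2 * Real.sin χ ^ 2 * e3
  linarith

/-- The contour integral at height `χ`. -/
def Jint (k : ℝ) (m : ℤ) (X : ℕ) (Y : ℤ) (χ : ℝ) : ℂ :=
  ∫ φ in (0:ℝ)..2 * π, lf k φ χ ^ X * zf k φ χ ^ Y * ef k m φ χ / dk k φ

lemma lzf_two_pi (χ : ℝ) : lf k (2 * π) χ = lf k 0 χ ∧ zf k (2 * π) χ = zf k 0 χ := by
  simp [lf, zf, dk]

lemma Jint_const (hk : k ∈ Ioo (0 : ℝ) 1) (m : ℤ) (X : ℕ) (Y : ℤ) {χ : ℝ}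
    (hχ : χ ∈ Ico 0 (π / 2)) : Jint k m X Y χ = Jint k m X Y 0 := by
  obtain ⟨a, ha⟩ := cr_zf hk
  obtain ⟨b, hb⟩ := cr_lf hk
  have hsub : Ioo (-(π / 2)) (π / 2) ⊆ strip := fun x hx => mem_strip hx
  obtain ⟨c, hc⟩ := (ha.mono hsub).zpow (fun φ χ h => zf_ne_zero hk φ h) Y
  obtain ⟨d, hd⟩ := (hb.mono hsub).pow X
  obtain ⟨e, he⟩ := cr_ef hk m (Ioo (-(π / 2)) (π / 2))
  refine ((hd.mul hc).mul he).integral_const hk (fun χ _ => ?_) ?_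
  · simp only [ef_two_pi hk, lzf_two_pi]
  · rw [uIcc_of_ge hχ.1]
    exact fun x hx => ⟨by linarith [hx.1, Real.pi_pos], by linarith [hx.2, hχ.2]⟩

lemma Jint_const_nat (hk : k ∈ Ioo (0 : ℝ) 1) (m : ℤ) (X : ℕ) (Y : ℕ) :
    Jint k m X Y (π / 2) = Jint k m X Y 0 := by
  obtain ⟨a, ha⟩ := cr_zf hk
  obtain ⟨b, hb⟩ := cr_lf hk
  obtain ⟨c, hc⟩ := ha.pow Y
  obtain ⟨d, hd⟩ := hb.pow X
  obtain ⟨e, he⟩ := cr_ef hk m strip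
  unfold Jint
  simp only [zpow_natCast]
  refine ((hd.mul hc).mul he).integral_const hk (fun χ _ => ?_) ?_
  · simp only [ef_two_pi hk, lzf_two_pi]
  · rw [uIcc_of_ge (by positivity)]
    exact fun x hx => ⟨by linarith [hx.1, Real.pi_pos], by linarith [hx.2, Real.pi_pos]⟩

lemma continuous_Jint_zero_integrand (hk : k ∈ Ioo (0 : ℝ) 1) (m : ℤ) (X : ℕ) (Y : ℤ) :
    Continuous fun φ : ℝ => (lam k φ : ℂ) ^ X *
      Complex.exp ((Y * φ + m * om k * uk k φ : ℝ) * I) / dk k φ := by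
  have h1 := continuous_lam hk
  have h2 := continuous_uk hk
  have hcd := continuous_dk (k := k)
  exact Continuous.div (by fun_prop) (by fun_prop) fun x => by exact_mod_cast (dk_pos hk x).ne'

lemma Phi_eq_re (hk : k ∈ Ioo (0 : ℝ) 1) (m : ℤ) (X : ℕ) (Y : ℤ) :
    Phi k m X Y = (∫ φ in (0:ℝ)..2 * π, (lam k φ : ℂ) ^ X *
      Complex.exp ((Y * φ + m * om k * uk k φ : ℝ) * I) / dk k φ).re := by
  have h := Complex.reCLM.intervalIntegral_comp_comm
    ((continuous_Jint_zero_integrand hk m X Y).intervalIntegrable (μ := MeasureTheory.volume) 0 (2 * π))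
  rw [Complex.reCLM_apply] at h
  rw [← h, Phi]
  congr 1; ext φ
  rw [Complex.reCLM_apply, ← Complex.ofReal_pow, Complex.div_ofReal_re, Complex.re_ofReal_mul,
    Complex.exp_ofReal_mul_I_re]

lemma Jint_zero (m : ℤ) (X : ℕ) (Y : ℤ) : Jint k m X Y 0 =
    ∫ φ in (0:ℝ)..2 * π, (lam k φ : ℂ) ^ X *
      Complex.exp ((Y * φ + m * om k * uk k φ : ℝ) * I) / dk k φ := by
  unfold Jint
  congr 1; ext φ
  rw [lf_zero, zf_zero, ef_zero, ← Complex.exp_int_mul, mul_assoc, ← Complex.exp_add]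
  congr 4; push_cast; ring

lemma Phi_eq (hk : k ∈ Ioo (0 : ℝ) 1) (m : ℤ) (X : ℕ) (Y : ℤ) :
    Phi k m X Y = (Jint k m X Y 0).re := by
  rw [Jint_zero, Phi_eq_re hk]

/-- The rotation identity. -/
lemma Phi_rotate (hk : k ∈ Ioo (0 : ℝ) 1) (m : ℤ) (X Y : ℕ) :
    Phi k m X Y = qk k ^ m * Phi k m Y (-X) := by
  rw [Phi_eq hk, ← Jint_const_nat hk, Phi_eq_re hk, ← Complex.re_ofReal_mul,
    ← intervalIntegral.integral_const_mul]
  congr 1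
  unfold Jint
  congr 1; ext φ
  rw [lf_pi_div_two hk, zf_pi_div_two hk, ef_pi_div_two hk, ← Complex.exp_nat_mul]
  rw [show Complex.exp (((((-X : ℤ) : ℝ) * φ + m * om k * uk k φ : ℝ) : ℂ) * I)
    = Complex.exp (X * (-φ * I)) * Complex.exp ((m * om k * uk k φ : ℝ) * I) by
      rw [← Complex.exp_add]; congr 1; push_cast; ring]
  rw [zpow_natCast]
  ring

/-- The ratio bounding `|z|` and `|z|⁻¹` at height `χ`. -/
def Abd (χ : ℝ) : ℝ := Real.sqrt ((1 + Real.sin χ) / (1 - Real.sin χ))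

lemma sin_lt_one_of_mem {χ : ℝ} (hχ : χ ∈ Ico 0 (π / 2)) : Real.sin χ < 1 := by
  have := Real.sin_lt_sin_of_lt_of_le_pi_div_two (by linarith [hχ.1, Real.pi_pos]) le_rfl hχ.2
  simpa using this

lemma Abd_one_le {χ : ℝ} (hχ : χ ∈ Ico 0 (π / 2)) : 1 ≤ Abd χ := by
  have h1 := sin_lt_one_of_mem hχ
  have h0 := Real.sin_nonneg_of_nonneg_of_le_pi hχ.1 (by linarith [hχ.2, Real.pi_pos])
  rw [Abd, Real.one_le_sqrt, le_div_iff₀ (by linarith)]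
  linarith

lemma norm_zf_zpow_le (hk : k ∈ Ioo (0 : ℝ) 1) (φ : ℝ) {χ : ℝ} (hχ : χ ∈ Ico 0 (π / 2)) (Y : ℤ) :
    ‖zf k φ χ ^ Y‖ ≤ Abd χ ^ Y.natAbs := by
  have hχ' : χ ∈ Ioo (-(π / 2)) (π / 2) := ⟨by linarith [hχ.1, Real.pi_pos], hχ.2⟩
  have h1 := sin_lt_one_of_mem hχ
  have h0 := Real.sin_nonneg_of_nonneg_of_le_pi hχ.1 (by linarith [hχ.2, Real.pi_pos])
  have hA := Abd_one_le hχ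
  have hn : ‖zf k φ χ‖ = Real.sqrt ((1 - dk k φ * Real.sin χ) / (1 + dk k φ * Real.sin χ)) := by
    rw [← normSq_zf hk φ (mem_strip hχ'), Complex.normSq_eq_norm_sq, Real.sqrt_sq (norm_nonneg _)]
  have hd0 := dk_pos hk φ
  have hd1 := dk_le_one (k := k) φ
  have hds : dk k φ * Real.sin χ ≤ Real.sin χ := by nlinarith
  have hds0 : 0 ≤ dk k φ * Real.sin χ := by positivity
  have h2 : ‖zf k φ χ‖ ≤ Abd χ := by
    rw [hn, Abd]
    refine Real.sqrt_le_sqrt ((div_le_div_iff₀ (by linarith) (by linarith)).2 ?_)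
    nlinarith
  have h3 : ‖(zf k φ χ)⁻¹‖ ≤ Abd χ := by
    rw [norm_inv, hn, ← Real.sqrt_inv, Abd, inv_div]
    refine Real.sqrt_le_sqrt ((div_le_div_iff₀ (by linarith) (by linarith)).2 ?_)
    nlinarith
  rcases Int.natAbs_eq Y with h | h
  · rw [h, zpow_natCast, norm_pow, Int.natAbs_natCast]
    exact pow_le_pow_left₀ (norm_nonneg _) h2 _
  · rw [h, zpow_neg, zpow_natCast, ← inv_pow, norm_pow, Int.natAbs_neg, Int.natAbs_natCast]
    exact pow_le_pow_left₀ (norm_nonneg _) h3 _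

lemma abs_Phi_le (hk : k ∈ Ioo (0 : ℝ) 1) (m : ℤ) (X : ℕ) (Y : ℤ) {χ : ℝ}
    (hχ : χ ∈ Ico 0 (π / 2)) :
    |Phi k m X Y| ≤ 4 * Kell k * Real.exp (-(m * om k * tk k χ)) * Abd χ ^ Y.natAbs := by
  rw [Phi_eq hk, ← Jint_const hk m X Y hχ]
  refine (Complex.abs_re_le_norm _).trans ?_
  have hi : IntervalIntegrable (fun φ => Real.exp (-(m * om k * tk k χ)) * Abd χ ^ Y.natAbs *
      (1 / dk k φ)) MeasureTheory.volume 0 (2 * π) :=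
    (continuous_const.mul (continuous_inv_dk hk)).intervalIntegrable _ _
  refine (intervalIntegral.norm_integral_le_of_norm_le (by positivity) ?_ hi).trans ?_
  · refine Filter.Eventually.of_forall fun φ _ => ?_
    have h1 := norm_lf_le hk φ (χ := χ) ⟨hχ.1, hχ.2.le⟩
    have h2 := norm_zf_zpow_le hk φ hχ Y
    have h3 : ‖ef k m φ χ‖ = Real.exp (-(m * om k * tk k χ)) := by
      rw [ef_eq, norm_mul, Complex.norm_exp_ofReal_mul_I, one_mul, Complex.norm_real,
        Real.norm_of_nonneg (Real.exp_pos _).le]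
    have hd0 := dk_pos hk φ
    rw [norm_div, norm_mul, norm_mul, norm_pow, h3, Complex.norm_real, Real.norm_of_nonneg hd0.le,
      div_eq_mul_one_div]
    refine mul_le_mul_of_nonneg_right ?_ (by positivity)
    rw [mul_comm]
    refine mul_le_mul_of_nonneg_left ?_ (Real.exp_pos _).le
    calc ‖lf k φ χ‖ ^ X * ‖zf k φ χ ^ Y‖ ≤ 1 * Abd χ ^ Y.natAbs := by
          gcongr
          exact pow_le_one₀ (norm_nonneg _) h1
      _ = _ := one_mul _
  · rw [intervalIntegral.integral_const_mul, ← uk, uk_two_pi hk]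
    apply le_of_eq; ring

/-- The kernel concentrating at the zeros of `cos` as `χ → π/2`. -/
def ker (k φ χ : ℝ) : ℝ := Real.cos χ * dc k χ / (1 - dk k φ ^ 2 * Real.sin χ ^ 2)

lemma ker_den_pos (hk : k ∈ Ioo (0 : ℝ) 1) (φ : ℝ) {χ : ℝ} (hχ : χ ∈ Ico 0 (π / 2)) :
    0 < 1 - dk k φ ^ 2 * Real.sin χ ^ 2 := by
  have hχ' : χ ∈ Ioo (-(π / 2)) (π / 2) := ⟨by linarith [hχ.1, Real.pi_pos], hχ.2⟩
  have := mul_pos (abs_dk_mul_sin_lt hk φ hχ') (zden_pos hk φ (mem_strip hχ'))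
  nlinarith

lemma ker_den_eq (hk : k ∈ Ioo (0 : ℝ) 1) (φ χ : ℝ) : 1 - dk k φ ^ 2 * Real.sin χ ^ 2 =
    Real.cos χ ^ 2 + k ^ 2 * Real.sin χ ^ 2 * Real.cos φ ^ 2 := by
  rw [dk_sq hk]
  linear_combination -Real.sin_sq_add_cos_sq χ

lemma continuous_ker (hk : k ∈ Ioo (0 : ℝ) 1) {χ : ℝ} (hχ : χ ∈ Ico 0 (π / 2)) :
    Continuous fun φ => ker k φ χ := by
  have hcd := continuous_dk (k := k)
  exact Continuous.div (by fun_prop) (by fun_prop) fun x => (ker_den_pos hk x hχ).ne'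

lemma zf_inv (hk : k ∈ Ioo (0 : ℝ) 1) (φ : ℝ) {χ : ℝ} (hχ : χ ∈ Ico 0 (π / 2)) :
    (zf k φ χ)⁻¹ = (Real.cos φ * dc k χ - I * (Real.sin φ * Real.cos χ)) /
      (1 - dk k φ * Real.sin χ) := by
  have hχ' : χ ∈ Ioo (-(π / 2)) (π / 2) := ⟨by linarith [hχ.1, Real.pi_pos], hχ.2⟩
  have h1 : (1 - dk k φ * Real.sin χ : ℂ) ≠ 0 := by
    exact_mod_cast (abs_dk_mul_sin_lt hk φ hχ').ne'
  have h2 : (1 + dk k φ * Real.sin χ : ℂ) ≠ 0 := by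
    exact_mod_cast (zden_pos hk φ (mem_strip hχ')).ne'
  refine inv_eq_of_mul_eq_one_left ?_
  obtain ⟨e1, e2, e3, e4, -, -⟩ := cr_relations hk φ χ
  rw [zf, div_mul_div_comm, div_eq_one_iff_eq (mul_ne_zero h1 h2)]
  linear_combination (Real.cos φ : ℂ) ^ 2 * e2 + (Real.sin χ : ℂ) ^ 2 * e1
    + (Real.cos χ : ℂ) ^ 2 * e3 + e4 - (Real.sin φ : ℂ) ^ 2 * (Real.cos χ : ℂ) ^ 2 * I_sq

lemma re_source (hk : k ∈ Ioo (0 : ℝ) 1) (φ : ℝ) {χ : ℝ} (hχ : χ ∈ Ico 0 (π / 2)) :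
    (1 - k / 2 * (lf k φ χ * (zf k φ χ + (zf k φ χ)⁻¹))).re = dk k φ * ker k φ χ := by
  have hχ' : χ ∈ Ioo (-(π / 2)) (π / 2) := ⟨by linarith [hχ.1, Real.pi_pos], hχ.2⟩
  have h1 : (1 - dk k φ * Real.sin χ : ℂ) ≠ 0 := by
    exact_mod_cast (abs_dk_mul_sin_lt hk φ hχ').ne'
  have h2 : (1 + dk k φ * Real.sin χ : ℂ) ≠ 0 := by
    exact_mod_cast (zden_pos hk φ (mem_strip hχ')).ne'
  have h3 : (dc k χ + dk k φ * Real.cos χ : ℂ) ≠ 0 := by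
    exact_mod_cast (lden_pos hk φ (mem_strip hχ')).ne'
  have h4 : (1 - dk k φ ^ 2 * Real.sin χ ^ 2 : ℂ) ≠ 0 := by
    exact_mod_cast (ker_den_pos hk φ hχ).ne'
  have key : (1 - k / 2 * (lf k φ χ * (zf k φ χ + (zf k φ χ)⁻¹))) =
      ((dk k φ * ker k φ χ : ℝ) : ℂ) + ((k ^ 2 * Real.cos φ * Real.sin φ * Real.sin χ /
        (1 - dk k φ ^ 2 * Real.sin χ ^ 2) : ℝ) : ℂ) * I := by
    rw [zf_inv hk φ hχ, zf, lf, ker]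
    push_cast
    simp only [← Complex.ofReal_cos, ← Complex.ofReal_sin]
    obtain ⟨e1, e2, e3, e4, -, -⟩ := cr_relations hk φ χ
    generalize (Real.sin φ : ℂ) = S at *
    generalize (Real.cos φ : ℂ) = C at *
    generalize (Real.sin χ : ℂ) = s at *
    generalize (Real.cos χ : ℂ) = c at *
    generalize (dk k φ : ℂ) = d at *
    generalize (dc k χ : ℂ) = D at *
    have e : (C * D + I * (S * c)) / (1 + d * s) + (C * D - I * (S * c)) / (1 - d * s)
        = 2 * (C * D - I * (d * s * c * S)) / (1 - d ^ 2 * s ^ 2) := by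
      rw [div_add_div _ _ h2 h1, div_eq_div_iff (mul_ne_zero h2 h1) h4]
      ring
    rw [e]
    have hq : (D + d * c) * (1 - d ^ 2 * s ^ 2) - k ^ 2 * ((C - I * (s * S)) *
        (C * D - I * (d * s * c * S))) = (d * c * D + k ^ 2 * C * S * s * I) * (D + d * c) := by
      linear_combination (-d ^ 2 * D - d * c) * e4 + (-D - s ^ 2 * d * c) * e1 - d * c * e2
        + k ^ 2 * s ^ 2 * d * c * e3 - k ^ 2 * s ^ 2 * S ^ 2 * d * c * I_sq
    generalize (1 - d ^ 2 * s ^ 2 : ℂ) = Δ at *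
    field_simp
    linear_combination hq
  rw [key, Complex.add_re, Complex.ofReal_re, Complex.re_ofReal_mul, Complex.I_re, mul_zero,
    add_zero]


lemma continuous_lf (hk : k ∈ Ioo (0 : ℝ) 1) {χ : ℝ} (hχ : χ ∈ strip) :
    Continuous fun φ => lf k φ χ := by
  obtain ⟨a, ha⟩ := cr_lf hk
  exact continuous_iff_continuousAt.2 fun φ => (ha.dphi χ hχ φ).continuousAt

lemma continuous_zf (hk : k ∈ Ioo (0 : ℝ) 1) {χ : ℝ} (hχ : χ ∈ strip) :
    Continuous fun φ => zf k φ χ := by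
  obtain ⟨a, ha⟩ := cr_zf hk
  exact continuous_iff_continuousAt.2 fun φ => (ha.dphi χ hχ φ).continuousAt

lemma continuous_ef (hk : k ∈ Ioo (0 : ℝ) 1) (m : ℤ) (χ : ℝ) :
    Continuous fun φ => ef k m φ χ := by
  obtain ⟨a, ha⟩ := cr_ef hk m univ
  exact continuous_iff_continuousAt.2 fun φ => (ha.dphi χ (mem_univ _) φ).continuousAt

lemma continuous_Jint_integrand (hk : k ∈ Ioo (0 : ℝ) 1) (m : ℤ) (X : ℕ) (Y : ℤ) {χ : ℝ}
    (hχ : χ ∈ Ico 0 (π / 2)) :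
    Continuous fun φ => lf k φ χ ^ X * zf k φ χ ^ Y * ef k m φ χ / dk k φ := by
  have hχ' : χ ∈ Ioo (-(π / 2)) (π / 2) := ⟨by linarith [hχ.1, Real.pi_pos], hχ.2⟩
  have h1 := continuous_lf hk (mem_strip hχ')
  have h2 := (continuous_zf hk (mem_strip hχ')).zpow₀ Y fun φ => Or.inl (zf_ne_zero hk φ hχ')
  have h3 := continuous_ef hk m χ
  have hcd := continuous_dk (k := k)
  exact Continuous.div (by fun_prop) (by fun_prop) fun x => by exact_mod_cast (dk_pos hk x).ne'

/-- `∫ cos(Yφ + mωu) dφ`. -/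
def cm (k : ℝ) (m : ℤ) (Y : ℤ) : ℝ :=
  ∫ φ in (0:ℝ)..2 * π, Real.cos (Y * φ + m * om k * uk k φ)

lemma cm_eq (hk : k ∈ Ioo (0 : ℝ) 1) (m Y : ℤ) :
    cm k m Y = Phi k m 0 Y - k / 2 * (Phi k m 1 (Y + 1) + Phi k m 1 (Y - 1)) := by
  have hi : ∀ X Y, IntervalIntegrable
      (fun φ => lam k φ ^ X * Real.cos (Y * φ + m * om k * uk k φ) / dk k φ)
      MeasureTheory.volume 0 (2 * π) := fun X Y => by
    have h1 := continuous_lam hk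
    have h2 := continuous_uk hk
    refine Continuous.intervalIntegrable (Continuous.div (by fun_prop) continuous_dk
      fun x => (dk_pos hk x).ne') _ _
  unfold Phi cm
  rw [← intervalIntegral.integral_add (hi _ _) (hi _ _), ← intervalIntegral.integral_const_mul,
    ← intervalIntegral.integral_sub (hi _ _) (((hi _ _).add (hi _ _)).const_mul _)]
  congr 1; ext φ
  have e1 : Real.cos (((Y + 1 : ℤ) : ℝ) * φ + m * om k * uk k φ) =
      Real.cos ((Y * φ + m * om k * uk k φ) + φ) := by congr 1; push_cast; ring
  have e2 : Real.cos (((Y - 1 : ℤ) : ℝ) * φ + m * om k * uk k φ) =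
      Real.cos ((Y * φ + m * om k * uk k φ) - φ) := by congr 1; push_cast; ring
  rw [e1, e2]
  generalize (Y * φ + m * om k * uk k φ : ℝ) = θ
  rw [Real.cos_add, Real.cos_sub]
  have hd := (dk_pos hk φ).ne'
  field_simp
  linear_combination (-2 * Real.cos θ) * one_sub_lam hk φ

lemma ef_mul_exp (m : ℤ) (φ χ : ℝ) :
    (Real.exp (m * om k * tk k χ) : ℂ) * ef k m φ χ =
      Complex.exp ((m * om k * uk k φ : ℝ) * I) := by
  rw [ef_eq, mul_left_comm, ← Complex.ofReal_mul, ← Real.exp_add, add_neg_cancel, Real.exp_zero]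
  simp

lemma re_interval {f : ℝ → ℂ} (hf : Continuous f) (a b : ℝ) :
    (∫ x in a..b, f x).re = ∫ x in a..b, (f x).re := by
  have h := Complex.reCLM.intervalIntegral_comp_comm
    (hf.intervalIntegrable (μ := MeasureTheory.volume) a b)
  simpa using h.symm

lemma cosh_mul_cm (hk : k ∈ Ioo (0 : ℝ) 1) (m : ℤ) {χ : ℝ} (hχ : χ ∈ Ico 0 (π / 2)) :
    (Real.exp (m * om k * tk k χ) + Real.exp (-(m * om k * tk k χ))) * cm k m 0 =
      2 * ∫ φ in (0:ℝ)..2 * π, ker k φ χ * Real.cos (m * om k * uk k φ) := by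
  have hχ' : χ ∈ Ioo (-(π / 2)) (π / 2) := ⟨by linarith [hχ.1, Real.pi_pos], hχ.2⟩
  have hneg : cm k (-m) 0 = cm k m 0 := by
    unfold cm; congr 1; ext φ; rw [← Real.cos_neg]; congr 1; push_cast; ring
  have hcont : ∀ m : ℤ, Continuous fun φ => (1 - k / 2 * (lf k φ χ * (zf k φ χ + (zf k φ χ)⁻¹))) *
      ef k m φ χ / dk k φ := by
    intro m
    have h1 := continuous_lf hk (mem_strip hχ')
    have h2 := (continuous_zf hk (mem_strip hχ'))
    have h2' := h2.inv₀ fun φ => (zf_ne_zero hk φ hχ')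
    have h3 := continuous_ef hk m χ
    have hcd := continuous_dk (k := k)
    exact Continuous.div ((continuous_const.sub (continuous_const.mul (h1.mul (h2.add h2')))).mul h3)
      (by fun_prop) fun x => by exact_mod_cast (dk_pos hk x).ne'
  have hJ : ∀ m : ℤ, cm k m 0 = (∫ φ in (0:ℝ)..2 * π,
      (1 - k / 2 * (lf k φ χ * (zf k φ χ + (zf k φ χ)⁻¹))) * ef k m φ χ / dk k φ).re := by
    intro m
    rw [cm_eq hk, Phi_eq hk, Phi_eq hk, Phi_eq hk, ← Jint_const hk _ _ _ hχ,
      ← Jint_const hk _ _ _ hχ, ← Jint_const hk _ _ _ hχ, ← Complex.add_re,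
      show k / 2 = ((k / 2 : ℝ) : ℂ).re by simp]
    rw [show ((k / 2 : ℝ) : ℂ).re = k / 2 by simp, ← Complex.re_ofReal_mul, ← Complex.sub_re]
    unfold Jint
    rw [← intervalIntegral.integral_add, ← intervalIntegral.integral_const_mul,
      ← intervalIntegral.integral_sub]
    · congr 2; ext φ
      push_cast
      norm_num
      ring
    · exact (continuous_Jint_integrand hk m 0 0 hχ).intervalIntegrable _ _
    · exact (((continuous_Jint_integrand hk m 1 _ hχ).intervalIntegrable _ _).add
        ((continuous_Jint_integrand hk m 1 _ hχ).intervalIntegrable _ _)).const_mul _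
    · exact (continuous_Jint_integrand hk m 1 _ hχ).intervalIntegrable _ _
    · exact (continuous_Jint_integrand hk m 1 _ hχ).intervalIntegrable _ _
  have h1 := hJ m
  have h2 := hJ (-m)
  rw [hneg] at h2
  rw [add_mul]
  nth_rewrite 1 [h1]
  rw [h2, ← Complex.re_ofReal_mul, ← Complex.re_ofReal_mul, ← Complex.add_re,
    ← intervalIntegral.integral_const_mul, ← intervalIntegral.integral_const_mul,
    ← intervalIntegral.integral_add, re_interval, ← intervalIntegral.integral_const_mul]
  · congr 1; ext φ
    have e1 := ef_mul_exp (k := k) m φ χ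
    have e2 := ef_mul_exp (k := k) (-m) φ χ
    have hd := (dk_pos hk φ).ne'
    rw [show ((-m : ℤ) : ℝ) * om k * tk k χ = -(m * om k * tk k χ) by push_cast; ring] at e2
    generalize hs : (1 - k / 2 * (lf k φ χ * (zf k φ χ + (zf k φ χ)⁻¹)) : ℂ) = s
    rw [mul_div_assoc', mul_div_assoc', ← add_div, mul_left_comm, e1, mul_left_comm, e2, ← mul_add,
      Complex.div_ofReal_re, ← hs]
    have : Complex.exp ((m * om k * uk k φ : ℝ) * I) +
        Complex.exp ((((-m : ℤ) : ℝ) * om k * uk k φ : ℝ) * I) =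
        ((2 * Real.cos (m * om k * uk k φ) : ℝ) : ℂ) := by
      push_cast
      rw [Complex.two_cos]
      congr 2; ring
    rw [this, Complex.re_mul_ofReal, re_source hk φ hχ]
    field_simp
  · exact ((hcont m).const_mul _).add ((hcont (-m)).const_mul _)
  · exact ((hcont m).const_mul _).intervalIntegrable _ _
  · exact ((hcont (-m)).const_mul _).intervalIntegrable _ _

lemma integral_ker (hk : k ∈ Ioo (0 : ℝ) 1) {χ : ℝ} (hχ : χ ∈ Ico 0 (π / 2)) :
    ∫ φ in (0:ℝ)..2 * π, ker k φ χ = 2 * π := by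
  have h := cosh_mul_cm hk 0 hχ
  simp [cm] at h
  linarith

lemma sinh_mul_Phi (hk : k ∈ Ioo (0 : ℝ) 1) (m : ℤ) {χ : ℝ} (hχ : χ ∈ Ico 0 (π / 2)) :
    Real.exp (m * om k * tk k χ) * Phi k m 0 (-1) - Real.exp (-(m * om k * tk k χ)) * Phi k m 0 1 =
      2 / dc k χ * (∫ φ in (0:ℝ)..2 * π, ker k φ χ *
        (Real.sin φ * Real.sin (m * om k * uk k φ) / dk k φ)) +
      2 * Real.sin χ / dc k χ * (∫ φ in (0:ℝ)..2 * π, ker k φ χ *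
        (Real.sin φ * Real.sin (m * om k * uk k φ))) := by
  have hχ' : χ ∈ Ioo (-(π / 2)) (π / 2) := ⟨by linarith [hχ.1, Real.pi_pos], hχ.2⟩
  have hcu := continuous_uk hk
  have hck := continuous_ker hk hχ
  have hneg : Phi k m 0 1 = Phi k (-m) 0 (-1) := by rw [Phi_neg, neg_neg]
  have hc := fun m => continuous_Jint_integrand hk m 0 (-1) hχ
  rw [hneg, Phi_eq hk, Phi_eq hk, ← Jint_const hk _ _ _ hχ, ← Jint_const hk _ _ _ hχ,
    ← Complex.re_ofReal_mul, ← Complex.re_ofReal_mul, ← Complex.sub_re]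
  unfold Jint
  rw [← intervalIntegral.integral_const_mul, ← intervalIntegral.integral_const_mul,
    ← intervalIntegral.integral_sub, re_interval, ← intervalIntegral.integral_const_mul,
    ← intervalIntegral.integral_const_mul, ← intervalIntegral.integral_add]
  · congr 1; ext φ
    have e1 := ef_mul_exp (k := k) m φ χ
    have e2 := ef_mul_exp (k := k) (-m) φ χ
    have hd := (dk_pos hk φ).ne'
    have hdc := (dc_pos hk χ).ne'
    rw [show ((-m : ℤ) : ℝ) * om k * tk k χ = -(m * om k * tk k χ) by push_cast; ring] at e2
    rw [mul_div_assoc', mul_div_assoc', ← sub_div, mul_left_comm, e1, mul_left_comm, e2, ← mul_sub,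
      Complex.div_ofReal_re]
    have : Complex.exp ((m * om k * uk k φ : ℝ) * I) -
        Complex.exp ((((-m : ℤ) : ℝ) * om k * uk k φ : ℝ) * I) =
        ((2 * Real.sin (m * om k * uk k φ) : ℝ) : ℂ) * I := by
      push_cast
      rw [Complex.two_sin, neg_mul, neg_mul]
      linear_combination (Complex.exp (m * om k * uk k φ * I) -
        Complex.exp (-(m * om k * uk k φ) * I)) * I_sq
    have hz : (zf k φ χ)⁻¹ = ((Real.cos φ * dc k χ / (1 - dk k φ * Real.sin χ) : ℝ) : ℂ) -
        ((Real.sin φ * Real.cos χ / (1 - dk k φ * Real.sin χ) : ℝ) : ℂ) * I := by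
      rw [zf_inv hk φ hχ]; push_cast; ring
    rw [this, pow_zero, one_mul, zpow_neg_one, hz]
    have hs1 := (abs_dk_mul_sin_lt hk φ hχ').ne'
    have hs2 := (zden_pos hk φ (mem_strip hχ')).ne'
    have hs3 : 1 - dk k φ ^ 2 * Real.sin χ ^ 2 =
      (1 - dk k φ * Real.sin χ) * (1 + dk k φ * Real.sin χ) := by ring
    rw [ker, hs3]
    simp only [Complex.mul_re, Complex.sub_re, Complex.sub_im, Complex.mul_im, Complex.ofReal_re,
      Complex.ofReal_im, Complex.I_re, Complex.I_im]
    field_simp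
    ring
  · refine Continuous.intervalIntegrable (continuous_const.mul (hck.mul
      (Continuous.div (by fun_prop) continuous_dk fun x => (dk_pos hk x).ne'))) _ _
  · refine Continuous.intervalIntegrable (continuous_const.mul (hck.mul
      (by fun_prop))) _ _
  · exact ((hc m).const_mul _).sub ((hc (-m)).const_mul _)
  · exact ((hc m).const_mul _).intervalIntegrable _ _
  · exact ((hc (-m)).const_mul _).intervalIntegrable _ _

open Filter Topology

lemma ker_nonneg (hk : k ∈ Ioo (0 : ℝ) 1) (φ : ℝ) {χ : ℝ} (hχ : χ ∈ Ico 0 (π / 2)) :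
    0 ≤ ker k φ χ :=
  div_nonneg (mul_nonneg (Real.cos_nonneg_of_mem_Icc ⟨by linarith [hχ.1, Real.pi_pos], hχ.2.le⟩)
    (dc_pos hk χ).le) (ker_den_pos hk φ hχ).le

lemma ker_mul_cos_sq_le (hk : k ∈ Ioo (0 : ℝ) 1) (φ : ℝ) {χ : ℝ} (hχ : χ ∈ Ioo 0 (π / 2)) :
    ker k φ χ * Real.cos φ ^ 2 ≤ Real.cos χ * dc k χ / (k ^ 2 * Real.sin χ ^ 2) := by
  have h1 := ker_den_pos hk φ ⟨hχ.1.le, hχ.2⟩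
  have hs : 0 < Real.sin χ := Real.sin_pos_of_pos_of_lt_pi hχ.1 (by linarith [hχ.2, Real.pi_pos])
  have h2 : 0 < k ^ 2 * Real.sin χ ^ 2 := by have := hk.1; positivity
  have h3 := mul_nonneg (Real.cos_nonneg_of_mem_Icc
    ⟨by linarith [hχ.1, Real.pi_pos], hχ.2.le⟩ : 0 ≤ Real.cos χ) (dc_pos hk χ).le
  rw [ker, div_mul_eq_mul_div, div_le_div_iff₀ h1 h2, mul_assoc]
  refine mul_le_mul_of_nonneg_left ?_ h3
  rw [ker_den_eq hk]
  nlinarith [sq_nonneg (Real.cos χ)]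

lemma cos_ne_zero_of_mem {φ : ℝ} (h : φ ∈ Icc 0 (2 * π)) (h1 : φ ≠ π / 2) (h2 : φ ≠ 3 * π / 2) :
    Real.cos φ ≠ 0 := by
  rw [Real.cos_ne_zero_iff]
  intro n hn
  have hp := Real.pi_pos
  have a1 : (-1 : ℝ) < n := by
    by_contra hc
    have := h.1
    nlinarith
  have a2 : (n : ℝ) < 2 := by
    by_contra hc
    have := h.2
    nlinarith
  have b1 : -1 < n := by exact_mod_cast a1
  have b2 : n < 2 := by exact_mod_cast a2
  interval_cases n
  · exact h1 (by rw [hn]; push_cast; ring)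
  · exact h2 (by rw [hn]; push_cast; ring)

lemma exists_le_add_cos_sq {g : ℝ → ℝ} (hg : Continuous g) {c : ℝ} (h1 : g (π / 2) = c)
    (h2 : g (3 * π / 2) = c) {ε : ℝ} (hε : 0 < ε) :
    ∃ M, ∀ φ ∈ Icc 0 (2 * π), |g φ - c| ≤ ε + M * Real.cos φ ^ 2 := by
  have hcont : Continuous fun φ => |g φ - c| := by fun_prop
  have hS : IsCompact {φ ∈ Icc 0 (2 * π) | ε ≤ |g φ - c|} :=
    isCompact_Icc.inter_right (isClosed_le continuous_const hcont)
  obtain ⟨δ, hδ, hδ'⟩ := hS.exists_forall_le' (f := fun φ => Real.cos φ ^ 2) (a := 0)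
    (by fun_prop) (by
      rintro φ ⟨hφ, hφ'⟩
      refine sq_pos_of_ne_zero (cos_ne_zero_of_mem hφ ?_ ?_)
      · rintro rfl; rw [h1, sub_self, abs_zero] at hφ'; linarith
      · rintro rfl; rw [h2, sub_self, abs_zero] at hφ'; linarith)
  obtain ⟨B, hB⟩ := (isCompact_Icc (a := 0) (b := 2 * π)).exists_bound_of_continuousOn
    hcont.continuousOn
  have hB0 : 0 ≤ B := (norm_nonneg _).trans (hB 0 ⟨le_rfl, by positivity⟩)
  refine ⟨B / δ, fun φ hφ => ?_⟩
  by_cases h : ε ≤ |g φ - c|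
  · have e1 := hδ' φ ⟨hφ, h⟩
    have e2 := hB φ hφ
    rw [Real.norm_eq_abs, abs_abs] at e2
    have e3 : B ≤ B / δ * Real.cos φ ^ 2 := by
      rw [div_mul_eq_mul_div, le_div_iff₀ hδ]
      exact mul_le_mul_of_nonneg_left e1 hB0
    linarith
  · have : 0 ≤ B / δ * Real.cos φ ^ 2 := by positivity
    linarith

lemma abs_integral_ker_sub_le (hk : k ∈ Ioo (0 : ℝ) 1) {g : ℝ → ℝ} (hg : Continuous g)
    {c ε M χ : ℝ} (hM0 : 0 ≤ M) (hM : ∀ φ ∈ Icc 0 (2 * π), |g φ - c| ≤ ε + M * Real.cos φ ^ 2)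
    (hχ : χ ∈ Ioo 0 (π / 2)) :
    |(∫ φ in (0:ℝ)..2 * π, ker k φ χ * g φ) - 2 * π * c| ≤
      2 * π * ε + M * (Real.cos χ * dc k χ / (k ^ 2 * Real.sin χ ^ 2)) * (2 * π) := by
  have hχ' : χ ∈ Ico 0 (π / 2) := ⟨hχ.1.le, hχ.2⟩
  have hc := continuous_ker hk hχ'
  set B := Real.cos χ * dc k χ / (k ^ 2 * Real.sin χ ^ 2)
  have e1 : (∫ φ in (0:ℝ)..2 * π, ker k φ χ * g φ) - 2 * π * c =
      ∫ φ in (0:ℝ)..2 * π, ker k φ χ * (g φ - c) := by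
    simp_rw [mul_sub]
    rw [intervalIntegral.integral_sub, intervalIntegral.integral_mul_const, integral_ker hk hχ']
    · exact (hc.mul hg).intervalIntegrable _ _
    · exact (hc.mul continuous_const).intervalIntegrable _ _
  have hp : (0:ℝ) ≤ 2 * π := by positivity
  have e2 : ∫ φ in (0:ℝ)..2 * π, (ker k φ χ * ε + M * B) = 2 * π * ε + M * B * (2 * π) := by
    rw [intervalIntegral.integral_add, intervalIntegral.integral_mul_const, integral_ker hk hχ',
      intervalIntegral.integral_const]
    · simp; ring
    · exact (hc.mul continuous_const).intervalIntegrable _ _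
    · exact continuous_const.intervalIntegrable _ _
  rw [e1, ← e2]
  refine (intervalIntegral.abs_integral_le_integral_abs hp).trans
    (intervalIntegral.integral_mono_on hp ?_ ?_ ?_)
  · exact Continuous.intervalIntegrable (hc.mul (hg.sub continuous_const)).abs _ _
  · exact Continuous.intervalIntegrable ((hc.mul continuous_const).add continuous_const) _ _
  intro φ hφ
  have h0 := ker_nonneg hk φ hχ'
  rw [abs_mul, abs_of_nonneg h0]
  have h1 := mul_le_mul_of_nonneg_left (hM φ hφ) h0
  have h2 := mul_le_mul_of_nonneg_left (ker_mul_cos_sq_le hk φ hχ) hM0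
  linarith

/-- `ker k · χ dφ` converges weakly to a multiple of the sum of the Dirac masses at `π/2`, `3π/2`. -/
lemma tendsto_integral_ker (hk : k ∈ Ioo (0 : ℝ) 1) {g : ℝ → ℝ} (hg : Continuous g) {c : ℝ}
    (h1 : g (π / 2) = c) (h2 : g (3 * π / 2) = c) :
    Tendsto (fun χ => ∫ φ in (0:ℝ)..2 * π, ker k φ χ * g φ) (𝓝[<] (π / 2)) (𝓝 (2 * π * c)) := by
  rw [Metric.tendsto_nhds]
  intro ε hε
  obtain ⟨M, hM⟩ := exists_le_add_cos_sq hg h1 h2 (ε := ε / (4 * π)) (by positivity)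
  have hM' : ∀ φ ∈ Icc 0 (2 * π), |g φ - c| ≤ ε / (4 * π) + |M| * Real.cos φ ^ 2 := fun φ hφ =>
    (hM φ hφ).trans (by gcongr; exact le_abs_self M)
  have hdc := continuous_dc (k := k)
  have hlim : Tendsto (fun χ => |M| * (Real.cos χ * dc k χ / (k ^ 2 * Real.sin χ ^ 2)) * (2 * π))
      (𝓝[<] (π / 2)) (𝓝 0) := by
    have : ContinuousAt (fun χ => |M| * (Real.cos χ * dc k χ / (k ^ 2 * Real.sin χ ^ 2)) * (2 * π))
        (π / 2) := by
      refine (continuousAt_const.mul (ContinuousAt.div (by fun_prop) (by fun_prop) ?_)).mul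
        continuousAt_const
      simp [hk.1.ne']
    simpa using this.tendsto.mono_left nhdsWithin_le_nhds
  filter_upwards [hlim.eventually_lt_const (u := ε / 2) (by positivity),
    Ioo_mem_nhdsLT (show (0:ℝ) < π / 2 by positivity)] with χ hχ hχ'
  rw [Real.dist_eq]
  have := abs_integral_ker_sub_le hk hg (abs_nonneg M) hM' hχ'
  have e : 2 * π * (ε / (4 * π)) = ε / 2 := by field_simp; ring
  linarith

lemma exp_om_mul (k : ℝ) (m : ℤ) : Real.exp (m * om k * Kell (kComp k)) = qk k ^ (-m) := by
  rw [qk, ← Real.rpow_intCast, ← Real.exp_mul]; congr 1; push_cast; ring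

lemma exp_neg_om_mul (k : ℝ) (m : ℤ) : Real.exp (-(m * om k * Kell (kComp k))) = qk k ^ m := by
  rw [qk, ← Real.rpow_intCast, ← Real.exp_mul]; congr 1; ring

lemma dk_pi_div_two : dk k (π / 2) = 1 := by simp [dk]

lemma dk_three_pi_div_two : dk k (3 * π / 2) = 1 := by
  rw [show 3 * π / 2 = π / 2 + π by ring, dk_add_pi, dk_pi_div_two]

lemma om_uk_pi_div_two (hk : k ∈ Ioo (0 : ℝ) 1) (m : ℤ) :
    m * om k * uk k (π / 2) = m * π / 2 := by
  rw [uk_pi_div_two, mul_assoc, om_mul_Kell hk]; ring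

lemma om_uk_three_pi_div_two (hk : k ∈ Ioo (0 : ℝ) 1) (m : ℤ) :
    m * om k * uk k (3 * π / 2) = m * (2 * π) - m * π / 2 := by
  rw [uk_three_pi_div_two hk]; linear_combination 3 * m * om_mul_Kell hk

lemma cm_zero_eq (hk : k ∈ Ioo (0 : ℝ) 1) (m : ℤ) :
    (qk k ^ (-m) + qk k ^ m) * cm k m 0 = 4 * π * Real.cos (m * π / 2) := by
  have hu := continuous_uk hk
  have ht := continuous_tk hk
  have h := (tendsto_integral_ker hk (g := fun φ => Real.cos (m * om k * uk k φ))
    (c := Real.cos (m * π / 2)) (by fun_prop) (by simp only [om_uk_pi_div_two hk])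
    (by simp only [om_uk_three_pi_div_two hk, Real.cos_int_mul_two_pi_sub])).const_mul 2
  have hL : ContinuousAt (fun χ => (Real.exp (m * om k * tk k χ) +
      Real.exp (-(m * om k * tk k χ))) * cm k m 0) (π / 2) := by fun_prop
  have h' := hL.tendsto.mono_left (nhdsWithin_le_nhds (s := Iio (π / 2)))
  rw [tk_pi_div_two hk, exp_om_mul, exp_neg_om_mul] at h'
  have := tendsto_nhds_unique_of_eventuallyEq h' h (by
    filter_upwards [Ioo_mem_nhdsLT (show (0:ℝ) < π / 2 by positivity)] with χ hχ
    exact cosh_mul_cm hk m ⟨hχ.1.le, hχ.2⟩)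
  rw [this]; ring

lemma Phi_zero_one_eq (hk : k ∈ Ioo (0 : ℝ) 1) (m : ℤ) :
    qk k ^ (-m) * Phi k m 0 (-1) - qk k ^ m * Phi k m 0 1 =
      8 * π / k * Real.sin (m * π / 2) := by
  have hu := continuous_uk hk
  have ht := continuous_tk hk
  have hd := continuous_dk (k := k)
  have hdc := continuous_dc (k := k)
  have s3 : Real.sin (3 * π / 2) = -1 := by
    rw [show 3 * π / 2 = π / 2 + π by ring, Real.sin_add_pi, Real.sin_pi_div_two]
  have hA := tendsto_integral_ker hk
    (g := fun φ => Real.sin φ * Real.sin (m * om k * uk k φ) / dk k φ)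
    (c := Real.sin (m * π / 2))
    (Continuous.div (by fun_prop) hd fun x => (dk_pos hk x).ne')
    (by simp only [om_uk_pi_div_two hk, dk_pi_div_two]; simp)
    (by simp only [om_uk_three_pi_div_two hk, dk_three_pi_div_two, s3,
      Real.sin_int_mul_two_pi_sub]; simp)
  have hB := tendsto_integral_ker hk
    (g := fun φ => Real.sin φ * Real.sin (m * om k * uk k φ))
    (c := Real.sin (m * π / 2)) (by fun_prop)
    (by simp only [om_uk_pi_div_two hk]; simp)
    (by simp only [om_uk_three_pi_div_two hk, s3, Real.sin_int_mul_two_pi_sub]; simp)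
  have hL : ContinuousAt (fun χ => Real.exp (m * om k * tk k χ) * Phi k m 0 (-1) -
      Real.exp (-(m * om k * tk k χ)) * Phi k m 0 1) (π / 2) := by fun_prop
  have h' := hL.tendsto.mono_left (nhdsWithin_le_nhds (s := Iio (π / 2)))
  rw [tk_pi_div_two hk, exp_om_mul, exp_neg_om_mul] at h'
  have c1 : ContinuousAt (fun χ => 2 / dc k χ) (π / 2) :=
    continuousAt_const.div hdc.continuousAt (dc_pos hk _).ne'
  have c2 : ContinuousAt (fun χ => 2 * Real.sin χ / dc k χ) (π / 2) :=
    ContinuousAt.div (by fun_prop) hdc.continuousAt (dc_pos hk _).ne'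
  have h := ((c1.tendsto.mono_left (nhdsWithin_le_nhds (s := Iio (π / 2)))).mul hA).add
    ((c2.tendsto.mono_left (nhdsWithin_le_nhds (s := Iio (π / 2)))).mul hB)
  have := tendsto_nhds_unique_of_eventuallyEq h' h (by
    filter_upwards [Ioo_mem_nhdsLT (show (0:ℝ) < π / 2 by positivity)] with χ hχ
    exact sinh_mul_Phi hk m ⟨hχ.1.le, hχ.2⟩)
  rw [this, dc_pi_div_two hk, Real.sin_pi_div_two]; ring

lemma uk_surjective (hk : k ∈ Ioo (0 : ℝ) 1) : Function.Surjective (uk k) := by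
  have hmono : Monotone fun x => uk k x - x := by
    refine monotone_of_hasDerivAt_nonneg
      (fun x => (hasDerivAt_uk hk x).fun_sub (hasDerivAt_id x)) fun x => ?_
    have h1 := dk_pos hk x
    have h2 := dk_le_one (k := k) x
    have : 1 ≤ 1 / dk k x := by rw [le_div_iff₀ h1]; linarith
    simpa using this
  refine (continuous_uk hk).surjective ?_ ?_
  · refine tendsto_atTop_mono' _ ?_ tendsto_id
    filter_upwards [eventually_ge_atTop 0] with x hx
    have := hmono hx
    simp only [uk_zero] at this
    simp only [id]
    linarith
  · refine tendsto_atBot_mono' _ ?_ tendsto_id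
    filter_upwards [eventually_le_atBot 0] with x hx
    have := hmono hx
    simp only [uk_zero] at this
    simp only [id]
    linarith

/-- The amplitude function, the inverse of `uk`. -/
def amk (hk : k ∈ Ioo (0 : ℝ) 1) : ℝ ≃o ℝ :=
  ((uk_strictMono hk).orderIsoOfSurjective _ (uk_surjective hk)).symm

lemma amk_uk (hk : k ∈ Ioo (0 : ℝ) 1) (x : ℝ) : amk hk (uk k x) = x :=
  ((uk_strictMono hk).orderIsoOfSurjective _ (uk_surjective hk)).symm_apply_apply x

lemma amk_add (hk : k ∈ Ioo (0 : ℝ) 1) (u : ℝ) : amk hk (u + 4 * Kell k) = amk hk u + 2 * π := by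
  obtain ⟨x, rfl⟩ := uk_surjective hk u
  have : uk k x + 4 * Kell k = uk k (x + 2 * π) := by
    rw [show x + 2 * π = x + π + π by ring, uk_add_pi hk, uk_add_pi hk]; ring
  rw [this, amk_uk, amk_uk]

/-- The function on the circle whose Fourier coefficients are the numbers `cm k m A`. -/
def circFun (hk : k ∈ Ioo (0 : ℝ) 1) (A : ℤ) (u : ℝ) : ℂ :=
  Complex.exp (-(A * amk hk u * I)) * dk k (amk hk u)

lemma circFun_periodic (hk : k ∈ Ioo (0 : ℝ) 1) (A : ℤ) :
    Function.Periodic (circFun hk A) (4 * Kell k) := fun u => by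
  have hd : dk k (amk hk u + 2 * π) = dk k (amk hk u) := by
    rw [show amk hk u + 2 * π = amk hk u + π + π by ring, dk_add_pi, dk_add_pi]
  rw [circFun, circFun, amk_add, hd]
  congr 1
  rw [show -((A : ℂ) * ((amk hk u + 2 * π : ℝ) : ℂ) * I) =
    -(A * amk hk u * I) + ((-A : ℤ) : ℂ) * (2 * π * I) by push_cast; ring]
  rw [Complex.exp_add, Complex.exp_int_mul_two_pi_mul_I, mul_one]

lemma continuous_circFun (hk : k ∈ Ioo (0 : ℝ) 1) (A : ℤ) : Continuous (circFun hk A) := by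
  have h1 := (amk hk).continuous
  have h2 := continuous_dk (k := k)
  unfold circFun
  fun_prop

lemma integral_sin_eq_zero (hk : k ∈ Ioo (0 : ℝ) 1) (m A : ℤ) :
    ∫ φ in (0:ℝ)..2 * π, Real.sin (A * φ + m * om k * uk k φ) = 0 := by
  have h := intervalIntegral.integral_comp_sub_left (a := 0) (b := 2 * π)
    (fun φ => Real.sin (A * φ + m * om k * uk k φ)) (2 * π)
  rw [sub_self, sub_zero] at h
  have e : ∀ φ, Real.sin (A * (2 * π - φ) + m * om k * uk k (2 * π - φ)) =
      -Real.sin (A * φ + m * om k * uk k φ) := fun φ => by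
    have : uk k (2 * π - φ) = 4 * Kell k - uk k φ := by
      rw [show 2 * π - φ = -φ + π + π by ring, uk_add_pi hk, uk_add_pi hk, uk_neg]; ring
    rw [this, show A * (2 * π - φ) + m * om k * (4 * Kell k - uk k φ) =
      ((A + m : ℤ) : ℝ) * (2 * π) - (A * φ + m * om k * uk k φ) by
        push_cast; linear_combination 4 * m * om_mul_Kell hk, Real.sin_int_mul_two_pi_sub]
  simp_rw [e] at h
  rw [intervalIntegral.integral_neg] at h
  linarith

lemma hasSum_cm_of_summable (hk : k ∈ Ioo (0 : ℝ) 1) (A : ℤ) (hs : Summable fun m => cm k m A) :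
    HasSum (fun m => cm k m A) (4 * Kell k * kComp k) := by
  have hK := Kell_pos hk
  have : Fact (0 < 4 * Kell k) := ⟨by positivity⟩
  let F : C(AddCircle (4 * Kell k), ℂ) := ⟨(circFun_periodic hk A).lift,
    continuous_coinduced_dom.2 (continuous_circFun hk A)⟩
  have hF : ∀ u : ℝ, F (u : AddCircle (4 * Kell k)) = circFun hk A u := fun u => rfl
  have hc : ∀ m : ℤ, fourierCoeff F m = ((1 / (4 * Kell k) * cm k m A : ℝ) : ℂ) := fun m => by
    rw [fourierCoeff_eq_intervalIntegral _ _ 0, zero_add]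
    have hg : Continuous fun u : ℝ => fourier (-m) (u : AddCircle (4 * Kell k)) •
        F (u : AddCircle (4 * Kell k)) := by
      have h1 : Continuous fun u : ℝ => (u : AddCircle (4 * Kell k)) :=
        AddCircle.continuous_mk' _
      exact (((map_continuous (fourier (-m)))).comp h1).smul ((map_continuous F).comp h1)
    have h := intervalIntegral.integral_deriv_smul_comp (a := 0) (b := 2 * π)
      (fun x _ => hasDerivAt_uk hk x) (continuous_inv_dk hk).continuousOn hg
    rw [uk_zero, uk_two_pi hk] at h
    rw [← h]
    have e : ∀ φ : ℝ, (1 / dk k φ) • ((fun u : ℝ => fourier (-m) (u : AddCircle (4 * Kell k)) •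
        F (u : AddCircle (4 * Kell k))) ∘ uk k) φ =
        ((Real.cos (A * φ + m * om k * uk k φ) : ℝ) : ℂ) +
          ((-Real.sin (A * φ + m * om k * uk k φ) : ℝ) : ℂ) * I := fun φ => by
      have hd : (dk k φ : ℂ) ≠ 0 := by exact_mod_cast (dk_pos hk φ).ne'
      have hK' : (Kell k : ℂ) ≠ 0 := by exact_mod_cast hK.ne'
      simp only [Function.comp, hF, fourier_coe_apply, circFun, amk_uk, smul_eq_mul,
        Complex.real_smul]
      have : Complex.exp (2 * π * I * ((-m : ℤ) : ℂ) * uk k φ / ((4 * Kell k : ℝ) : ℂ)) *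
          Complex.exp (-(A * φ * I)) =
          Complex.exp (-((A * φ + m * om k * uk k φ : ℝ) : ℂ) * I) := by
        rw [← Complex.exp_add, om]; congr 1; push_cast; field_simp; ring
      rw [← mul_assoc (Complex.exp _), this, Complex.exp_mul_I, ← Complex.ofReal_neg,
        ← Complex.ofReal_cos, ← Complex.ofReal_sin, Real.cos_neg, Real.sin_neg]
      push_cast
      field_simp
    have hu := continuous_uk hk
    simp_rw [e]
    rw [intervalIntegral.integral_add, intervalIntegral.integral_mul_const,
      intervalIntegral.integral_ofReal, intervalIntegral.integral_ofReal,
      intervalIntegral.integral_neg, integral_sin_eq_zero hk]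
    · simp [cm]
    · exact Continuous.intervalIntegrable (by fun_prop) _ _
    · exact Continuous.intervalIntegrable (by fun_prop) _ _
  have hsum : Summable (fourierCoeff F) := by
    have : fourierCoeff F = fun m => ((1 / (4 * Kell k) * cm k m A : ℝ) : ℂ) := funext hc
    rw [this]
    exact (Complex.ofRealCLM.summable (hs.mul_left _))
  have h := has_pointwise_sum_fourier_series_of_summable hsum ((0 : ℝ) : AddCircle (4 * Kell k))
  rw [hF] at h
  have h0 : circFun hk A 0 = ((kComp k : ℝ) : ℂ) := by
    have : amk hk 0 = 0 := by simpa [uk_zero] using amk_uk hk 0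
    rw [circFun, this]; simp [dk, kComp]
  rw [h0] at h
  simp_rw [fourier_coe_apply, hc] at h
  have h' := (Complex.hasSum_ofReal (f := fun m : ℤ => 1 / (4 * Kell k) * cm k m A)).1
    (by simpa using h)
  have he : (fun m => cm k m A) = fun m => 4 * Kell k * (1 / (4 * Kell k) * cm k m A) := by
    ext m
    field_simp
  rw [he]
  exact h'.mul_left (4 * Kell k)

lemma hasSum_of_eq {ι : Type*} {f g : ι → ℝ} {a b : ℝ} (h : HasSum f a) (hf : ∀ i, g i = f i)
    (hab : b = a) : HasSum g b := by
  rw [hab, funext hf]; exact h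

lemma cm_by_parts (hk : k ∈ Ioo (0 : ℝ) 1) (m Y : ℤ) :
    Y * cm k m Y + m * om k * Phi k m 0 Y = 0 := by
  have hu := continuous_uk hk
  have hd := continuous_dk (k := k)
  have c1 : Continuous fun φ => Real.cos (Y * φ + m * om k * uk k φ) := by fun_prop
  have c2 : Continuous fun φ => lam k φ ^ 0 * Real.cos (Y * φ + m * om k * uk k φ) / dk k φ := by
    have := continuous_lam hk
    exact Continuous.div (by fun_prop) hd fun x => (dk_pos hk x).ne'
  unfold cm Phi
  rw [← intervalIntegral.integral_const_mul, ← intervalIntegral.integral_const_mul,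
    ← intervalIntegral.integral_add ((c1.const_mul _).intervalIntegrable _ _)
      ((c2.const_mul _).intervalIntegrable _ _)]
  rw [intervalIntegral.integral_eq_sub_of_hasDerivAt
    (f := fun φ => Real.sin (Y * φ + m * om k * uk k φ))]
  · rw [uk_two_pi hk, uk_zero, show (Y : ℝ) * (2 * π) + m * om k * (4 * Kell k) =
      ((Y + m : ℤ) : ℝ) * (2 * π) - 0 by push_cast; linear_combination 4 * m * om_mul_Kell hk,
      Real.sin_int_mul_two_pi_sub]
    simp
  · intro φ _
    have h1 : HasDerivAt (fun φ => (Y : ℝ) * φ + m * om k * uk k φ)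
        (Y * 1 + m * om k * (1 / dk k φ)) φ :=
      ((hasDerivAt_id' φ).const_mul _).fun_add ((hasDerivAt_uk hk φ).const_mul _)
    refine h1.sin.congr_deriv ?_
    ring
  · exact ((c1.const_mul _).add (c2.const_mul _)).intervalIntegrable _ _

lemma Phi_zero_pos (hk : k ∈ Ioo (0 : ℝ) 1) (m : ℤ) (A : ℕ) :
    Phi k m 0 A = qk k ^ m * (qk k ^ m * Phi k m 0 (-A)) := by
  rw [Phi_rotate hk m 0 A, ← Phi_rotate hk m A 0]
  simp

lemma cm_neg (hk : k ∈ Ioo (0 : ℝ) 1) (m : ℤ) {A : ℕ} (hA : A ≠ 0) :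
    cm k (-m) (-A) = -(qk k ^ m * (qk k ^ m * cm k m (-A))) := by
  have h1 := cm_by_parts hk (-m) (-A)
  have h2 := cm_by_parts hk m (-A)
  rw [Phi_neg, neg_neg, Phi_zero_pos hk] at h1
  have hA' : (A : ℝ) ≠ 0 := by exact_mod_cast hA
  push_cast at h1 h2
  refine mul_left_cancel₀ hA' ?_
  linear_combination -h1 - qk k ^ m * qk k ^ m * h2

lemma exists_abs_Phi_le (hk : k ∈ Ioo (0 : ℝ) 1) : ∃ r ∈ Ioo (0:ℝ) 1, ∃ B : ℝ, 1 ≤ B ∧ k * B ^ 2 < 1 ∧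
    ∀ (m : ℕ) (X : ℕ) (Y : ℤ), |Phi k m X Y| ≤ 4 * Kell k * r ^ m * B ^ Y.natAbs := by
  have hlim : Tendsto (fun χ => k * Abd χ ^ 2) (𝓝[>] 0) (𝓝 (k * Abd 0 ^ 2)) := by
    have : ContinuousAt (fun χ => k * Abd χ ^ 2) 0 := by
      unfold Abd
      have : ContinuousAt (fun χ => (1 + Real.sin χ) / (1 - Real.sin χ)) 0 :=
        ContinuousAt.div (by fun_prop) (by fun_prop) (by simp)
      fun_prop
    exact this.tendsto.mono_left nhdsWithin_le_nhds
  have h0 : k * Abd 0 ^ 2 < 1 := by simpa [Abd] using hk.2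
  obtain ⟨χ, h1, h2⟩ := ((hlim.eventually_lt_const h0).and
    (Ioo_mem_nhdsGT (show (0:ℝ) < π / 2 by positivity))).exists
  have hχ : χ ∈ Ico 0 (π / 2) := ⟨h2.1.le, h2.2⟩
  have ht : 0 < tk k χ := by
    rw [← tk_zero (k := k)]; exact tk_strictMono hk h2.1
  refine ⟨Real.exp (-(om k * tk k χ)), ⟨Real.exp_pos _, ?_⟩, Abd χ, Abd_one_le hχ, h1,
    fun m X Y => ?_⟩
  · rw [Real.exp_lt_one_iff]; have := om_pos hk; nlinarith [mul_pos this ht]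
  · refine (abs_Phi_le hk m X Y hχ).trans (le_of_eq ?_)
    rw [← Real.exp_nat_mul]
    congr 3
    push_cast; ring

lemma summable_cm_nat (hk : k ∈ Ioo (0 : ℝ) 1) {A : ℕ} (hA : A ≠ 0) :
    Summable fun m : ℕ => cm k m (-A) := by
  obtain ⟨r, hr, B, -, -, h⟩ := exists_abs_Phi_le hk
  have hA' : (A : ℝ) ≠ 0 := by exact_mod_cast hA
  have he : (fun m : ℕ => cm k m (-A)) = fun m : ℕ => om k / A * (m * Phi k m 0 (-A)) := by
    ext m
    have h2 := cm_by_parts hk m (-A)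
    push_cast at h2
    field_simp
    linear_combination -h2
  rw [he]
  refine Summable.mul_left _ ?_
  have hs := ((summable_pow_mul_geometric_of_norm_lt_one 1
    (show ‖r‖ < 1 by rw [Real.norm_of_nonneg hr.1.le]; exact hr.2)).mul_left (4 * Kell k)).mul_right
    (B ^ (-(A:ℤ)).natAbs)
  refine Summable.of_norm_bounded hs fun m => ?_
  rw [Real.norm_eq_abs, abs_mul, Nat.abs_cast]
  refine (mul_le_mul_of_nonneg_left (h m 0 (-A)) (Nat.cast_nonneg m)).trans (le_of_eq ?_)
  ring

lemma qk_zpow_mul (m : ℕ) (x : ℝ) : qk k ^ (m : ℤ) * (qk k ^ (m : ℤ) * x) = qk k ^ (2 * m) * x := by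
  rw [zpow_natCast]; ring

lemma hasSum_cm (hk : k ∈ Ioo (0 : ℝ) 1) {A : ℕ} (hA : A ≠ 0) :
    HasSum (fun m : ℕ => (1 - qk k ^ (2 * m)) * cm k m (-A)) (4 * Kell k * kComp k) := by
  have hs := summable_cm_nat hk hA
  have hs' : Summable fun m : ℕ => cm k (-m) (-A) := by
    refine Summable.of_norm_bounded hs.norm fun m => ?_
    rw [cm_neg hk m hA, qk_zpow_mul, norm_neg, norm_mul]
    refine mul_le_of_le_one_left (norm_nonneg _) ?_
    rw [Real.norm_of_nonneg (by have := qk_pos (k := k); positivity)]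
    exact pow_le_one₀ qk_pos.le (qk_lt_one hk).le
  have h := (hasSum_cm_of_summable hk (-A) (Summable.of_nat_of_neg hs hs')).nat_add_neg
  have h0 : cm k 0 (-A) = 0 := by
    have := cm_by_parts hk 0 (-A)
    push_cast at this
    have hA' : (A : ℝ) ≠ 0 := by exact_mod_cast hA
    have h2 : (A : ℝ) * cm k 0 (-A) = 0 := by linarith
    simpa [hA] using h2
  rw [h0, add_zero] at h
  refine hasSum_of_eq h (fun m => ?_) rfl
  rw [cm_neg hk m hA, qk_zpow_mul]
  ring

lemma cm_zero_eq' (hk : k ∈ Ioo (0 : ℝ) 1) (m : ℕ) :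
    cm k m 0 = 4 * π * (Real.cos (m * π / 2) * (qk k ^ m / (1 + qk k ^ (2 * m)))) := by
  have h := cm_zero_eq hk m
  have hq := qk_pos (k := k)
  have h1 : qk k ^ m ≠ 0 := by positivity
  have h2 : 1 + qk k ^ (2 * m) ≠ 0 := by positivity
  rw [zpow_neg, zpow_natCast] at h
  have h3 : (1 + qk k ^ (2 * m)) * cm k m 0 = 4 * π * Real.cos (m * π / 2) * qk k ^ m := by
    have : (1 + qk k ^ (2 * m)) = ((qk k ^ m)⁻¹ + qk k ^ m) * qk k ^ m := by
      field_simp; ring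
    push_cast at h
    rw [this]
    linear_combination qk k ^ m * h
  rw [← mul_div_assoc, ← mul_div_assoc, eq_div_iff h2]
  linear_combination h3

lemma abs_div_one_add_le (m : ℕ) : qk k ^ m / (1 + qk k ^ (2 * m)) ≤ qk k ^ m := by
  have hq := qk_pos (k := k)
  refine div_le_self (by positivity) ?_
  have : 0 < qk k ^ (2 * m) := by positivity
  linarith

lemma summable_cos_mul (hk : k ∈ Ioo (0 : ℝ) 1) :
    Summable fun m : ℕ => Real.cos (m * π / 2) * (qk k ^ m / (1 + qk k ^ (2 * m))) := by
  have hq := qk_pos (k := k)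
  refine Summable.of_norm_bounded (summable_geometric_of_lt_one hq.le (qk_lt_one hk)) fun m => ?_
  rw [norm_mul, Real.norm_eq_abs, Real.norm_of_nonneg (show 0 ≤ qk k ^ m / (1 + qk k ^ (2 * m)) by
    positivity)]
  exact (mul_le_of_le_one_left (by positivity) (Real.abs_cos_le_one _)).trans (abs_div_one_add_le m)

/-- The Lambert-type series for `K`. -/
lemma hasSum_cos_mul (hk : k ∈ Ioo (0 : ℝ) 1) :
    HasSum (fun m : ℕ => Real.cos (m * π / 2) * (qk k ^ m / (1 + qk k ^ (2 * m))))
      (Kell k * kComp k / (2 * π) + 1 / 4) := by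
  have hneg : ∀ m : ℤ, cm k (-m) 0 = cm k m 0 := by
    intro m
    unfold cm; congr 1; ext φ; rw [← Real.cos_neg]; congr 1; push_cast; ring
  have hs : Summable fun m : ℕ => cm k m 0 := by
    simp_rw [cm_zero_eq' hk]
    exact (summable_cos_mul hk).mul_left _
  have h := (hasSum_cm_of_summable hk 0 (Summable.of_nat_of_neg hs
    (by simpa only [hneg] using hs))).nat_add_neg
  have h0 : cm k 0 0 = 2 * π := by simp [cm]
  simp_rw [hneg, h0, cm_zero_eq' hk] at h
  have h2 := h.mul_left (1 / (8 * π))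
  refine hasSum_of_eq h2 (fun m => ?_) ?_
  · ring_nf
    field_simp
  · field_simp; ring

lemma term_zero_neg_one (hk : k ∈ Ioo (0 : ℝ) 1) (m : ℕ) :
    (1 - qk k ^ (2 * m)) * Phi k m 0 (-1) =
      8 * π / k * (Real.sin (m * π / 2) * (qk k ^ m / (1 + qk k ^ (2 * m)))) := by
  rcases Nat.eq_zero_or_pos m with rfl | hm
  · simp
  have h := Phi_zero_one_eq hk m
  have h' := Phi_zero_pos hk m 1
  rw [qk_zpow_mul] at h'
  push_cast at h'
  rw [h', zpow_neg, zpow_natCast] at h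
  have hq := qk_pos (k := k)
  have hk0 := hk.1.ne'
  have h1 : qk k ^ m ≠ 0 := by positivity
  have h2 : 1 + qk k ^ (2 * m) ≠ 0 := by positivity
  push_cast at h
  have h3 : (1 - qk k ^ (2 * m)) * Phi k m 0 (-1) * (1 + qk k ^ (2 * m)) =
      8 * π / k * Real.sin (m * π / 2) * qk k ^ m := by
    rw [← h]
    field_simp
    ring
  rw [← mul_div_assoc, ← mul_div_assoc, eq_div_iff h2, h3]
  ring

lemma term_one_neg_one (hk : k ∈ Ioo (0 : ℝ) 1) (m : ℕ) :
    (1 - qk k ^ (2 * m)) * Phi k m 1 (-1) =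
      -(8 * π / k * (Real.cos (m * π / 2) * ((1 - qk k ^ m) * (qk k ^ m / (1 + qk k ^ (2 * m)))))) := by
  rcases Nat.eq_zero_or_pos m with rfl | hm
  · simp
  have hm' : (m : ℤ) ≠ 0 := by exact_mod_cast hm.ne'
  have h := cm_eq hk m 0
  have h' := Phi_rotate hk m 1 1
  rw [zpow_natCast] at h'
  push_cast at h'
  rw [Phi_zero_zero hk hm', zero_add, zero_sub, cm_zero_eq' hk, h'] at h
  have hq := qk_pos (k := k)
  have hk0 := hk.1.ne'
  have h2 : 1 + qk k ^ (2 * m) ≠ 0 := by positivity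
  rw [zero_sub, ← mul_div_assoc, ← mul_div_assoc, div_eq_iff h2] at h
  have h3 : 4 * π * (Real.cos (m * π / 2) * qk k ^ m) =
      -(k / 2 * (1 + qk k ^ m) * (1 + qk k ^ (2 * m)) * Phi k m 1 (-1)) := by
    linear_combination h
  rw [← mul_div_assoc, ← mul_div_assoc, ← mul_div_assoc, ← neg_div, eq_div_iff h2]
  have h4 : 8 * π / k * (Real.cos (m * π / 2) * ((1 - qk k ^ m) * qk k ^ m)) =
      2 / k * (1 - qk k ^ m) * (4 * π * (Real.cos (m * π / 2) * qk k ^ m)) := by ring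
  rw [h4, h3]
  field_simp
  ring

/-- The terms of the series defining `Psi`. -/
def psiTerm (k : ℝ) (N X : ℕ) (Y : ℤ) (m : ℕ) : ℝ :=
  (1 - qk k ^ (2 * m)) * qk k ^ (m * N) * Phi k m X Y

/-- The harmonic function with a source on the sheet `N = 0`. -/
def Psi (k : ℝ) (N X : ℕ) (Y : ℤ) : ℝ := 1 / (4 * Kell k * kComp k) * ∑' m, psiTerm k N X Y m

lemma kComp_pos (hk : k ∈ Ioo (0 : ℝ) 1) : 0 < kComp k := by
  have h1 := hk.1
  have h2 := hk.2
  exact Real.sqrt_pos.2 (by nlinarith)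

lemma abs_psiTerm_le (hk : k ∈ Ioo (0 : ℝ) 1) (N X : ℕ) (Y : ℤ) (m : ℕ) :
    |psiTerm k N X Y m| ≤ |Phi k m X Y| := by
  have hq := qk_pos (k := k)
  have hq1 := (qk_lt_one hk).le
  have h1 : qk k ^ (2 * m) ≤ 1 := pow_le_one₀ hq.le hq1
  have h2 : qk k ^ (m * N) ≤ 1 := pow_le_one₀ hq.le hq1
  have h3 : 0 < qk k ^ (2 * m) := by positivity
  have h4 : 0 < qk k ^ (m * N) := by positivity
  rw [psiTerm, abs_mul]
  refine mul_le_of_le_one_left (abs_nonneg _) ?_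
  rw [abs_of_nonneg (mul_nonneg (by linarith) h4.le)]
  exact mul_le_one₀ (by linarith) h4.le h2

lemma exists_hasSum_bound (hk : k ∈ Ioo (0 : ℝ) 1) : ∃ B M : ℝ, 1 ≤ B ∧ k * B ^ 2 < 1 ∧ 0 ≤ M ∧
    ∀ (N X : ℕ) (Y : ℤ), Summable (psiTerm k N X Y) ∧ |Psi k N X Y| ≤ M * B ^ Y.natAbs := by
  obtain ⟨r, hr, B, h1, h2, h⟩ := exists_abs_Phi_le hk
  have hK := Kell_pos hk
  have hk' := kComp_pos hk
  have hr1 : 0 < 1 - r := by linarith [hr.2]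
  refine ⟨B, 1 / (4 * Kell k * kComp k) * (4 * Kell k * (1 - r)⁻¹), h1, h2, by positivity,
    fun N X Y => ?_⟩
  have hs : HasSum (fun m => 4 * Kell k * r ^ m * B ^ Y.natAbs)
      (4 * Kell k * (1 - r)⁻¹ * B ^ Y.natAbs) :=
    ((hasSum_geometric_of_lt_one hr.1.le hr.2).mul_left _).mul_right _
  have hb : ∀ m, ‖psiTerm k N X Y m‖ ≤ 4 * Kell k * r ^ m * B ^ Y.natAbs := fun m =>
    (abs_psiTerm_le hk N X Y m).trans (h m X Y)
  refine ⟨Summable.of_norm_bounded hs.summable hb, ?_⟩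
  rw [Psi, abs_mul, abs_of_pos (by positivity), mul_assoc (1 / _)]
  refine mul_le_mul_of_nonneg_left ?_ (by positivity)
  exact tsum_of_norm_bounded hs hb

lemma summable_psiTerm (hk : k ∈ Ioo (0 : ℝ) 1) (N X : ℕ) (Y : ℤ) : Summable (psiTerm k N X Y) := by
  obtain ⟨_, _, _, _, _, h⟩ := exists_hasSum_bound hk
  exact (h N X Y).1

lemma Psi_harmonic (hk : k ∈ Ioo (0 : ℝ) 1) (N X : ℕ) (Y : ℤ) : Psi k N (X + 1) Y =
    k / 4 * (Psi k N (X + 2) (Y + 1) + Psi k N (X + 2) (Y - 1) + Psi k N X (Y + 1) +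
      Psi k N X (Y - 1)) := by
  have s := summable_psiTerm hk N
  have : ∑' m, psiTerm k N (X + 1) Y m = k / 4 * (∑' m, psiTerm k N (X + 2) (Y + 1) m +
      ∑' m, psiTerm k N (X + 2) (Y - 1) m + ∑' m, psiTerm k N X (Y + 1) m +
      ∑' m, psiTerm k N X (Y - 1) m) := by
    rw [← (s _ _).tsum_add (s _ _), ← ((s _ _).add (s _ _)).tsum_add (s _ _),
      ← (((s _ _).add (s _ _)).add (s _ _)).tsum_add (s _ _), ← tsum_mul_left]
    congr 1; ext m
    simp only [psiTerm]
    rw [Phi_harmonic hk]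
    ring
  simp only [Psi, this]
  ring

lemma Psi_rotate (hk : k ∈ Ioo (0 : ℝ) 1) (N X Y : ℕ) :
    Psi k N X Y = Psi k (N + 1) Y (-X) := by
  unfold Psi
  congr 2; ext m
  simp only [psiTerm]
  rw [Phi_rotate hk m X Y, zpow_natCast]
  ring

lemma Psi_zero_zero (hk : k ∈ Ioo (0 : ℝ) 1) (N : ℕ) : Psi k N 0 0 = 0 := by
  have : psiTerm k N 0 0 = fun _ => 0 := by
    ext m
    rcases Nat.eq_zero_or_pos m with rfl | hm
    · simp [psiTerm]
    · rw [psiTerm, Phi_zero_zero hk (by exact_mod_cast hm.ne'), mul_zero]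
  rw [Psi, this, tsum_zero, mul_zero]

lemma Psi_source (hk : k ∈ Ioo (0 : ℝ) 1) {A : ℕ} (hA : A ≠ 0) : Psi k 0 0 (-A) =
    1 + k / 2 * (Psi k 0 1 (-A + 1) + Psi k 0 1 (-A - 1)) := by
  have hK := Kell_pos hk
  have hk' := kComp_pos hk
  have s := summable_psiTerm hk 0
  have h := (hasSum_cm hk hA).tsum_eq
  have h2 : ∑' m : ℕ, (1 - qk k ^ (2 * m)) * cm k m (-A) = ∑' m, psiTerm k 0 0 (-A) m -
      k / 2 * (∑' m, psiTerm k 0 1 (-A + 1) m + ∑' m, psiTerm k 0 1 (-A - 1) m) := by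
    rw [← (s _ _).tsum_add (s _ _), ← tsum_mul_left,
      ← (s _ _).tsum_sub (((s _ _).add (s _ _)).mul_left _)]
    congr 1; ext m
    simp only [psiTerm]
    rw [cm_eq hk]
    ring
  rw [h2] at h
  have e : ∑' m, psiTerm k 0 0 (-A) m = 4 * Kell k * kComp k +
      k / 2 * (∑' m, psiTerm k 0 1 (-A + 1) m + ∑' m, psiTerm k 0 1 (-A - 1) m) := by linarith
  simp only [Psi, e]
  field_simp

lemma hasSum_sin_term (hk : k ∈ Ioo (0 : ℝ) 1) (N : ℕ) :
    HasSum (fun m : ℕ => Real.sin (m * π / 2) * (qk k ^ (m * (N + 1)) / (1 + qk k ^ (2 * m))))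
      (k * Kell k * kComp k / (2 * π) * Psi k N 0 (-1)) := by
  have hK := Kell_pos hk
  have hk' := kComp_pos hk
  have hk0 := hk.1
  have h := (summable_psiTerm hk N 0 (-1)).hasSum.mul_left (k / (8 * π))
  refine hasSum_of_eq h (fun m => ?_) ?_
  · rw [psiTerm, mul_right_comm, term_zero_neg_one hk]
    field_simp
    ring
  · rw [Psi]; field_simp; ring

lemma hasSum_cos_term (hk : k ∈ Ioo (0 : ℝ) 1) (N : ℕ) :
    HasSum (fun m : ℕ => Real.cos (m * π / 2) * ((1 - qk k ^ m) *
      (qk k ^ (m * (N + 1)) / (1 + qk k ^ (2 * m)))))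
      (-(k * Kell k * kComp k / (2 * π) * Psi k N 1 (-1))) := by
  have hK := Kell_pos hk
  have hk' := kComp_pos hk
  have hk0 := hk.1
  have h := (summable_psiTerm hk N 1 (-1)).hasSum.mul_left (-(k / (8 * π)))
  refine hasSum_of_eq h (fun m => ?_) ?_
  · rw [psiTerm, mul_right_comm, term_one_neg_one hk]
    field_simp
    ring
  · rw [Psi]; field_simp; ring

/-- Normal form of the point `i ^ N * (a + i b)` on the universal cover of the punctured lattice:
the second coordinate is kept positive and the third one nonnegative, away from the origin. -/
def nrm (N a b : ℤ) : ℤ × ℤ × ℤ :=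
  if b < 0 then (N - 1, -b, a) else if a = 0 then (N + 1, b, 0) else (N, a, b)

/-- The harmonic function `Psi`, in terms of normal forms. -/
def hS (k : ℝ) (s : ℤ × ℤ × ℤ) : ℝ :=
  if 0 ≤ s.1 then Psi k s.1.toNat s.2.2.toNat (-s.2.1)
  else Psi k (-s.1 - 1).toNat s.2.1.toNat (-s.2.2)

lemma hS_natCast (n a b : ℕ) : hS k (n, a, b) = Psi k n b (-a) := by
  simp [hS]

lemma hS_neg_natCast (n a b : ℕ) : hS k (-n - 1, a, b) = Psi k n a (-b) := by
  rw [hS, if_neg (by simp only; omega)]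
  simp

lemma hS_nrm_nonneg (hk : k ∈ Ioo (0 : ℝ) 1) (n a b : ℕ) :
    hS k (nrm n a b) = Psi k n b (-a) := by
  rcases Nat.eq_zero_or_pos a with rfl | ha
  · have := hS_natCast (k := k) (n + 1) b 0
    push_cast at this
    rw [nrm, if_neg (by omega), if_pos (by simp), this, ← Psi_rotate hk n b 0]
    simp
  · rw [nrm, if_neg (by omega), if_neg (by omega), hS_natCast]

lemma hS_nrm_neg (hk : k ∈ Ioo (0 : ℝ) 1) (n a b : ℕ) :
    hS k (nrm (-n - 1) a b) = Psi k n a (-b) := by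
  rcases Nat.eq_zero_or_pos a with rfl | ha
  · rcases n with _ | n
    · have := hS_natCast (k := k) 0 b 0
      push_cast at this
      rw [nrm, if_neg (by omega), if_pos (by simp)]
      simpa using this
    · have := hS_neg_natCast (k := k) n b 0
      have h2 := Psi_rotate hk n b 0
      push_cast at this h2
      simp only [neg_zero] at this
      have e : -((n + 1 : ℕ) : ℤ) - 1 + 1 = -n - 1 := by push_cast; ring
      rw [nrm, if_neg (by omega), if_pos (by simp), e, this, h2]
  · rw [nrm, if_neg (by omega), if_neg (by omega), hS_neg_natCast]

/-- The sum of a function over the four diagonal neighbours of `i ^ N * (a + i b)`. -/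
def nbr {R : Type*} [Add R] (f : ℤ × ℤ × ℤ → R) (N a b : ℤ) : R :=
  f (nrm N (a + 1) (b + 1)) + f (nrm N (a + 1) (b - 1)) + f (nrm N (a - 1) (b + 1)) +
    f (nrm N (a - 1) (b - 1))

lemma nrm_neg_one (N a : ℤ) : nrm N a (0 - 1) = (N - 1, 1, a) := by simp [nrm]

lemma hS_eq_nonneg_succ (hk : k ∈ Ioo (0 : ℝ) 1) (n a b : ℕ) :
    hS k (n, (a + 1 : ℕ), (b + 1 : ℕ)) =
      k / 4 * nbr (hS k) n (a + 1 : ℕ) (b + 1 : ℕ) := by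
  have h1 := hS_nrm_nonneg hk n (a + 2) (b + 2)
  have h2 := hS_nrm_nonneg hk n (a + 2) b
  have h3 := hS_nrm_nonneg hk n a (b + 2)
  have h4 := hS_nrm_nonneg hk n a b
  have e1 : ((a + 1 : ℕ) : ℤ) + 1 = (a + 2 : ℕ) := by push_cast; ring
  have e2 : ((b + 1 : ℕ) : ℤ) + 1 = (b + 2 : ℕ) := by push_cast; ring
  have e3 : ((a + 1 : ℕ) : ℤ) - 1 = a := by push_cast; ring
  have e4 : ((b + 1 : ℕ) : ℤ) - 1 = b := by push_cast; ring
  rw [nbr, e1, e2, e3, e4, h1, h2, h3, h4, hS_natCast, Psi_harmonic hk]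
  have f1 : -((a + 1 : ℕ) : ℤ) + 1 = -a := by push_cast; ring
  have f2 : -((a + 1 : ℕ) : ℤ) - 1 = -(a + 2 : ℕ) := by push_cast; ring
  rw [f1, f2]
  ring

lemma hS_eq_pos_zero (hk : k ∈ Ioo (0 : ℝ) 1) (n a : ℕ) :
    hS k ((n + 1 : ℕ), (a + 1 : ℕ), 0) = k / 4 * nbr (hS k) (n + 1 : ℕ) (a + 1 : ℕ) 0 := by
  have h0 := hS_natCast (k := k) (n + 1) (a + 1) 0
  have h1 := hS_nrm_nonneg hk (n + 1) (a + 2) 1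
  have h2 := hS_natCast (k := k) n 1 (a + 2)
  have h3 := hS_nrm_nonneg hk (n + 1) a 1
  have h4 := hS_natCast (k := k) n 1 a
  have e1 : ((a + 1 : ℕ) : ℤ) + 1 = (a + 2 : ℕ) := by push_cast; ring
  have e3 : ((a + 1 : ℕ) : ℤ) - 1 = a := by push_cast; ring
  have e5 : ((n + 1 : ℕ) : ℤ) - 1 = n := by push_cast; ring
  have r1 := Psi_rotate hk n (a + 1) 0
  have r2 := Psi_rotate hk n (a + 2) 1
  have r3 := Psi_rotate hk n a 1
  rw [Nat.cast_zero] at h0 r1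
  rw [Nat.cast_one] at h1 h2 h3 h4 r2 r3
  rw [nbr, e1, e3, nrm_neg_one, nrm_neg_one, e5, zero_add, h1, h2, h3, h4, h0, ← r1, ← r2, ← r3,
    Psi_harmonic hk]
  rw [zero_add, zero_sub]

lemma hS_eq_zero_zero (hk : k ∈ Ioo (0 : ℝ) 1) (a : ℕ) :
    hS k (0, (a + 1 : ℕ), 0) = 1 + k / 4 * nbr (hS k) 0 (a + 1 : ℕ) 0 := by
  have h0 := hS_natCast (k := k) 0 (a + 1) 0
  have h1 := hS_nrm_nonneg hk 0 (a + 2) 1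
  have h2 := hS_neg_natCast (k := k) 0 1 (a + 2)
  have h3 := hS_nrm_nonneg hk 0 a 1
  have h4 := hS_neg_natCast (k := k) 0 1 a
  have e1 : ((a + 1 : ℕ) : ℤ) + 1 = (a + 2 : ℕ) := by push_cast; ring
  have e3 : ((a + 1 : ℕ) : ℤ) - 1 = a := by push_cast; ring
  have r1 := Psi_source hk (A := a + 1) (by omega)
  rw [Nat.cast_zero] at h0 h1 h2 h3 h4
  rw [Nat.cast_one] at h1 h2 h3 h4
  rw [neg_zero] at h2 h4
  rw [nbr, e1, e3, nrm_neg_one, nrm_neg_one, zero_add, h1, h2, h3, h4, h0, r1]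
  have f1 : -((a + 1 : ℕ) : ℤ) + 1 = -a := by push_cast; ring
  have f2 : -((a + 1 : ℕ) : ℤ) - 1 = -(a + 2 : ℕ) := by push_cast; ring
  rw [f1, f2]
  ring

lemma hS_eq_neg (hk : k ∈ Ioo (0 : ℝ) 1) (n a b : ℕ) :
    hS k (-n - 1, (a + 1 : ℕ), b) = k / 4 * nbr (hS k) (-n - 1) (a + 1 : ℕ) b := by
  have h1 := hS_nrm_neg hk n (a + 2) (b + 1)
  have h3 := hS_nrm_neg hk n a (b + 1)
  have e1 : ((a + 1 : ℕ) : ℤ) + 1 = (a + 2 : ℕ) := by push_cast; ring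
  have e3 : ((a + 1 : ℕ) : ℤ) - 1 = a := by push_cast; ring
  have h2 : ∀ c : ℕ, hS k (nrm (-n - 1) c (b - 1)) = Psi k n c (-b + 1) := by
    intro c
    rcases b with _ | b
    · have r := Psi_rotate hk n c 1
      have h := hS_neg_natCast (k := k) (n + 1) 1 c
      have e5 : (-(n : ℤ) - 1) - 1 = -((n + 1 : ℕ) : ℤ) - 1 := by push_cast; ring
      rw [Nat.cast_one] at r h
      rw [Nat.cast_zero, nrm_neg_one, e5, h, neg_zero, zero_add, r]
    · have := hS_nrm_neg hk n c b
      have e4 : ((b + 1 : ℕ) : ℤ) - 1 = b := by push_cast; ring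
      have e5 : -((b + 1 : ℕ) : ℤ) + 1 = -b := by push_cast; ring
      rw [e4, e5, this]
  have e2 : (b : ℤ) + 1 = (b + 1 : ℕ) := by push_cast; ring
  have e6 : -((b : ℕ) : ℤ) - 1 = -(b + 1 : ℕ) := by push_cast; ring
  rw [nbr, e1, e3, h2, h2, e2, h1, h3, hS_neg_natCast, Psi_harmonic hk, e6]
  ring

lemma hS_eq (hk : k ∈ Ioo (0 : ℝ) 1) (N : ℤ) {a b : ℤ} (ha : 1 ≤ a) (hb : 0 ≤ b) :
    hS k (N, a, b) = (if N = 0 ∧ b = 0 then 1 else 0) + k / 4 * nbr (hS k) N a b := by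
  obtain ⟨a, rfl⟩ : ∃ a' : ℕ, a = (a' + 1 : ℕ) := ⟨(a - 1).toNat, by omega⟩
  lift b to ℕ using hb
  rcases lt_or_ge N 0 with hN | hN
  · obtain ⟨n, rfl⟩ : ∃ n : ℕ, N = -n - 1 := ⟨(-N - 1).toNat, by omega⟩
    rw [hS_eq_neg hk, if_neg (by omega), zero_add]
  · lift N to ℕ using hN
    rcases b with _ | b
    · rcases N with _ | n
      · simpa using hS_eq_zero_zero hk a
      · rw [Nat.cast_zero, hS_eq_pos_zero hk, if_neg (by omega), zero_add]
    · rw [hS_eq_nonneg_succ hk, if_neg (by omega), zero_add]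

lemma hS_dead (hk : k ∈ Ioo (0 : ℝ) 1) (N : ℤ) : hS k (N, 0, 0) = 0 := by
  simp only [hS]
  split_ifs <;> simp [Psi_zero_zero hk]

/-- The root smaller than one of `k x ^ 2 - 2 x + k`. -/
def psk (k : ℝ) : ℝ := (1 - kComp k) / k

lemma kComp_sq (hk : k ∈ Ioo (0 : ℝ) 1) : kComp k ^ 2 = 1 - k ^ 2 :=
  Real.sq_sqrt (by nlinarith [hk.1, hk.2])

lemma kComp_lt_one (hk : k ∈ Ioo (0 : ℝ) 1) : kComp k < 1 := by
  nlinarith [kComp_sq hk, kComp_pos hk, hk.1, hk.2]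

lemma psk_pos (hk : k ∈ Ioo (0 : ℝ) 1) : 0 < psk k :=
  div_pos (by linarith [kComp_lt_one hk]) hk.1

lemma mul_psk (hk : k ∈ Ioo (0 : ℝ) 1) : k * psk k = 1 - kComp k := by
  have := hk.1.ne'
  rw [psk]; field_simp

lemma psk_quad (hk : k ∈ Ioo (0 : ℝ) 1) : k * (psk k ^ 2 + 1) = 2 * psk k := by
  have h := mul_psk hk
  have h2 := kComp_sq hk
  refine mul_left_cancel₀ hk.1.ne' ?_
  have : kComp k = 1 - k * psk k := by linarith
  rw [this] at h2
  linear_combination h2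

lemma psk_le_one (hk : k ∈ Ioo (0 : ℝ) 1) : psk k ≤ 1 := by
  rw [psk, div_le_one hk.1]
  nlinarith [kComp_sq hk, kComp_pos hk, hk.1, hk.2, kComp_lt_one hk]

/-- The correction of `hS` on the sheets on which the killed walk is counted. -/
def edge (k : ℝ) (s : ℤ × ℤ × ℤ) : ℝ :=
  if s.1 = 0 then 1 - psk k ^ s.2.1 else if s.1 = -1 then 1 - psk k ^ s.2.2 else 0

lemma edge_nrm_nonneg (N : ℤ) (a : ℤ) {b : ℤ} (hb : 0 ≤ b) :
    edge k (nrm N a b) = edge k (N, a, b) := by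
  rw [nrm, if_neg (by omega)]
  split_ifs with h
  · subst h
    by_cases h0 : N = 0
    · subst h0; simp [edge]
    by_cases h1 : N = -1
    · subst h1; simp [edge]
    by_cases h2 : N = -2
    · subst h2; simp [edge]
    have e1 : N + 1 ≠ 0 := by omega
    have e2 : N + 1 ≠ -1 := by omega
    simp [edge, h0, h1, e1, e2]
  · rfl

/-- Indicator that the half step from height `b ± 1` to `b` on sheet `N` ends in a quadrant
that is counted. -/
def qInd (N b : ℤ) : ℕ :=
  if (if b < 0 then N - 1 else N) = 0 ∨ (if b < 0 then N - 1 else N) = -1 then 1 else 0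

/-- The number of walks of length `j + 1` from a given state whose last half step ends in one of
the quadrants that are counted. -/
def cnt : ℕ → ℤ × ℤ × ℤ → ℕ
  | 0, s => if s.2.1 = 0 then 0 else 2 * (qInd s.1 (s.2.2 + 1) + qInd s.1 (s.2.2 - 1))
  | j + 1, s => if s.2.1 = 0 then 0 else nbr (cnt j) s.1 s.2.1 s.2.2

lemma edge_eq (hk : k ∈ Ioo (0 : ℝ) 1) (N : ℤ) {a b : ℤ} (ha : 1 ≤ a) (hb : 0 ≤ b) :
    edge k (N, a, b) + kComp k / 2 * ((if N + 1 = 0 ∧ b = 0 then 1 else 0) +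
      (if N - 1 = 0 ∧ b = 0 then 1 else 0)) =
    (1 - k) / 4 * (cnt 0 (N, a, b) : ℕ) + k / 4 * nbr (edge k) N a b := by
  have hp := (psk_pos hk).ne'
  have hq := psk_quad hk
  have hm := mul_psk hk
  have z1 : ∀ c : ℤ, psk k ^ (c + 1) + psk k ^ (c - 1) = 2 / k * psk k ^ c := fun c => by
    rw [zpow_add₀ hp, zpow_sub₀ hp, zpow_one]
    have := hk.1.ne'
    field_simp
    linear_combination hq
  have z2 : ∀ c : ℤ, k * (psk k ^ (c + 1) + psk k ^ (c - 1)) = 2 * psk k ^ c := fun c => by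
    rw [z1]; have := hk.1.ne'; field_simp
  have za := z2 a
  have zb := z2 b
  have ha0 : a ≠ 0 := by omega
  rcases hb.eq_or_lt with rfl | hb
  · rw [nbr, edge_nrm_nonneg N (a + 1) (b := 0 + 1) (by norm_num),
      edge_nrm_nonneg N (a - 1) (b := 0 + 1) (by norm_num), nrm_neg_one, nrm_neg_one]
    by_cases h0 : N = 0
    · subst h0
      simp [edge, cnt, qInd, ha0]
      linarith
    by_cases h1 : N = -1
    · subst h1
      simp [edge, cnt, qInd, ha0]
      linarith
    by_cases h2 : N = 1
    · subst h2
      simp [edge, cnt, qInd, ha0]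
      linarith
    have e1 : N - 1 ≠ 0 := by omega
    have e2 : N - 1 ≠ -1 := by omega
    have e3 : N + 1 ≠ 0 := by omega
    simp [edge, cnt, qInd, ha0, h0, h1, e1, e2, e3]
  · have hb0 : b ≠ 0 := by omega
    have hb1 : ¬ b + 1 < 0 := by omega
    have hb2 : ¬ b - 1 < 0 := by omega
    rw [nbr, edge_nrm_nonneg _ _ (by omega), edge_nrm_nonneg _ _ (by omega),
      edge_nrm_nonneg _ _ (by omega), edge_nrm_nonneg _ _ (by omega)]
    by_cases h0 : N = 0
    · subst h0
      simp only [edge, cnt, qInd, ha0, hb0, hb1, hb2]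
      norm_num
      linarith
    by_cases h1 : N = -1
    · subst h1
      simp only [edge, cnt, qInd, ha0, hb0, hb1, hb2]
      norm_num
      linarith
    simp [edge, cnt, qInd, ha0, hb0, hb1, hb2, h0, h1]

/-- The generating function of the numbers `cnt j s`. -/
def Vf (k : ℝ) (s : ℤ × ℤ × ℤ) : ℝ :=
  kComp k / 2 * (hS k (s.1 + 1, s.2) + hS k (s.1 - 1, s.2)) + edge k s

lemma nrm_shift (N c a b : ℤ) : nrm (N + c) a b = ((nrm N a b).1 + c, (nrm N a b).2) := by
  unfold nrm
  split_ifs <;> simp <;> ring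

lemma nbr_Vf (N a b : ℤ) : nbr (Vf k) N a b =
    kComp k / 2 * (nbr (hS k) (N + 1) a b + nbr (hS k) (N - 1) a b) + nbr (edge k) N a b := by
  simp only [nbr, sub_eq_add_neg N 1, nrm_shift, Vf]
  simp only [← sub_eq_add_neg]
  ring

lemma Vf_eq (hk : k ∈ Ioo (0 : ℝ) 1) (N : ℤ) {a b : ℤ} (ha : 1 ≤ a) (hb : 0 ≤ b) :
    Vf k (N, a, b) = (1 - k) / 4 * (cnt 0 (N, a, b) : ℕ) + k / 4 * nbr (Vf k) N a b := by
  rw [nbr_Vf, Vf]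
  simp only
  rw [hS_eq hk (N + 1) ha hb, hS_eq hk (N - 1) ha hb]
  linear_combination edge_eq hk N ha hb

/-- States that are in normal form (or dead). -/
def Valid (s : ℤ × ℤ × ℤ) : Prop := (1 ≤ s.2.1 ∧ 0 ≤ s.2.2) ∨ (s.2.1 = 0 ∧ s.2.2 = 0)

lemma valid_nrm (N : ℤ) {a b : ℤ} (ha : 0 ≤ a) (hb : -1 ≤ b) : Valid (nrm N a b) := by
  simp only [nrm, Valid]
  split_ifs <;> dsimp only <;> omega

lemma nrm_sum_le (N a b : ℤ) :
    (nrm N a b).2.1 + (nrm N a b).2.2 ≤ a + |b| := by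
  simp only [nrm]
  split_ifs with h1 h2
  · rw [abs_of_neg h1]
    dsimp only
    omega
  · have := le_abs_self b
    dsimp only
    omega
  · have := le_abs_self b
    dsimp only
    omega

lemma Vf_dead (hk : k ∈ Ioo (0 : ℝ) 1) (N : ℤ) : Vf k (N, 0, 0) = 0 := by
  simp [Vf, hS_dead hk, edge]

lemma exists_abs_Vf_le (hk : k ∈ Ioo (0 : ℝ) 1) : ∃ B M : ℝ, 1 ≤ B ∧ k * B ^ 2 < 1 ∧ 0 ≤ M ∧
    ∀ s, Valid s → |Vf k s| ≤ M * B ^ (s.2.1 + s.2.2) := by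
  obtain ⟨B, M, h1, h2, h3, h⟩ := exists_hasSum_bound hk
  have hS_le : ∀ N a b : ℤ, 0 ≤ a → 0 ≤ b → |hS k (N, a, b)| ≤ M * B ^ (a + b) := by
    intro N a b ha hb
    simp only [hS]
    split_ifs
    · refine ((h _ _ _).2).trans (mul_le_mul_of_nonneg_left ?_ h3)
      rw [← zpow_natCast]
      exact zpow_le_zpow_right₀ h1 (by omega)
    · refine ((h _ _ _).2).trans (mul_le_mul_of_nonneg_left ?_ h3)
      rw [← zpow_natCast]
      exact zpow_le_zpow_right₀ h1 (by omega)
  have hp := psk_pos hk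
  have hpw : ∀ c : ℤ, 0 ≤ c → |1 - psk k ^ c| ≤ 1 := by
    intro c hc
    lift c to ℕ using hc
    have e1 : psk k ^ c ≤ 1 := pow_le_one₀ hp.le (psk_le_one hk)
    have e2 : 0 < psk k ^ c := by positivity
    rw [zpow_natCast, abs_le]
    constructor <;> linarith
  have hedge : ∀ N a b : ℤ, 0 ≤ a → 0 ≤ b → |edge k (N, a, b)| ≤ 1 := by
    intro N a b ha hb
    simp only [edge]
    split_ifs
    · exact hpw a ha
    · exact hpw b hb
    · simp
  refine ⟨B, M + 1, h1, h2, by linarith, ?_⟩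
  rintro ⟨N, a, b⟩ hs
  have hab : 0 ≤ a ∧ 0 ≤ b := by simp only [Valid] at hs; omega
  have e1 := hS_le (N + 1) a b hab.1 hab.2
  have e2 := hS_le (N - 1) a b hab.1 hab.2
  have e3 := hedge N a b hab.1 hab.2
  have e4 : 1 ≤ B ^ (a + b) := one_le_zpow₀ h1 (by omega)
  have hk1 := kComp_lt_one hk
  have hk0 := kComp_pos hk
  simp only [Vf]
  rw [abs_le] at *
  constructor <;> nlinarith

/-- The weighted partial sums of the numbers `cnt j s`. -/
def partSum (k : ℝ) (J : ℕ) (s : ℤ × ℤ × ℤ) : ℝ :=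
  ∑ j ∈ Finset.range J, k ^ j * (1 - k) * (1 / 4 : ℝ) ^ (j + 1) * (cnt j s : ℝ)

lemma partSum_succ (J : ℕ) (N : ℤ) {a b : ℤ} (ha : a ≠ 0) : partSum k (J + 1) (N, a, b) =
    (1 - k) / 4 * (cnt 0 (N, a, b) : ℕ) + k / 4 * nbr (partSum k J) N a b := by
  unfold partSum nbr
  rw [Finset.sum_range_succ', ← Finset.sum_add_distrib, ← Finset.sum_add_distrib,
    ← Finset.sum_add_distrib, Finset.mul_sum, add_comm]
  congr 1
  · ring
  · refine Finset.sum_congr rfl fun j _ => ?_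
    rw [cnt, if_neg ha]
    simp only [nbr]
    push_cast
    ring

lemma cnt_dead (j : ℕ) (N : ℤ) : cnt j (N, 0, 0) = 0 := by
  cases j <;> simp [cnt]

lemma abs_Vf_sub_partSum_le (hk : k ∈ Ioo (0 : ℝ) 1) {B M : ℝ} (hB : 1 ≤ B) (hM : 0 ≤ M)
    (h : ∀ s, Valid s → |Vf k s| ≤ M * B ^ (s.2.1 + s.2.2)) (J : ℕ) :
    ∀ s, Valid s → |Vf k s - partSum k J s| ≤ M * (k * B ^ 2) ^ J * B ^ (s.2.1 + s.2.2) := by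
  have hk0 := hk.1
  have hB0 : 0 < B := by linarith
  induction J with
  | zero => intro s hs; simpa [partSum] using h s hs
  | succ J ih =>
    rintro ⟨N, a, b⟩ hs
    rcases hs with ⟨ha, hb⟩ | ⟨ha, hb⟩
    · simp only at ha hb
      rw [Vf_eq hk N ha hb, partSum_succ J N (by omega)]
      have key : ∀ a' b' : ℤ, 0 ≤ a' → -1 ≤ b' → a' ≤ a + 1 → |b'| ≤ b + 1 →
          |Vf k (nrm N a' b') - partSum k J (nrm N a' b')| ≤
            M * (k * B ^ 2) ^ J * (B ^ 2 * B ^ (a + b)) := by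
        intro a' b' h1 h2 h3 h4
        refine (ih _ (valid_nrm N h1 h2)).trans (mul_le_mul_of_nonneg_left ?_ (by positivity))
        have : B ^ 2 * B ^ (a + b) = B ^ (a + b + 2) := by
          rw [zpow_add₀ hB0.ne' (a + b) 2, mul_comm]; norm_cast
        rw [this]
        refine zpow_le_zpow_right₀ hB ?_
        have := nrm_sum_le N a' b'
        omega
      have k1 := key (a + 1) (b + 1) (by omega) (by omega) le_rfl (by rw [abs_of_nonneg (by omega)])
      have k2 := key (a + 1) (b - 1) (by omega) (by omega) le_rfl (by rw [abs_le]; omega)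
      have k3 := key (a - 1) (b + 1) (by omega) (by omega) (by omega)
        (by rw [abs_of_nonneg (by omega)])
      have k4 := key (a - 1) (b - 1) (by omega) (by omega) (by omega) (by rw [abs_le]; omega)
      have e : M * (k * B ^ 2) ^ (J + 1) * B ^ (a + b) =
          k * (M * (k * B ^ 2) ^ J * (B ^ 2 * B ^ (a + b))) := by ring
      simp only [nbr]
      rw [e]
      generalize M * (k * B ^ 2) ^ J * (B ^ 2 * B ^ (a + b)) = R at *
      rw [abs_le] at *
      constructor <;> nlinarith
    · simp only at ha hb
      subst ha hb
      simp [Vf_dead hk, partSum, cnt_dead]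
      positivity

lemma hasSum_cnt (hk : k ∈ Ioo (0 : ℝ) 1) {s : ℤ × ℤ × ℤ} (hs : Valid s) :
    HasSum (fun j : ℕ => k ^ j * (1 - k) * (1 / 4 : ℝ) ^ (j + 1) * (cnt j s : ℝ)) (Vf k s) := by
  have hk0 := hk.1
  have hk1 : 0 < 1 - k := by linarith [hk.2]
  rw [hasSum_iff_tendsto_nat_of_nonneg (fun j => by positivity)]
  obtain ⟨B, M, hB, hkB, hM, h⟩ := exists_abs_Vf_le hk
  have hlim : Tendsto (fun J : ℕ => M * (k * B ^ 2) ^ J * B ^ (s.2.1 + s.2.2)) atTop (𝓝 0) := by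
    simpa using ((tendsto_pow_atTop_nhds_zero_of_lt_one (by positivity) hkB).const_mul M).mul_const
      (B ^ (s.2.1 + s.2.2))
  rw [tendsto_iff_norm_sub_tendsto_zero]
  refine squeeze_zero (fun _ => norm_nonneg _) (fun J => ?_) hlim
  rw [← norm_neg, neg_sub]
  exact abs_Vf_sub_partSum_le hk hB hM h J s hs

lemma I_pow_eq (m : ℕ) :
    (Complex.I : ℂ) ^ m = (Real.cos (m * π / 2) : ℝ) + (Real.sin (m * π / 2) : ℝ) * Complex.I := by
  rw [Complex.ofReal_cos, Complex.ofReal_sin, ← Complex.exp_mul_I]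
  nth_rewrite 1 [← Complex.exp_pi_div_two_mul_I]
  rw [← Complex.exp_nat_mul]
  congr 1
  push_cast
  ring

lemma hasSum_I_mul_pow {y : ℝ} (hy : |y| < 1) :
    HasSum (fun m : ℕ => (Complex.I * y) ^ m) ((1 / (1 + y ^ 2) : ℝ) + (y / (1 + y ^ 2) : ℝ) * Complex.I) := by
  have h := hasSum_geometric_of_norm_lt_one (ξ := Complex.I * y) (by simpa using hy)
  have h1 : (1 + (y : ℂ) ^ 2) ≠ 0 := by
    have : (1 + y ^ 2 : ℝ) ≠ 0 := by positivity
    exact_mod_cast this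
  rw [show ((1 / (1 + y ^ 2) : ℝ) + (y / (1 + y ^ 2) : ℝ) * Complex.I : ℂ) =
    (1 - Complex.I * y)⁻¹ from ?_]
  · exact h
  · refine eq_inv_of_mul_eq_one_left ?_
    push_cast
    field_simp
    linear_combination (-(y : ℂ) ^ 2) * Complex.I_sq

lemma hasSum_cos_pow {y : ℝ} (hy : |y| < 1) :
    HasSum (fun m : ℕ => Real.cos (m * π / 2) * y ^ m) (1 / (1 + y ^ 2)) := by
  refine hasSum_of_eq (Complex.hasSum_re (hasSum_I_mul_pow hy)) (fun m => ?_) ?_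
  · rw [mul_pow, I_pow_eq, ← Complex.ofReal_pow, Complex.re_mul_ofReal, Complex.add_re, Complex.re_ofReal_mul,
      Complex.ofReal_re, Complex.I_re, mul_zero, add_zero]
  · rw [Complex.add_re, Complex.re_ofReal_mul, Complex.ofReal_re, Complex.I_re, mul_zero, add_zero]

lemma hasSum_sin_pow {y : ℝ} (hy : |y| < 1) :
    HasSum (fun m : ℕ => Real.sin (m * π / 2) * y ^ m) (y / (1 + y ^ 2)) := by
  refine hasSum_of_eq (Complex.hasSum_im (hasSum_I_mul_pow hy)) (fun m => ?_) ?_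
  · rw [mul_pow, I_pow_eq, ← Complex.ofReal_pow, Complex.im_mul_ofReal, Complex.add_im, Complex.im_ofReal_mul,
      Complex.ofReal_im, Complex.I_im, mul_one, zero_add]
  · rw [Complex.add_im, Complex.im_ofReal_mul, Complex.ofReal_im, Complex.I_im, mul_one, zero_add]

lemma abs_qk_pow_lt_one (hk : k ∈ Ioo (0 : ℝ) 1) {n : ℕ} (hn : n ≠ 0) : |qk k ^ n| < 1 := by
  rw [abs_of_pos (pow_pos qk_pos n)]
  exact pow_lt_one₀ qk_pos.le (qk_lt_one hk) hn

lemma Psi_sin_add (hk : k ∈ Ioo (0 : ℝ) 1) (N : ℕ) :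
    k * Kell k * kComp k / (2 * π) * (Psi k N 0 (-1) + Psi k (N + 2) 0 (-1)) =
      qk k ^ (N + 1) / (1 + (qk k ^ (N + 1)) ^ 2) := by
  rw [mul_add]
  refine ((hasSum_sin_term hk N).add (hasSum_sin_term hk (N + 2))).unique
    (hasSum_of_eq (hasSum_sin_pow (abs_qk_pow_lt_one hk (n := N + 1) N.succ_ne_zero)) (fun m => ?_) rfl)
  have : 1 + qk k ^ (2 * m) ≠ 0 := by have := pow_pos (qk_pos (k := k)) (2 * m); positivity
  rw [← pow_mul]
  field_simp
  ring

lemma cos_nat_mul_pi (l : ℕ) : Real.cos ((2 * l : ℕ) * π / 2) = (-1) ^ l := by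
  rw [← Real.cos_nat_mul_pi]
  congr 1
  push_cast
  ring

lemma cos_odd_mul_pi_div_two (l : ℕ) : Real.cos ((2 * l + 1 : ℕ) * π / 2) = 0 := by
  rw [Real.cos_eq_zero_iff]
  exact ⟨l, by push_cast; ring⟩

lemma hasSum_alternating (hk : k ∈ Ioo (0 : ℝ) 1) :
    HasSum (fun l : ℕ => (-1) ^ l * (qk k ^ (2 * (l + 1)) / (1 + (qk k ^ (2 * (l + 1))) ^ 2)))
      (1 / 4 - Kell k * kComp k / (2 * π)) := by
  have h := hasSum_cos_mul hk
  have hinj : Function.Injective (fun l : ℕ => 2 * l) := fun a b h => by simpa using h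
  rw [← hinj.hasSum_iff] at h
  · rw [← hasSum_nat_add_iff' 1] at h
    refine hasSum_of_eq h.neg (fun l => ?_) ?_
    · simp only [Function.comp, cos_nat_mul_pi]
      rw [pow_succ, ← pow_mul, mul_comm 2 (2 * (l + 1))]
      ring
    · simp
      ring
  · intro m hm
    obtain ⟨l, rfl | rfl⟩ := m.even_or_odd'
    · exact absurd ⟨l, rfl⟩ hm
    · rw [cos_odd_mul_pi_div_two, zero_mul]

lemma Psi_one_zero_neg_one (hk : k ∈ Ioo (0 : ℝ) 1) :
    k * Kell k * kComp k / (2 * π) * Psi k 1 0 (-1) = 1 / 4 - Kell k * kComp k / (2 * π) := by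
  have hq := qk_pos (k := k)
  have hq1 := qk_lt_one hk
  set F : ℕ × ℕ → ℝ := fun p => Real.sin (p.1 * π / 2) * ((-1) ^ p.2 * qk k ^ (2 * p.1 * (p.2 + 1)))
  have hF : Summable F := by
    have hg := summable_geometric_of_lt_one hq.le hq1
    refine Summable.of_norm_bounded (hg.mul_of_nonneg hg (fun _ => by positivity)
      (fun _ => by positivity)) ?_
    rintro ⟨m, l⟩
    simp only [F, norm_mul, norm_pow, Real.norm_eq_abs, abs_of_pos hq]
    rcases Nat.eq_zero_or_pos m with rfl | hm
    · simp; positivity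
    · have h1 : |Real.sin (m * π / 2)| ≤ 1 := Real.abs_sin_le_one _
      have h2 : qk k ^ (2 * m * (l + 1)) ≤ qk k ^ m * qk k ^ l := by
        rw [← pow_add]
        exact pow_le_pow_of_le_one hq.le hq1.le (by nlinarith)
      have h3 : 0 < qk k ^ (2 * m * (l + 1)) := by positivity
      simp only [abs_neg, abs_one, one_pow, one_mul]
      nlinarith [abs_nonneg (Real.sin (m * π / 2))]
  have h1 : ∀ m : ℕ, HasSum (fun l : ℕ => F (m, l))
      (Real.sin (m * π / 2) * (qk k ^ (m * (1 + 1)) / (1 + qk k ^ (2 * m)))) := by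
    intro m
    rcases Nat.eq_zero_or_pos m with rfl | hm
    · simp [F]
    · have hlt := abs_qk_pow_lt_one hk (n := 2 * m) (by omega)
      have hg := (hasSum_geometric_of_abs_lt_one (r := -qk k ^ (2 * m)) (by rwa [abs_neg]))
      refine hasSum_of_eq (hg.mul_left (Real.sin (m * π / 2) * qk k ^ (2 * m))) (fun l => ?_) ?_
      · simp only [F]
        rw [neg_pow, pow_mul, pow_succ]
        ring
      · rw [sub_neg_eq_add, mul_comm m]
        norm_num
        ring
  have h2 : ∀ l : ℕ, HasSum (fun m : ℕ => F (m, l))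
      ((-1) ^ l * (qk k ^ (2 * (l + 1)) / (1 + (qk k ^ (2 * (l + 1))) ^ 2))) := by
    intro l
    refine hasSum_of_eq ((hasSum_sin_pow (abs_qk_pow_lt_one hk (n := 2 * (l + 1)) (by omega))).mul_left
      ((-1) ^ l)) (fun m => ?_) rfl
    simp only [F]
    rw [← pow_mul]
    ring
  have e1 := (hF.hasSum.prod_fiberwise h1).unique (hasSum_sin_term hk 1)
  have hs : HasSum (fun p : ℕ × ℕ => F p.swap) (∑' p, F p) :=
    (Equiv.prodComm ℕ ℕ).hasSum_iff.2 hF.hasSum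
  have e2 := (hs.prod_fiberwise h2).unique (hasSum_alternating hk)
  rw [← e1, e2]

lemma Psi_cos_add (hk : k ∈ Ioo (0 : ℝ) 1) (N : ℕ) :
    k * Kell k * kComp k / (2 * π) * (Psi k N 1 (-1) + Psi k (N + 2) 1 (-1)) =
      1 / (1 + (qk k ^ (N + 2)) ^ 2) - 1 / (1 + (qk k ^ (N + 1)) ^ 2) := by
  have h1 := (hasSum_cos_term hk N).add (hasSum_cos_term hk (N + 2))
  have h2 := (hasSum_cos_pow (abs_qk_pow_lt_one hk N.succ_ne_zero)).sub
    (hasSum_cos_pow (abs_qk_pow_lt_one hk (N + 1).succ_ne_zero))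
  have h3 := h1.unique (hasSum_of_eq h2 (fun m => ?_) rfl)
  · simp only [Nat.succ_eq_add_one] at h3
    linear_combination -h3
  · have : 1 + qk k ^ (2 * m) ≠ 0 := by have := pow_pos (qk_pos (k := k)) (2 * m); positivity
    rw [← pow_mul, ← pow_mul]
    simp only [Nat.succ_eq_add_one]
    field_simp
    ring

lemma Psi_cos_add_one (hk : k ∈ Ioo (0 : ℝ) 1) :
    k * Kell k * kComp k / (2 * π) * (Psi k 0 1 (-1) + Psi k 1 1 (-1)) =
      1 / (1 + qk k ^ 2) - 2 * (Kell k * kComp k / (2 * π) + 1 / 4) := by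
  have h1 := (hasSum_cos_term hk 0).add (hasSum_cos_term hk 1)
  have h2 := ((hasSum_cos_mul hk).mul_left 2).sub (hasSum_cos_pow (abs_qk_pow_lt_one hk one_ne_zero))
  have h3 := h1.unique (hasSum_of_eq h2 (fun m => ?_) rfl)
  · rw [pow_one] at h3
    linear_combination -h3
  · have : 1 + qk k ^ (2 * m) ≠ 0 := by have := pow_pos (qk_pos (k := k)) (2 * m); positivity
    rw [pow_one]
    field_simp
    ring

lemma one_div_cosh (x : ℝ) : 1 / Real.cosh x = 2 * Real.exp (-x) / (1 + Real.exp (-x) ^ 2) := by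
  have h : Real.exp x = (Real.exp (-x))⁻¹ := by rw [Real.exp_neg, inv_inv]
  rw [Real.cosh_eq, h]
  have := Real.exp_pos (-x)
  field_simp

lemma qk_eq (k : ℝ) : qk k = Real.exp (-(2 * π * Tell k)) := by
  rw [qk, om, Tell]
  congr 1
  ring

lemma sech_natCast (k : ℝ) (n : ℕ) :
    1 / Real.cosh (4 * Tell k * (π / 2 * n)) = 2 * qk k ^ n / (1 + (qk k ^ n) ^ 2) := by
  have : Real.exp (-(4 * Tell k * (π / 2 * n))) = qk k ^ n := by
    rw [qk_eq, ← Real.exp_nat_mul]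
    congr 1
    ring
  rw [one_div_cosh, this]

lemma hS_one_zero (hk : k ∈ Ioo (0 : ℝ) 1) (j : ℤ) : hS k (j, 1, 0) = Psi k j.natAbs 0 (-1) := by
  obtain ⟨n, rfl | rfl⟩ := j.eq_nat_or_neg
  · simpa using hS_natCast (k := k) n 1 0
  · rcases n with _ | n
    · simpa using hS_natCast (k := k) 0 1 0
    · have h1 := hS_neg_natCast (k := k) n 1 0
      have h2 := Psi_rotate hk n 1 0
      have e : (-(n : ℤ) - 1) = -((n + 1 : ℕ) : ℤ) := by push_cast; ring
      rw [e] at h1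
      rw [Int.natAbs_neg, Int.natAbs_natCast]
      rw [Nat.cast_one] at h2
      rw [← h2]
      simpa using h1

lemma Vf_one_zero (hk : k ∈ Ioo (0 : ℝ) 1) (n : ℤ) : Vf k (-n, 1, 0) =
    π / (2 * k * Kell k) * (1 / Real.cosh (4 * Tell k * (π / 2 * n))) +
      (k - 1) / k * (if n = 0 then 1 else 0) := by
  have hk0 := hk.1
  have hK := Kell_pos hk
  have hk' := kComp_pos hk
  have hpi := Real.pi_pos
  rw [Vf]
  simp only
  rw [hS_one_zero hk, hS_one_zero hk]
  rcases eq_or_ne n 0 with rfl | hn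
  · have h := Psi_one_zero_neg_one hk
    have hm := mul_psk hk
    simp only [edge]
    norm_num
    field_simp at h ⊢
    linear_combination h / 2 - 2 * Kell k * hm
  · have he : edge k (-n, 1, 0) = 0 := by simp [edge, hn]
    obtain ⟨N, hN⟩ : ∃ N : ℕ, n.natAbs = N + 1 := ⟨n.natAbs - 1, by omega⟩
    have h1 : Psi k (-n + 1).natAbs 0 (-1) + Psi k (-n - 1).natAbs 0 (-1) =
        Psi k N 0 (-1) + Psi k (N + 2) 0 (-1) := by
      rcases lt_or_gt_of_ne hn with h | h
      · rw [show (-n + 1).natAbs = N + 2 by omega, show (-n - 1).natAbs = N by omega, add_comm]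
      · rw [show (-n + 1).natAbs = N by omega, show (-n - 1).natAbs = N + 2 by omega]
    have h2 : Real.cosh (4 * Tell k * (π / 2 * n)) =
        Real.cosh (4 * Tell k * (π / 2 * (N + 1 : ℕ))) := by
      rw [← hN]
      obtain ⟨m, rfl | rfl⟩ := n.eq_nat_or_neg
      · simp
      · rw [← Real.cosh_neg]; congr 1; simp
    have h := Psi_sin_add hk N
    rw [he, h1, h2, sech_natCast, if_neg hn]
    have hq := pow_pos (qk_pos (k := k)) (N + 1)
    generalize Psi k N 0 (-1) + Psi k (N + 2) 0 (-1) = P at *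
    generalize qk k ^ (N + 1) = y at *
    have hy : 1 + y ^ 2 ≠ 0 := by positivity
    field_simp at h ⊢
    linear_combination h

lemma hS_one_one_natCast (n : ℕ) : hS k (n, 1, 1) = Psi k n 1 (-1) := by
  simpa using hS_natCast (k := k) n 1 1

lemma hS_one_one_neg (n : ℕ) : hS k (-n - 1, 1, 1) = Psi k n 1 (-1) := by
  simpa using hS_neg_natCast (k := k) n 1 1

lemma Vf_one_one_of_natCast (hk : k ∈ Ioo (0 : ℝ) 1) {P E : ℝ} (n : ℕ)
    (hP : n = 0 → P = Psi k 0 1 (-1) + Psi k 1 1 (-1))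
    (hP' : ∀ m, n = m + 1 → P = Psi k m 1 (-1) + Psi k (m + 2) 1 (-1))
    (hE : E = if n = 0 then 1 else 0) :
    (1 - k) * E + k * (kComp k / 2 * P + E * (1 - psk k)) =
      π * Real.sinh (2 * π * Tell k) / (2 * Kell k) *
          (1 / Real.cosh (4 * Tell k * (π / 2 * n))) *
          (1 / Real.cosh (4 * Tell k * (π / 2 * (n + 1 : ℕ)))) := by
  have hk0 := hk.1
  have hK := Kell_pos hk
  have hk' := kComp_pos hk
  have hpi := Real.pi_pos
  have hm := mul_psk hk
  have hq := qk_pos (k := k)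
  have hs : Real.sinh (2 * π * Tell k) = (1 / qk k - qk k) / 2 := by
    rw [Real.sinh_eq, qk_eq, one_div, ← Real.exp_neg, neg_neg]
  rw [sech_natCast, sech_natCast, hs]
  rcases n with _ | m
  · have h := Psi_cos_add_one hk
    rw [← hP rfl] at h
    rw [hE, if_pos rfl, zero_add, pow_zero, pow_one]
    have hy : 1 + qk k ^ 2 ≠ 0 := by positivity
    generalize qk k = y at *
    field_simp at h ⊢
    norm_num at h ⊢
    linear_combination h / 2 - 4 * Kell k * (1 + y ^ 2) * hm
  · have h := Psi_cos_add hk m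
    rw [← hP' m rfl] at h
    rw [hE, if_neg m.succ_ne_zero]
    have e : qk k ^ (m + 1 + 1) = qk k ^ (m + 1) * qk k := pow_succ _ _
    have e' : qk k ^ (m + 2) = qk k ^ (m + 1) * qk k := pow_succ _ _
    rw [e] 
    rw [e'] at h
    have hz := pow_pos hq (m + 1)
    generalize qk k ^ (m + 1) = z at *
    generalize qk k = y at *
    have hy : 1 + z ^ 2 ≠ 0 := by positivity
    have hy2 : 1 + (z * y) ^ 2 ≠ 0 := by positivity
    field_simp at h ⊢
    linear_combination h

lemma Vf_one_one (hk : k ∈ Ioo (0 : ℝ) 1) (j : ℤ) :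
    (1 - k) * (if j = 0 ∨ j = -1 then 1 else 0) + k * Vf k (-(j + 1), 1, 1) =
      π * Real.sinh (2 * π * Tell k) / (2 * Kell k) *
          (1 / Real.cosh (4 * Tell k * (π / 2 * j))) *
          (1 / Real.cosh (4 * Tell k * (π / 2 * (j + 1 : ℤ)))) := by
  have hE : edge k (-(j + 1), 1, 1) = (if j = 0 ∨ j = -1 then 1 else 0) * (1 - psk k) := by
    simp only [edge, zpow_one]
    split_ifs <;> first | omega | simp
  rw [Vf, hE]
  simp only
  rcases le_or_gt 0 j with hj | hj
  · obtain ⟨n, rfl⟩ := Int.eq_ofNat_of_zero_le hj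
    have h2 := hS_one_one_neg (k := k) (n + 1)
    rw [show -((n + 1 : ℕ) : ℤ) - 1 = -((n : ℤ) + 1) - 1 by push_cast; ring] at h2
    rw [h2]
    refine (Vf_one_one_of_natCast hk n (fun h => ?_) (fun m h => ?_) ?_).trans ?_
    · subst h
      have := hS_one_one_natCast (k := k) 0
      simpa using this
    · subst h
      have := hS_one_one_neg (k := k) m
      rw [← this]
      congr 3
      push_cast
      ring_nf
    · have : (n : ℤ) ≠ -1 := by omega
      simp [this]
    · simp
  · obtain ⟨n, hn⟩ := Int.eq_ofNat_of_zero_le (show 0 ≤ -1 - j by omega)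
    obtain rfl : j = -1 - n := by omega
    have h2 := hS_one_one_natCast (k := k) (n + 1)
    rw [show ((n + 1 : ℕ) : ℤ) = -((-1 - n : ℤ) + 1) + 1 by push_cast; ring] at h2
    rw [h2]
    refine (Vf_one_one_of_natCast hk n (fun h => ?_) (fun m h => ?_) ?_).trans ?_
    · subst h
      have := hS_one_one_neg (k := k) 0
      simp at this ⊢
      linarith
    · subst h
      have := hS_one_one_natCast (k := k) m
      rw [← this, add_comm]
      congr 3
      push_cast
      ring_nf
    · have : (-1 - n : ℤ) = 0 ∨ (-1 - n : ℤ) = -1 ↔ n = 0 := by omega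
      simp only [this]
    · rw [← Real.cosh_neg, ← Real.cosh_neg (4 * Tell k * (π / 2 * (n + 1 : ℕ))), mul_right_comm]
      congr 4
      · push_cast; ring
      · push_cast; ring

lemma halfPt_cons_succ (p : ℤ × ℤ) {w : List (ℤ × ℤ)} (hw : 2 ≤ w.length) (i : ℕ) :
    halfPt (p :: w) (i + 1) = halfPt w i := by
  obtain ⟨n, hn⟩ : ∃ n, w.length = n + 2 := ⟨w.length - 2, by omega⟩
  simp [halfPt, hn]

lemma halfPt_cons_zero (p : ℤ × ℤ) {w : List (ℤ × ℤ)} (hw : w ≠ []) :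
    halfPt (p :: w) 0 = ptC p := by
  have := List.length_pos_iff.2 hw
  simp [halfPt, this]

lemma windHalf_cons_succ (p : ℤ × ℤ) {w : List (ℤ × ℤ)} (hw : 2 ≤ w.length) (z : ℂ) (s : ℕ) :
    windHalf (p :: w) z (s + 2) = windHalf w z (s + 1) := by
  obtain ⟨n, hn⟩ : ∃ n, w.length = n + 1 := ⟨w.length - 1, by omega⟩
  rw [windHalf, windHalf, List.length_cons, Nat.add_sub_cancel, hn, Nat.add_sub_cancel,
    show s + 2 = s + 1 + 1 from rfl, ← Finset.map_add_right_Icc _ _ 1, Finset.sum_map]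
  refine Finset.sum_congr rfl fun i hi => ?_
  obtain ⟨i, rfl⟩ : ∃ m, i = m + 1 := ⟨i - 1, by have := Finset.mem_Icc.1 hi; omega⟩
  simp only [addRightEmbedding_apply, Nat.add_sub_cancel, halfPt_cons_succ p hw]

lemma windHalf_cons (p q : ℤ × ℤ) {w : List (ℤ × ℤ)} (hw : w ≠ []) (z : ℂ) :
    windHalf (p :: q :: w) z 1 =
      ((ptC q - z) / (ptC p - z)).arg + windHalf (q :: w) z 1 := by
  have hl : 2 ≤ (q :: w).length := by have := List.length_pos_iff.2 hw; simpa
  rw [← windHalf_cons_succ p hl z 0, windHalf, windHalf, List.length_cons, Nat.add_sub_cancel,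
    ← Finset.add_sum_Ioc_eq_sum_Icc (by omega)]
  congr 1
  rw [halfPt_cons_succ p hl, Nat.sub_self, halfPt_cons_zero q hw, halfPt_cons_zero p (by simp)]

lemma windHalf_pair (p q : ℤ × ℤ) (z : ℂ) :
    windHalf [p, q] z 1 = (((ptC p + ptC q) / 2 - z) / (ptC p - z)).arg := by
  simp [windHalf, halfPt]

/-- Continuations of a walk that is at `p` and has winding angle `θ` around `z`, by `j + 1` steps
that avoid `z` and end with winding angle in `(-π/2, π/2)`. -/
def contSet (z : ℂ) (j : ℕ) (p : ℤ × ℤ) (θ : ℝ) : Set (List (ℤ × ℤ)) :=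
  {w | w.length = j + 2 ∧ w.head? = some p ∧ w.IsChain IsRectStep ∧
    (∀ i, i ≤ j → ptC (w.getD i 0) ≠ z) ∧ θ + windHalf w z 1 ∈ Ioo (-(π / 2)) (π / 2)}

lemma ncard_of_first_step {A : Set (List (ℤ × ℤ))} {p : ℤ × ℤ} {B : ℤ × ℤ → Set (List (ℤ × ℤ))}
    (hA : ∀ w, w ∈ A ↔ ∃ q w', w = p :: w' ∧ IsRectStep p q ∧ w' ∈ B q)
    (hB : ∀ d, (d = (1, 0) ∨ d = (-1, 0) ∨ d = (0, 1) ∨ d = (0, -1)) → (B (p + d)).Finite)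
    (hh : ∀ q, ∀ w ∈ B q, w.head? = some q) :
    A.Finite ∧ A.ncard = (B (p + (1, 0))).ncard + (B (p + (-1, 0))).ncard +
      (B (p + (0, 1))).ncard + (B (p + (0, -1))).ncard := by
  have hA' : A = (p :: ·) '' (B (p + (1, 0)) ∪ B (p + (-1, 0)) ∪ B (p + (0, 1)) ∪
      B (p + (0, -1))) := by
    ext w
    rw [hA]
    simp only [mem_image, mem_union, IsRectStep, sub_eq_iff_eq_add']
    constructor
    · rintro ⟨q, w', rfl, rfl | rfl | rfl | rfl, h⟩ <;> exact ⟨w', by tauto, rfl⟩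
    · rintro ⟨w', ((h | h) | h) | h, rfl⟩ <;> exact ⟨_, w', rfl, by tauto, h⟩
  have hf1 := hB (1, 0) (by simp)
  have hf2 := hB (-1, 0) (by simp)
  have hf3 := hB (0, 1) (by simp)
  have hf4 := hB (0, -1) (by simp)
  have hd : ∀ d d' : ℤ × ℤ, d ≠ d' → ∀ w, w ∈ B (p + d) → w ∉ B (p + d') := by
    intro d d' hne w h1 h2
    have := (hh _ _ h1).symm.trans (hh _ _ h2)
    simp only [Option.some.injEq, add_right_inj] at this
    exact hne this
  subst hA'
  refine ⟨(((hf1.union hf2).union hf3).union hf4).image _, ?_⟩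
  rw [ncard_image_of_injective _ (List.cons_injective), ncard_union_eq _ ((hf1.union hf2).union hf3)
    hf4, ncard_union_eq _ (hf1.union hf2) hf3, ncard_union_eq _ hf1 hf2]
  · rw [Set.disjoint_left]
    exact hd _ _ (by simp)
  · rw [Set.disjoint_left]
    rintro w (h | h)
    · exact hd _ _ (by simp) w h
    · exact hd _ _ (by simp) w h
  · rw [Set.disjoint_left]
    rintro w ((h | h) | h)
    · exact hd _ _ (by simp) w h
    · exact hd _ _ (by simp) w h
    · exact hd _ _ (by simp) w h

lemma mem_contSet_zero {z : ℂ} {p : ℤ × ℤ} {θ : ℝ} (hp : ptC p ≠ z) (w : List (ℤ × ℤ)) :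
    w ∈ contSet z 0 p θ ↔ ∃ q w', w = p :: w' ∧ IsRectStep p q ∧
      w' ∈ {v | v = [q] ∧ θ + (((ptC p + ptC q) / 2 - z) / (ptC p - z)).arg ∈
        Ioo (-(π / 2)) (π / 2)} := by
  rw [contSet]
  constructor
  · rintro ⟨h1, h2, h3, -, h5⟩
    obtain ⟨a, q, rfl⟩ := List.length_eq_two.1 h1
    obtain rfl : a = p := by simpa using h2
    refine ⟨q, [q], rfl, (List.isChain_cons_cons.1 h3).1, rfl, ?_⟩
    rwa [windHalf_pair] at h5
  · rintro ⟨q, w', rfl, hs, rfl, h⟩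
    refine ⟨rfl, rfl, List.isChain_cons_cons.2 ⟨hs, List.isChain_singleton _⟩, ?_, ?_⟩
    · intro i hi
      obtain rfl : i = 0 := by omega
      simpa using hp
    · rwa [windHalf_pair]

lemma mem_contSet_succ {z : ℂ} {j : ℕ} {p : ℤ × ℤ} {θ : ℝ} (hp : ptC p ≠ z)
    (w : List (ℤ × ℤ)) :
    w ∈ contSet z (j + 1) p θ ↔ ∃ q w', w = p :: w' ∧ IsRectStep p q ∧
      w' ∈ contSet z j q (θ + ((ptC q - z) / (ptC p - z)).arg) := by
  simp only [contSet]
  constructor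
  · rintro ⟨h1, h2, h3, h4, h5⟩
    match w with
    | [] => simp at h1
    | [_] => simp at h1
    | a :: q :: t =>
      obtain rfl : a = p := by simpa using h2
      have h3' := List.isChain_cons_cons.1 h3
      have ht : t ≠ [] := by rintro rfl; simp at h1
      refine ⟨q, q :: t, rfl, h3'.1, by simpa using h1, rfl, h3'.2, fun i hi => ?_, ?_⟩
      · simpa using h4 (i + 1) (by omega)
      · rw [windHalf_cons _ _ ht] at h5
        rwa [add_assoc]
  · rintro ⟨q, w', rfl, hs, h1, h2, h3, h4, h5⟩
    match w' with
    | [] => simp at h1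
    | a :: t =>
      obtain rfl : a = q := by simpa using h2
      have ht : t ≠ [] := by rintro rfl; simp at h1
      refine ⟨by simpa using h1, rfl, List.isChain_cons_cons.2 ⟨hs, h3⟩, fun i hi => ?_, ?_⟩
      · rcases i with _ | i
        · simpa using hp
        · simpa using h4 i (by omega)
      · rwa [windHalf_cons _ _ ht, ← add_assoc]

lemma contSet_eq_empty {z : ℂ} {j : ℕ} {p : ℤ × ℤ} {θ : ℝ} (hp : ptC p = z) :
    contSet z j p θ = ∅ := by
  rw [Set.eq_empty_iff_forall_notMem]
  rintro w ⟨h1, h2, -, h4, -⟩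
  refine h4 0 (Nat.zero_le j) ?_
  match w with
  | [] => simp at h1
  | a :: t =>
    obtain rfl : a = p := by simpa using h2
    simpa using hp

lemma arg_div_of_re_pos {u v : ℂ} (hv : 0 < v.re) (hu : 0 ≤ u.re) (hu0 : u ≠ 0) :
    (u / v).arg = u.arg - v.arg := by
  have hpi := Real.pi_pos
  have hv0 : v ≠ 0 := by rintro rfl; simp at hv
  have h1 := abs_lt.1 (Complex.abs_arg_lt_pi_div_two_iff.2 (Or.inl hv))
  have h2 := abs_le.1 (Complex.abs_arg_le_pi_div_two_iff.2 hu)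
  have h3 : v⁻¹.arg = -v.arg := by rw [Complex.arg_inv, if_neg (by linarith [h1.2])]
  rw [div_eq_mul_inv, (Complex.arg_mul_eq_add_arg_iff hu0 (inv_ne_zero hv0)).2, h3, sub_eq_add_neg]
  rw [h3]
  constructor <;> linarith [h1.1, h1.2, h2.1, h2.2]

lemma arg_I_mul {u : ℂ} (hu : 0 ≤ u.re) (hu0 : u ≠ 0) : (Complex.I * u).arg = u.arg + π / 2 := by
  have hpi := Real.pi_pos
  have h2 := abs_le.1 (Complex.abs_arg_le_pi_div_two_iff.2 hu)
  rw [(Complex.arg_mul_eq_add_arg_iff Complex.I_ne_zero hu0).2, Complex.arg_I, add_comm]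
  rw [Complex.arg_I]
  constructor <;> linarith [h2.1, h2.2]

/-- The Gaussian integer `a + i b`. -/
def gInt (a b : ℤ) : ℂ := a + b * Complex.I

@[simp] lemma gInt_re (a b : ℤ) : (gInt a b).re = a := by simp [gInt]

@[simp] lemma gInt_im (a b : ℤ) : (gInt a b).im = b := by simp [gInt]

/-- The fourth roots of unity. -/
def IsRot (ρ : ℂ) : Prop := ρ = 1 ∨ ρ = Complex.I ∨ ρ = -1 ∨ ρ = -Complex.I

lemma IsRot.ne_zero {ρ : ℂ} (h : IsRot ρ) : ρ ≠ 0 := by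
  rcases h with rfl | rfl | rfl | rfl <;> simp

lemma IsRot.mul_I {ρ : ℂ} (h : IsRot ρ) : IsRot (ρ * Complex.I) := by
  rcases h with rfl | rfl | rfl | rfl <;> simp [IsRot]

lemma IsRot.mul_neg_I {ρ : ℂ} (h : IsRot ρ) : IsRot (ρ * -Complex.I) := by
  rcases h with rfl | rfl | rfl | rfl <;> simp [IsRot]

/-- The state `s` describes a walk at `p` with winding angle `θ` around `z`. -/
def Describes (z : ℂ) (s : ℤ × ℤ × ℤ) (p : ℤ × ℤ) (θ : ℝ) : Prop :=
  (s.2.1 = 0 ∧ ptC p = z) ∨ (1 ≤ s.2.1 ∧ 0 ≤ s.2.2 ∧ ∃ ρ, IsRot ρ ∧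
    (1 - Complex.I) * (ptC p - z) = ρ * gInt s.2.1 s.2.2 ∧
    θ = s.1 * (π / 2) + (gInt s.2.1 s.2.2).arg)

lemma one_sub_I_ne_zero : (1 - Complex.I) ≠ 0 := fun h => by simpa using congrArg Complex.re h

lemma describes_nrm {z ρ : ℂ} {N a b : ℤ} {q : ℤ × ℤ} {θ : ℝ} (hρ : IsRot ρ) (ha : 0 ≤ a)
    (hq : (1 - Complex.I) * (ptC q - z) = ρ * gInt a b)
    (hθ : gInt a b ≠ 0 → θ = N * (π / 2) + (gInt a b).arg) : Describes z (nrm N a b) q θ := by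
  rw [nrm]
  have hne : a ≠ 0 ∨ b ≠ 0 → gInt a b ≠ 0 := by
    rintro h h0
    have h1 := congrArg Complex.re h0
    have h2 := congrArg Complex.im h0
    simp at h1 h2
    omega
  split_ifs with h1 h2
  · have h0 := hne (by omega)
    have e : gInt (-b) a = Complex.I * gInt a b := by
      apply Complex.ext <;> simp
    refine Or.inr ⟨by dsimp only; omega, ha, ρ * -Complex.I, hρ.mul_neg_I, ?_, ?_⟩
    · dsimp only
      rw [hq, e]
      linear_combination (ρ * gInt a b) * Complex.I_sq
    · dsimp only
      rw [hθ h0, e, arg_I_mul (by simpa using ha) h0]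
      push_cast
      ring
  · subst h2
    rcases eq_or_ne b 0 with rfl | hb
    · refine Or.inl ⟨rfl, ?_⟩
      have : (1 - Complex.I) * (ptC q - z) = 0 := by simpa [gInt] using hq
      rcases mul_eq_zero.1 this with h | h
      · exact absurd h one_sub_I_ne_zero
      · exact sub_eq_zero.1 h
    · have e : gInt 0 b = Complex.I * gInt b 0 := by
        apply Complex.ext <;> simp
      have h0 : gInt b 0 ≠ 0 := fun h => hb (by simpa using congrArg Complex.re h)
      refine Or.inr ⟨by dsimp only; omega, le_rfl, ρ * Complex.I, hρ.mul_I, ?_, ?_⟩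
      · dsimp only
        rw [hq, e, mul_assoc]
      · dsimp only
        rw [hθ (hne (Or.inr hb)), e, arg_I_mul (by simp; omega) h0]
        push_cast
        ring
  · exact Or.inr ⟨by dsimp only; omega, by dsimp only; omega, ρ, hρ, hq, hθ (hne (by omega))⟩

lemma sum_steps {ρ : ℂ} (hρ : IsRot ρ) {G : ℤ × ℤ → ℕ} {H : ℤ → ℤ → ℕ}
    (h : ∀ d e f, (e = 1 ∨ e = -1) → (f = 1 ∨ f = -1) →
      (d = (1, 0) ∨ d = (-1, 0) ∨ d = (0, 1) ∨ d = (0, -1)) →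
      (1 - Complex.I) * ptC d = ρ * gInt e f → G d = H e f) :
    G (1, 0) + G (-1, 0) + G (0, 1) + G (0, -1) = H 1 1 + H 1 (-1) + H (-1) 1 + H (-1) (-1) := by
  rcases hρ with rfl | rfl | rfl | rfl
  · rw [h (1, 0) 1 (-1), h (-1, 0) (-1) 1, h (0, 1) 1 1, h (0, -1) (-1) (-1)]
    · ring
    all_goals first | decide | (apply Complex.ext <;> simp [ptC])
  · rw [h (1, 0) (-1) (-1), h (-1, 0) 1 1, h (0, 1) 1 (-1), h (0, -1) (-1) 1]
    · ring
    all_goals first | decide | (apply Complex.ext <;> simp [ptC])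
  · rw [h (1, 0) (-1) 1, h (-1, 0) 1 (-1), h (0, 1) (-1) (-1), h (0, -1) 1 1]
    · ring
    all_goals first | decide | (apply Complex.ext <;> simp [ptC])
  · rw [h (1, 0) 1 1, h (-1, 0) (-1) (-1), h (0, 1) (-1) 1, h (0, -1) 1 (-1)]
    · ring
    all_goals first | decide | (apply Complex.ext <;> simp [ptC])

lemma exists_gInt_of_step {ρ : ℂ} (hρ : IsRot ρ) {d : ℤ × ℤ}
    (hd : d = (1, 0) ∨ d = (-1, 0) ∨ d = (0, 1) ∨ d = (0, -1)) :
    ∃ e f : ℤ, (e = 1 ∨ e = -1) ∧ (f = 1 ∨ f = -1) ∧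
      (1 - Complex.I) * ptC d = ρ * gInt e f := by
  obtain ⟨x, y⟩ := d
  simp only [Prod.mk.injEq] at hd
  rcases hρ with rfl | rfl | rfl | rfl
  · refine ⟨x + y, y - x, by omega, by omega, ?_⟩
    apply Complex.ext <;> simp [ptC]; ring
  · refine ⟨y - x, -(x + y), by omega, by omega, ?_⟩
    apply Complex.ext <;> simp [ptC]; ring
  · refine ⟨-(x + y), x - y, by omega, by omega, ?_⟩
    apply Complex.ext <;> simp [ptC]; ring
  · refine ⟨x - y, x + y, by omega, by omega, ?_⟩
    apply Complex.ext <;> simp [ptC]; ring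

lemma mem_Ioo_iff_quadrant {N : ℤ} {x : ℝ} (h0 : 0 < x) (h1 : x < π / 2) :
    (N : ℝ) * (π / 2) + x ∈ Ioo (-(π / 2)) (π / 2) ↔ N = 0 ∨ N = -1 := by
  have hpi := Real.pi_pos
  constructor
  · rintro ⟨h2, h3⟩
    have h4 : (N : ℝ) < 1 := by nlinarith
    have h5 : (-2 : ℝ) < N := by nlinarith
    have h4' : N < 1 := by exact_mod_cast h4
    have h5' : -2 < N := by exact_mod_cast h5
    omega
  · rintro (rfl | rfl)
    · constructor <;> norm_num <;> linarith
    · constructor <;> norm_num <;> linarith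

lemma ptC_add (p q : ℤ × ℤ) : ptC (p + q) = ptC p + ptC q := by
  simp [ptC]; ring

lemma gInt_add (a b c d : ℤ) : gInt (a + c) (b + d) = gInt a b + gInt c d := by
  simp [gInt]; ring

lemma div_eq_of_rot {ρ u v u' v' : ℂ} (hρ : IsRot ρ) (hu : (1 - Complex.I) * u = ρ * u')
    (hv : (1 - Complex.I) * v = ρ * v') : u / v = u' / v' := by
  rw [← mul_div_mul_left u v one_sub_I_ne_zero, hu, hv, mul_div_mul_left _ _ hρ.ne_zero]

lemma half_step_iff {N a b e f : ℤ} (ha : 1 ≤ a) (hb : 0 ≤ b) (he : e = 1 ∨ e = -1)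
    (hf : f = 1 ∨ f = -1) :
    (N : ℝ) * (π / 2) + (gInt a b).arg + ((gInt a b + gInt e f / 2) / gInt a b).arg ∈
      Ioo (-(π / 2)) (π / 2) ↔ qInd N (b + f) = 1 := by
  have har : (1 : ℝ) ≤ a := by exact_mod_cast ha
  set u := gInt a b + gInt e f / 2
  have hre : u.re = a + e / 2 := by simp [u]
  have him : u.im = b + f / 2 := by simp [u]
  have hur : 0 < u.re := by rw [hre]; rcases he with rfl | rfl <;> norm_num <;> linarith
  have hu0 : u ≠ 0 := by rintro h; rw [h] at hur; simp at hur
  rw [arg_div_of_re_pos (by simp; omega) hur.le hu0]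
  have h2 := abs_lt.1 (Complex.abs_arg_lt_pi_div_two_iff.2 (Or.inl hur))
  have e1 : (N : ℝ) * (π / 2) + (gInt a b).arg + (u.arg - (gInt a b).arg) =
    (N : ℝ) * (π / 2) + u.arg := by ring
  rw [e1]
  by_cases hc : b + f < 0
  · have h3 : u.im < 0 := by
      rw [him, show f = -1 by omega, show b = 0 by omega]; norm_num
    have h4 := Complex.arg_neg_iff.2 h3
    have e2 : (N : ℝ) * (π / 2) + u.arg = ((N - 1 : ℤ) : ℝ) * (π / 2) + (u.arg + π / 2) := by
      push_cast; ring
    rw [e2, mem_Ioo_iff_quadrant (by linarith [h2.1]) (by linarith)]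
    simp only [qInd, hc, if_true]
    split_ifs <;> simp_all
  · have hbf : (0 : ℝ) ≤ b + f := by exact_mod_cast not_lt.1 hc
    have hbr : (0 : ℝ) ≤ b := by exact_mod_cast hb
    have h3 : 0 < u.im := by
      rw [him]
      rcases hf with rfl | rfl <;> norm_num at hbf ⊢ <;> linarith
    have h4 : 0 < u.arg := by
      refine lt_of_le_of_ne (Complex.arg_nonneg_iff.2 h3.le) fun h => ?_
      have := (Complex.arg_eq_zero_iff.1 h.symm).2
      linarith
    rw [mem_Ioo_iff_quadrant h4 h2.2]
    simp only [qInd, hc, if_false]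
    split_ifs <;> simp_all

lemma qInd_eq_ite (N b : ℤ) : qInd N b = if qInd N b = 1 then 1 else 0 := by
  unfold qInd
  split_ifs <;> simp_all

lemma ncard_singleton_sep (q : ℤ × ℤ) (P : Prop) [Decidable P] :
    {v : List (ℤ × ℤ) | v = [q] ∧ P}.ncard = if P then 1 else 0 := by
  split_ifs with h
  · simp [h]
  · simp [h]

lemma contSet_card (z : ℂ) (j : ℕ) : ∀ s p θ, Describes z s p θ →
    (contSet z j p θ).Finite ∧ (contSet z j p θ).ncard = cnt j s := by
  classical
  induction j with
  | zero =>
    rintro ⟨N, a, b⟩ p θ (⟨h1, h2⟩ | ⟨ha, hb, ρ, hρ, hp, hθ⟩)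
    · rw [contSet_eq_empty h2]
      simp only at h1
      simp [cnt, h1]
    · simp only at ha hb hp hθ
      have hg : gInt a b ≠ 0 := fun h => by
        have := congrArg Complex.re h; simp at this; omega
      have hpz : ptC p ≠ z := by
        rintro h
        rw [h, sub_self, mul_zero] at hp
        exact mul_ne_zero hρ.ne_zero hg hp.symm
      obtain ⟨hfin, hcard⟩ := ncard_of_first_step (mem_contSet_zero (θ := θ) hpz)
        (fun d _ => (finite_singleton [p + d]).subset fun v hv => hv.1)
        (by rintro q w ⟨rfl, -⟩; rfl)
      refine ⟨hfin, ?_⟩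
      rw [hcard, sum_steps hρ (H := fun _ f => qInd N (b + f)) (G := fun d => ({v | v = [p + d] ∧
        θ + (((ptC p + ptC (p + d)) / 2 - z) / (ptC p - z)).arg ∈
          Ioo (-(π / 2)) (π / 2)} : Set (List (ℤ × ℤ))).ncard)]
      · simp only [cnt]
        rw [if_neg (by omega)]
        simp only [sub_eq_add_neg]
        ring
      · intro d e f he hf _ hd
        rw [ncard_singleton_sep, qInd_eq_ite]
        refine if_congr ?_ rfl rfl
        rw [← half_step_iff ha hb he hf, hθ, div_eq_of_rot hρ _ hp]
        rw [ptC_add]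
        linear_combination hp + hd / 2
  | succ j ih =>
    rintro ⟨N, a, b⟩ p θ (⟨h1, h2⟩ | ⟨ha, hb, ρ, hρ, hp, hθ⟩)
    · rw [contSet_eq_empty h2]
      simp only at h1
      simp [cnt, h1]
    · simp only at ha hb hp hθ
      have hg : gInt a b ≠ 0 := fun h => by
        have := congrArg Complex.re h; simp at this; omega
      have hpz : ptC p ≠ z := by
        rintro h
        rw [h, sub_self, mul_zero] at hp
        exact mul_ne_zero hρ.ne_zero hg hp.symm
      have key : ∀ d e f, (e = 1 ∨ e = -1) → (f = 1 ∨ f = -1) →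
          (1 - Complex.I) * ptC d = ρ * gInt e f → Describes z (nrm N (a + e) (b + f)) (p + d)
            (θ + ((ptC (p + d) - z) / (ptC p - z)).arg) := by
        intro d e f he hf hd
        have hq : (1 - Complex.I) * (ptC (p + d) - z) = ρ * gInt (a + e) (b + f) := by
          rw [ptC_add, gInt_add]
          linear_combination hp + hd
        refine describes_nrm hρ (by omega) hq fun h0 => ?_
        rw [div_eq_of_rot hρ hq hp, arg_div_of_re_pos _ _ h0, hθ]
        · ring
        · simp; omega
        · rw [gInt_re]
          exact_mod_cast (show 0 ≤ a + e by omega)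
      obtain ⟨hfin, hcard⟩ := ncard_of_first_step (mem_contSet_succ (j := j) (θ := θ) hpz)
        (fun d hd => by
          obtain ⟨e, f, he, hf, h⟩ := exists_gInt_of_step hρ hd
          exact (ih _ _ _ (key d e f he hf h)).1)
        (fun q w hw => hw.2.1)
      refine ⟨hfin, ?_⟩
      rw [hcard, sum_steps hρ (H := fun e f => cnt j (nrm N (a + e) (b + f)))
        (G := fun d => (contSet z j (p + d) (θ + ((ptC (p + d) - z) / (ptC p - z)).arg)).ncard)]
      · simp only [cnt]
        rw [if_neg (by omega)]
        simp only [nbr, sub_eq_add_neg]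
      · intro d e f he hf _ hd
        exact (ih _ _ _ (key d e f he hf hd)).2

lemma ptC_ne_half (p : ℤ × ℤ) : ptC p ≠ -(1 / 2) - (1 / 2) * Complex.I := by
  intro h
  have h1 := congrArg Complex.re h
  simp [ptC] at h1
  have h2 : (2 * p.1 : ℝ) = -1 := by rw [h1]; norm_num
  have h3 : 2 * p.1 = -1 := by exact_mod_cast h2
  omega

lemma add_mem_Ioo_iff (α x : ℝ) :
    -α + x ∈ Ioo (-(π / 2)) (π / 2) ↔ x ∈ Ioo (α - π / 2) (α + π / 2) := by
  simp only [mem_Ioo]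
  constructor <;> rintro ⟨h1, h2⟩ <;> constructor <;> linarith

lemma Nsq_eq (j : ℕ) (n : ℤ) : Nsq j (π / 2 * n) = cnt j (-n, 1, 0) := by
  have hd : Describes (-(1 / 2) - (1 / 2) * Complex.I) (-n, 1, 0) (0, 0) (-(π / 2 * n)) := by
    refine Or.inr ⟨le_rfl, le_rfl, 1, Or.inl rfl, ?_, ?_⟩
    · apply Complex.ext <;> simp [ptC]; norm_num
    · have : gInt 1 0 = 1 := by simp [gInt]
      rw [this, Complex.arg_one]
      push_cast
      ring
  rw [← (contSet_card _ j _ _ _ hd).2, Nsq, ← Nat.card_coe_set_eq]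
  refine Nat.card_congr (Equiv.subtypeEquivRight fun w => ?_)
  rw [← add_mem_Ioo_iff]
  refine and_congr_right fun _ => and_congr_right fun _ => and_congr_right fun _ => ?_
  exact (and_iff_right fun i _ => ptC_ne_half _).symm

lemma describes_one_one {d : ℤ × ℤ} (hd : d = (1, 0) ∨ d = (-1, 0) ∨ d = (0, 1) ∨ d = (0, -1))
    (n : ℤ) : Describes 0 (-(n + 1), 1, 1) d (-(π / 2 * n + π / 4)) := by
  have h11 : (gInt 1 1).arg = π / 4 := by
    have h := Complex.arg_mul_cos_add_sin_mul_I (r := √2) (by positivity) (θ := π / 4)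
      ⟨by linarith [Real.pi_pos], by linarith [Real.pi_pos]⟩
    rw [← h]
    congr 1
    have h2 : (√2 : ℝ) * √2 = 2 := Real.mul_self_sqrt (by norm_num)
    rw [← Complex.ofReal_cos, ← Complex.ofReal_sin, Real.cos_pi_div_four, Real.sin_pi_div_four]
    apply Complex.ext <;> simp <;> linarith
  obtain ⟨ρ, hρ, h⟩ : ∃ ρ, IsRot ρ ∧ (1 - Complex.I) * ptC d = ρ * gInt 1 1 := by
    rcases hd with rfl | rfl | rfl | rfl
    · refine ⟨-Complex.I, by simp [IsRot], ?_⟩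
      apply Complex.ext <;> simp [ptC]
    · refine ⟨Complex.I, by simp [IsRot], ?_⟩
      apply Complex.ext <;> simp [ptC]
    · refine ⟨1, by simp [IsRot], ?_⟩
      apply Complex.ext <;> simp [ptC]
    · refine ⟨-1, by simp [IsRot], ?_⟩
      apply Complex.ext <;> simp [ptC]
  refine Or.inr ⟨le_rfl, zero_le_one, ρ, hρ, by rwa [sub_zero], ?_⟩
  rw [h11]
  push_cast
  ring

lemma ptC_eq_zero_iff (p : ℤ × ℤ) : ptC p = 0 ↔ p = (0, 0) := by
  constructor
  · intro h
    have h1 := congrArg Complex.re h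
    have h2 := congrArg Complex.im h
    simp [ptC] at h1 h2
    exact Prod.ext h1 h2
  · rintro rfl
    simp [ptC]

lemma Nbu_succ (j : ℕ) (n : ℤ) :
    Nbu (j + 1) (π / 2 * n + π / 4) = 4 * cnt j (-(n + 1), 1, 1) := by
  set α := π / 2 * n + π / 4
  set A : Set (List (ℤ × ℤ)) := {w | w.length = j + 1 + 2 ∧ w.head? = some (0, 0) ∧
    w.IsChain IsRectStep ∧ (∀ i, 1 ≤ i → i ≤ j + 1 → w.getD i 0 ≠ (0, 0)) ∧
    windHalf w 0 2 ∈ Ioo (α - π / 2) (α + π / 2)}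
  have hA : ∀ w, w ∈ A ↔ ∃ q w', w = (0, 0) :: w' ∧ IsRectStep (0, 0) q ∧
      w' ∈ contSet 0 j q (-α) := by
    intro w
    simp only [A, contSet, add_mem_Ioo_iff, ne_eq, ptC_eq_zero_iff]
    constructor
    · rintro ⟨h1, h2, h3, h4, h5⟩
      match w with
      | [] => simp at h1
      | [_] => simp at h1
      | a :: q :: t =>
        obtain rfl : a = (0, 0) := by simpa using h2
        have h3' := List.isChain_cons_cons.1 h3
        refine ⟨q, q :: t, rfl, h3'.1, by simpa using h1, rfl, h3'.2, fun i hi => ?_, ?_⟩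
        · simpa using h4 (i + 1) (by omega) (by omega)
        · rwa [windHalf_cons_succ _ (by simp at h1 ⊢; omega) _ 0] at h5
    · rintro ⟨q, w', rfl, hs, h1, h2, h3, h4, h5⟩
      match w' with
      | [] => simp at h1
      | a :: t =>
        obtain rfl : a = q := by simpa using h2
        refine ⟨by simpa using h1, rfl, List.isChain_cons_cons.2 ⟨hs, h3⟩, fun i hi hi' => ?_, ?_⟩
        · obtain ⟨i, rfl⟩ : ∃ m, i = m + 1 := ⟨i - 1, by omega⟩
          simpa using h4 i (by omega)
        · rwa [windHalf_cons_succ _ (by simp at h1 ⊢; omega) _ 0]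
  have hz : ∀ d : ℤ × ℤ, ((0, 0) : ℤ × ℤ) + d = d := fun d => zero_add d
  have hc : ∀ d, (d = (1, 0) ∨ d = (-1, 0) ∨ d = (0, 1) ∨ d = (0, -1)) →
      (contSet 0 j ((0, 0) + d) (-α)).Finite ∧
        (contSet 0 j ((0, 0) + d) (-α)).ncard = cnt j (-(n + 1), 1, 1) := fun d hd => by
    rw [hz]
    exact contSet_card _ j _ _ _ (describes_one_one hd n)
  have h := (ncard_of_first_step hA (fun d hd => (hc d hd).1) (fun q w hw => hw.2.1)).2
  rw [(hc (1, 0) (by simp)).2, (hc (-1, 0) (by simp)).2, (hc (0, 1) (by simp)).2,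
    (hc (0, -1) (by simp)).2] at h
  calc Nbu (j + 1) α = A.ncard := (Nat.card_coe_set_eq A)
    _ = _ := by rw [h]; ring

lemma zero_mem_Ioo_iff (n : ℤ) :
    (0 : ℝ) ∈ Ioo (π / 2 * n + π / 4 - π / 2) (π / 2 * n + π / 4 + π / 2) ↔ n = 0 ∨ n = -1 := by
  have hpi := Real.pi_pos
  rw [← mem_Ioo_iff_quadrant (x := π / 4) (by linarith) (by linarith)]
  simp only [mem_Ioo]
  constructor <;> rintro ⟨h1, h2⟩ <;> constructor <;> linarith

lemma Nbu_zero (n : ℤ) :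
    Nbu 0 (π / 2 * n + π / 4) = 4 * (if n = 0 ∨ n = -1 then 1 else 0) := by
  classical
  set α := π / 2 * n + π / 4
  set A : Set (List (ℤ × ℤ)) := {w | w.length = 0 + 2 ∧ w.head? = some (0, 0) ∧
    w.IsChain IsRectStep ∧ (∀ i, 1 ≤ i → i ≤ 0 → w.getD i 0 ≠ (0, 0)) ∧
    windHalf w 0 2 ∈ Ioo (α - π / 2) (α + π / 2)}
  have hA : ∀ w, w ∈ A ↔ ∃ q w', w = (0, 0) :: w' ∧ IsRectStep (0, 0) q ∧
      w' ∈ {v | v = [q] ∧ (n = 0 ∨ n = -1)} := by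
    intro w
    rw [← zero_mem_Ioo_iff]
    have h0 : ∀ a b, windHalf [a, b] 0 2 = 0 := fun a b => by simp [windHalf]
    constructor
    · rintro ⟨h1, h2, h3, -, h5⟩
      obtain ⟨a, q, rfl⟩ := List.length_eq_two.1 h1
      obtain rfl : a = (0, 0) := by simpa using h2
      rw [h0] at h5
      exact ⟨q, [q], rfl, (List.isChain_cons_cons.1 h3).1, rfl, h5⟩
    · rintro ⟨q, w', rfl, hs, rfl, h⟩
      refine ⟨rfl, rfl, List.isChain_cons_cons.2 ⟨hs, List.isChain_singleton _⟩,
        fun i hi hi' => by omega, ?_⟩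
      rwa [h0]
  have h := (ncard_of_first_step hA (fun d _ => (finite_singleton _).subset fun v hv => hv.1)
    (by rintro q w ⟨rfl, -⟩; rfl)).2
  simp only [ncard_singleton_sep] at h
  calc Nbu 0 α = A.ncard := (Nat.card_coe_set_eq A)
    _ = _ := by rw [h]; ring

lemma hasSum_Nsq (hk : k ∈ Ioo (0 : ℝ) 1) (n : ℤ) :
    HasSum (fun j : ℕ => k ^ j * (1 - k) * (1 / 4 : ℝ) ^ (j + 1) * (Nsq j (π / 2 * n) : ℝ))
      (π / (2 * k * Kell k) * (1 / Real.cosh (4 * Tell k * (π / 2 * n))) +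
        (k - 1) / k * (if n = 0 then 1 else 0)) := by
  refine hasSum_of_eq (hasSum_cnt hk (s := (-n, 1, 0)) (Or.inl ⟨le_rfl, le_rfl⟩)) (fun j => ?_)
    (Vf_one_zero hk n).symm
  rw [Nsq_eq]

lemma hasSum_Nbu (hk : k ∈ Ioo (0 : ℝ) 1) (n : ℤ) :
    HasSum (fun j : ℕ => k ^ j * (1 - k) * (1 / 4 : ℝ) ^ (j + 1) *
      (Nbu j (π / 2 * n + π / 4) : ℝ))
      (π * Real.sinh (2 * π * Tell k) / (2 * Kell k) *
          (1 / Real.cosh (4 * Tell k * (π / 2 * n))) *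
          (1 / Real.cosh (4 * Tell k * (π / 2 * (n + 1 : ℤ))))) := by
  rw [← hasSum_nat_add_iff' 1, ← Vf_one_one hk]
  refine hasSum_of_eq ((hasSum_cnt hk (s := (-(n + 1), 1, 1))
    (Or.inl ⟨le_rfl, zero_le_one⟩)).mul_left k) (fun j => ?_) ?_
  · rw [Nbu_succ]
    push_cast
    ring
  · rw [Finset.sum_range_one, Nbu_zero]
    push_cast
    ring

end HypSec

/-- Theorem 18 (discrete hyperbolic secant laws): for a geometric time `ζ_k`, the winding
angle `θ^□_{ζ_k+1/2}` around `(-1/2,-1/2)` satisfies a discrete hyperbolic secant law on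
`(π/2)ℤ`, and the winding angle `θ^•_{ζ_k+1/2}` around the origin satisfies a discrete
hyperbolic secant squared law on `(π/2)ℤ + π/4`, with `c_k = π/(2kK(k))` and
`C_k = π sinh(2πT_k)/(2K(k))`. -/
theorem statement16 (k : ℝ) (hk : k ∈ Set.Ioo (0 : ℝ) 1) :
    (∀ ja : ℤ, ∀ α : ℝ, α = π / 2 * ja →
      Summable (fun j : ℕ => k ^ j * (1 - k) * (1 / 4 : ℝ) ^ (j + 1) * (Nsq j α : ℝ)) ∧
      (∑' j : ℕ, k ^ j * (1 - k) * (1 / 4 : ℝ) ^ (j + 1) * (Nsq j α : ℝ)) =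
        π / (2 * k * Kell k) * (1 / Real.cosh (4 * Tell k * α)) +
          (k - 1) / k * (if α = 0 then 1 else 0)) ∧
    (∀ ja : ℤ, ∀ α : ℝ, α = π / 2 * ja + π / 4 →
      Summable (fun j : ℕ => k ^ j * (1 - k) * (1 / 4 : ℝ) ^ (j + 1) * (Nbu j α : ℝ)) ∧
      (∑' j : ℕ, k ^ j * (1 - k) * (1 / 4 : ℝ) ^ (j + 1) * (Nbu j α : ℝ)) =
        π * Real.sinh (2 * π * Tell k) / (2 * Kell k) *
          (1 / Real.cosh (4 * Tell k * (α - π / 4))) *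
          (1 / Real.cosh (4 * Tell k * (α + π / 4)))) := by
  constructor
  · rintro n _ rfl
    have h := HypSec.hasSum_Nsq hk n
    refine ⟨h.summable, h.tsum_eq.trans ?_⟩
    have h0 : π / 2 * (n : ℝ) = 0 ↔ n = 0 := by simp [Real.pi_ne_zero]
    simp only [h0]
  · rintro n _ rfl
    have h := HypSec.hasSum_Nbu hk n
    refine ⟨h.summable, h.tsum_eq.trans ?_⟩
    congr 4
    · ring
    · push_cast
      ring

end
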